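/- The set of affine rational points of the hyperelliptic curve C : y² = 5x⁸ − 22x⁷ + 53x⁶ − 74x⁵ + 52x⁴ + 2x³ − 11x² + 2x + 1 is exactly {(0, 1), (0, −1)}: for x, y ∈ ℚ, y² = 5x⁸ − 22x⁷ + 53x⁶ − 74x⁵ + 52x⁴ + 2x³ − 11x² + 2x + 1 holds if and only if (x, y) = (0, 1) or (x, y) = (0, −1). -/

import Mathlib

open Polynomial NumberField Module
set_option linter.all false

theorem length_of_surj {M R : Type} [CommRing M] [CommRing R] (χ : M →+* R)
    (hs : Function.Surjective χ) (h : M) (hk : ∀ m, χ m = 0 ↔ h ∣ m) :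
    Ring.ord M h = Module.length R R := by
  letI := χ.toAlgebra
  have e1 : Module.length M R = Module.length R R := Module.length_eq_of_surjective hs
  rw [← e1, Ring.ord]
  have hker : LinearMap.ker (Algebra.linearMap M R) = Ideal.span {h} := by
    ext m
    rw [LinearMap.mem_ker, Ideal.mem_span_singleton]
    exact hk m
  have e2 := (LinearMap.quotKerEquivOfSurjective (Algebra.linearMap M R) hs).length_eq
  rw [hker] at e2
  exact e2

theorem length_pid {O : Type} [CommRing O] [IsDomain O] [IsPrincipalIdealRing O] (π : O)
    (hπ : Irreducible π) (v : ℕ) :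
    Module.length (O ⧸ Ideal.span {π^v}) (O ⧸ Ideal.span {π^v}) = v := by
  rw [← length_of_surj (Ideal.Quotient.mk (Ideal.span {π^v})) Ideal.Quotient.mk_surjective (π^v)
    (fun m => by rw [Ideal.Quotient.eq_zero_iff_mem, Ideal.mem_span_singleton])]
  rw [Ring.ord_pow (mem_nonZeroDivisors_of_ne_zero hπ.ne_zero), Ring.ord_of_irreducible hπ]
  simp

theorem even_of_ord {M : Type} [CommRing M] [IsNoetherianRing M] [Ring.KrullDimLE 1 M]
    (b d g h : M) (hid : b*b = (d*d)*(g*h)) (hg : IsUnit g) (hd : d ∈ nonZeroDivisors M)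
    (hh : h ∈ nonZeroDivisors M) (v : ℕ) (hord : Ring.ord M h = v) : Even v := by
  have hBn : b ∈ nonZeroDivisors M := by
    have : b*b ∈ nonZeroDivisors M := by
      rw [hid]
      exact mul_mem (mul_mem hd hd) (mul_mem hg.mem_nonZeroDivisors hh)
    exact (mul_mem_nonZeroDivisors.1 this).1
  have e1 := congrArg (Ring.ord M) hid
  rw [Ring.ord_mul _ hBn, Ring.ord_mul _ (mul_mem hg.mem_nonZeroDivisors hh), Ring.ord_mul _ hd,
    Ring.ord_mul_of_isUnit_left hg, hord] at e1
  obtain ⟨b, hb⟩ := ENat.ne_top_iff_exists.1 (Ring.ord_ne_top hBn)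
  obtain ⟨d, hd⟩ := ENat.ne_top_iff_exists.1 (Ring.ord_ne_top hd)
  rw [← hb, ← hd] at e1
  norm_cast at e1
  exact ⟨b - d, by omega⟩

theorem krull_aux (P : Ideal ℤ[X]) [P.IsPrime] (T : Type) [CommRing T] [IsDomain T]
    [Algebra ℤ[X] T] [IsLocalization.AtPrime T P] (M : Type) [CommRing M] (q : T →+* M)
    (hq : Function.Surjective q) (a : T) (ha : a ≠ 0) (hk : q a = 0) : Ring.KrullDimLE 1 M := by
  rw [Ring.krullDimLE_iff]
  have h1 : ringKrullDim (T ⧸ Ideal.span {a}) + 1 ≤ ringKrullDim T :=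
      ringKrullDim_quotient_succ_le_of_nonZeroDivisor (mem_nonZeroDivisors_of_ne_zero ha)
  have h2 : ringKrullDim T ≤ ringKrullDim ℤ[X] := by
    rw [IsLocalization.AtPrime.ringKrullDim_eq_height P T]
    exact Ideal.height_le_ringKrullDim_of_isPrime
  have h3 : ringKrullDim ℤ[X] = 2 := by
    rw [Polynomial.ringKrullDim_of_isNoetherianRing,
      IsPrincipalIdealRing.ringKrullDim_eq_one ℤ Int.not_isField]
    rfl
  have h4 : ringKrullDim M ≤ ringKrullDim (T ⧸ Ideal.span {a}) := by
    apply ringKrullDim_le_of_surjective (Ideal.Quotient.lift (Ideal.span {a}) q ?_)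
    · exact Ideal.Quotient.lift_surjective_of_surjective _ _ hq
    · intro x hx
      obtain ⟨c, rfl⟩ := Ideal.mem_span_singleton.1 hx
      rw [map_mul, hk, zero_mul]
  have h5 := h1.trans (h2.trans h3.le)
  rw [show (2 : WithBot ℕ∞) = 1 + 1 from rfl] at h5
  have h6 : ringKrullDim (T ⧸ Ideal.span {a}) ≤ 1 := by
    exact (ENat.WithBot.add_le_add_one_right_iff).1 h5
  exact h4.trans h6

theorem nzd_aux (P : Ideal ℤ[X]) [P.IsPrime] (T : Type) [CommRing T] [IsDomain T]
    [Algebra ℤ[X] T] [IsLocalization.AtPrime T P] (M : Type) [CommRing M] (q : T →+* M)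
    (hq : Function.Surjective q) (A : ℤ[X]) (hk : ∀ t, q t = 0 ↔ algebraMap ℤ[X] T A ∣ t)
    (Q : ℤ[X]) (hQ : ∀ u : ℤ[X], A ∣ Q*u → A ∣ u) :
    q (algebraMap ℤ[X] T Q) ∈ nonZeroDivisors M := by
  have hinj : Function.Injective (algebraMap ℤ[X] T) :=
    IsLocalization.injective T P.primeCompl_le_nonZeroDivisors
  rw [mem_nonZeroDivisors_iff_right]
  intro x hx
  obtain ⟨t, rfl⟩ := hq x
  rw [← map_mul, hk] at hx
  rw [hk]
  obtain ⟨⟨n, s⟩, hs⟩ := IsLocalization.surj P.primeCompl t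
  obtain ⟨w, hw⟩ := hx
  obtain ⟨⟨m, s'⟩, hs'⟩ := IsLocalization.surj P.primeCompl w
  simp only at hs hs'
  have h3 : Q*(n*s') = A*(m*s) := by
    apply hinj
    simp only [map_mul]
    rw [← hs, ← hs']
    linear_combination algebraMap ℤ[X] T s*algebraMap ℤ[X] T s'*hw
  obtain ⟨k, hk⟩ := hQ _ ⟨_, h3⟩
  have hu : IsUnit (algebraMap ℤ[X] T s*algebraMap ℤ[X] T s') :=
    (IsLocalization.map_units T s).mul (IsLocalization.map_units T s')
  rw [← hu.dvd_mul_right]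
  refine ⟨algebraMap ℤ[X] T k, ?_⟩
  rw [← map_mul (algebraMap ℤ[X] T) A, ← hk, map_mul, ← hs]; ring

theorem parity_T {O : Type} [CommRing O] [IsDomain O] [IsPrincipalIdealRing O] (φ : O)
    (H G : ℤ[X]) (hker : ∀ P : ℤ[X], aeval φ P = 0 → H ∣ P) (hH : aeval φ H = 0)
    (h2 : ∀ y : O, ∃ n : ℕ, ∃ P : ℤ[X], aeval φ P = 2^n*y)
    (π : O) (hπ : Irreducible π) (hπ2 : ¬ π ∣ 2) (hG : ¬ π ∣ aeval φ G)
    (A B : ℤ[X]) (D : ℤ) (hA0 : A ≠ 0)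
    (hA : A ∣ B^2 - C D^2*G*H)
    (hAD : ∀ u : ℤ[X], A ∣ C D*u → A ∣ u) (hAH : ∀ u : ℤ[X], A ∣ H*u → A ∣ u)
    (v : ℕ) (c : O) (hv : aeval φ A = π^v*c) (hc : ¬ π ∣ c)
    (P : Ideal ℤ[X]) [P.IsPrime] (hmem : ∀ Q, Q ∈ P ↔ π ∣ aeval φ Q)
    (T : Type) [CommRing T] [IsDomain T]
    [Algebra ℤ[X] T] [IsLocalization.AtPrime T P] (M : Type) [CommRing M] (q : T →+* M)
    (hq : Function.Surjective q) (hk : ∀ t, q t = 0 ↔ algebraMap ℤ[X] T A ∣ t) : Even v := by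
  have hinj : Function.Injective (algebraMap ℤ[X] T) :=
    IsLocalization.injective T P.primeCompl_le_nonZeroDivisors
  haveI : IsNoetherianRing T := IsLocalization.isNoetherianRing P.primeCompl T inferInstance
  haveI : IsNoetherianRing M := isNoetherianRing_of_surjective _ _ q hq
  have hqA : q (algebraMap ℤ[X] T A) = 0 := (hk _).2 dvd_rfl
  haveI : Ring.KrullDimLE 1 M := krull_aux P T M q hq (algebraMap ℤ[X] T A)
    (by rw [Ne, map_eq_zero_iff _ hinj]; exact hA0) hqA
  have hGu : IsUnit (q (algebraMap ℤ[X] T G)) :=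
    IsUnit.map q (IsLocalization.map_units T (⟨G, fun h => hG ((hmem G).1 h)⟩ : P.primeCompl))
  refine even_of_ord (q (algebraMap ℤ[X] T B)) (q (algebraMap ℤ[X] T (C D)))
    (q (algebraMap ℤ[X] T G)) (q (algebraMap ℤ[X] T H)) ?_ hGu
    (nzd_aux P T M q hq A hk _ hAD) (nzd_aux P T M q hq A hk _ hAH) v ?_
  · obtain ⟨k, hk⟩ := hA
    have := congrArg (fun x => q (algebraMap ℤ[X] T x)) hk
    simp only [map_sub, map_mul, map_pow, hqA, zero_mul] at this
    linear_combination this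
  -- the order
  have hcop : ∀ x : O, ¬ π ∣ x → IsUnit (Ideal.Quotient.mk (Ideal.span {π^v}) x) := by
    intro x hx
    have : IsCoprime (π^v) x := IsCoprime.pow_left ((hπ.coprime_iff_not_dvd).2 hx)
    obtain ⟨a, b, hab⟩ := this
    refine IsUnit.of_mul_eq_one (Ideal.Quotient.mk _ b) ?_
    rw [← map_mul, ← map_one (Ideal.Quotient.mk _), Ideal.Quotient.eq, Ideal.mem_span_singleton]
    exact ⟨-a, by linear_combination hab⟩
  let f : ℤ[X] →+* O ⧸ Ideal.span {π^v} :=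
    (Ideal.Quotient.mk (Ideal.span {π^v})).comp (aeval φ : ℤ[X] →ₐ[ℤ] O).toRingHom
  have hf : ∀ Q, f Q = Ideal.Quotient.mk (Ideal.span {π^v}) (aeval φ Q) := fun Q => rfl
  have hfu : ∀ y : P.primeCompl, IsUnit (f y) := fun y => by
    rw [hf]; exact hcop _ (fun h => y.2 ((hmem y).2 h))
  let g : T →+* O ⧸ Ideal.span {π^v} := IsLocalization.lift hfu
  have hg : ∀ Q, g (algebraMap ℤ[X] T Q) = f Q := fun Q => IsLocalization.lift_eq hfu Q
  have hf0 : ∀ Q, f Q = 0 ↔ π^v ∣ aeval φ Q := fun Q => by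
    rw [hf, Ideal.Quotient.eq_zero_iff_mem, Ideal.mem_span_singleton]
  have hgA : g (algebraMap ℤ[X] T A) = 0 := by
    rw [hg, hf0, hv]; exact dvd_mul_right _ _
  have h2P : ∀ n : ℕ, ¬ π ∣ (2 : O)^n := fun n h => hπ2 (hπ.prime.dvd_of_dvd_pow h)
  have hgs : Function.Surjective g := by
    intro y
    obtain ⟨y, rfl⟩ := Ideal.Quotient.mk_surjective y
    obtain ⟨n, Q, hQ⟩ := h2 y
    have h2n : (2 : ℤ[X])^n ∈ P.primeCompl := by
      intro h; exact h2P n (by simpa only [map_pow, map_ofNat] using (hmem _).1 h)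
    have hu := IsLocalization.map_units T (⟨2^n, h2n⟩ : P.primeCompl)
    obtain ⟨i, hi⟩ := hu.exists_right_inv
    simp only at hi
    refine ⟨algebraMap ℤ[X] T Q*i, ?_⟩
    have h5 := congrArg g hi
    rw [map_mul, hg, map_one, hf] at h5
    rw [map_mul, hg, hf, hQ]
    simp only [map_mul, map_pow, map_ofNat] at h5 ⊢
    linear_combination (Ideal.Quotient.mk (Ideal.span {π^v})) y*h5
  have hgk : ∀ t, g t = 0 → ∃ u w, t = algebraMap ℤ[X] T A*u + algebraMap ℤ[X] T H*w := by
    intro t ht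
    obtain ⟨⟨n, s⟩, hs⟩ := IsLocalization.surj P.primeCompl t
    simp only at hs
    have h6 : f n = 0 := by rw [← hg, ← hs, map_mul, ht, zero_mul]
    rw [hf0] at h6
    obtain ⟨y, hy⟩ := h6
    obtain ⟨m, Q, hQ⟩ := h2 y
    obtain ⟨k, R, hR⟩ := h2 c
    have h7 : aeval φ (2^m*R*n - 2^k*A*Q) = 0 := by
      simp only [map_sub, map_mul, map_pow, map_ofNat, hQ, hR, hy, hv]; ring
    obtain ⟨w, hw⟩ := hker _ h7
    have hR' : 2^m*R ∈ P.primeCompl := by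
      intro h
      have := (hmem _).1 h
      simp only [map_mul, map_pow, map_ofNat, hR] at this
      rcases hπ.prime.dvd_or_dvd this with h | h
      · exact h2P _ h
      · rcases hπ.prime.dvd_or_dvd h with h | h
        · exact h2P _ h
        · exact hc h
    obtain ⟨i, hi⟩ := (IsLocalization.map_units T (⟨2^m*R, hR'⟩ : P.primeCompl)).exists_right_inv
    obtain ⟨j, hj⟩ := (IsLocalization.map_units T s).exists_right_inv
    simp only at hi
    refine ⟨algebraMap ℤ[X] T (2^k*Q)*i*j, algebraMap ℤ[X] T w*i*j, ?_⟩
    have h8 := congrArg (algebraMap ℤ[X] T) hw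
    simp only [map_sub, map_mul] at h8 hi ⊢
    linear_combination i*j*h8 - t*hi + (-t)*(algebraMap ℤ[X] T (2^m)*algebraMap ℤ[X] T R*i)*hj + algebraMap ℤ[X] T (2^m)*algebraMap ℤ[X] T R*i*j*hs
  let χ : M →+* O ⧸ Ideal.span {π^v} := RingHom.liftOfSurjective q hq ⟨g, fun t ht => by
    rw [RingHom.mem_ker, hk] at ht
    obtain ⟨r, rfl⟩ := ht
    rw [RingHom.mem_ker, map_mul, hgA, zero_mul]⟩
  have hχ : ∀ t, χ (q t) = g t := fun t => RingHom.liftOfRightInverse_comp_apply _ _ _ _ t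
  rw [length_of_surj χ ?_ _ ?_, length_pid π hπ]
  · intro y
    obtain ⟨t, rfl⟩ := hgs y
    exact ⟨q t, hχ t⟩
  · intro m
    obtain ⟨t, rfl⟩ := hq m
    rw [hχ]
    constructor
    · intro h
      obtain ⟨u, w, rfl⟩ := hgk t h
      rw [map_add, map_mul, hqA, zero_mul, zero_add, map_mul]
      exact dvd_mul_right _ _
    · rintro ⟨w, hw⟩
      obtain ⟨w, rfl⟩ := hq w
      rw [← hχ, hw, map_mul, hχ, hg, hf, hH, map_zero, zero_mul]

theorem parity_aux {O : Type} [CommRing O] [IsDomain O] [IsPrincipalIdealRing O] (φ : O)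
    (H G : ℤ[X]) (hker : ∀ P : ℤ[X], aeval φ P = 0 → H ∣ P) (hH : aeval φ H = 0)
    (h2 : ∀ y : O, ∃ n : ℕ, ∃ P : ℤ[X], aeval φ P = 2^n*y)
    (π : O) (hπ : Irreducible π) (hπ2 : ¬ π ∣ 2) (hG : ¬ π ∣ aeval φ G)
    (A B : ℤ[X]) (D : ℤ) (hA0 : A ≠ 0)
    (hA : A ∣ B^2 - C D^2*G*H)
    (hAD : ∀ u : ℤ[X], A ∣ C D*u → A ∣ u) (hAH : ∀ u : ℤ[X], A ∣ H*u → A ∣ u)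
    (v : ℕ) (c : O) (hv : aeval φ A = π^v*c) (hc : ¬ π ∣ c) : Even v := by
  haveI hI : (Ideal.span {π}).IsPrime := (Ideal.span_singleton_prime hπ.ne_zero).2 hπ.prime
  haveI : ((Ideal.span {π}).comap (aeval φ : ℤ[X] →ₐ[ℤ] O).toRingHom).IsPrime :=
    Ideal.comap_isPrime _ _
  refine parity_T φ H G hker hH h2 π hπ hπ2 hG A B D hA0 hA hAD hAH v c hv hc
    ((Ideal.span {π}).comap (aeval φ : ℤ[X] →ₐ[ℤ] O).toRingHom) (fun Q => ?_)
    (Localization.AtPrime ((Ideal.span {π}).comap (aeval φ : ℤ[X] →ₐ[ℤ] O).toRingHom))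
    (_ ⧸ Ideal.span {algebraMap ℤ[X] (Localization.AtPrime ((Ideal.span {π}).comap (aeval φ : ℤ[X] →ₐ[ℤ] O).toRingHom)) A}) (Ideal.Quotient.mk _) Ideal.Quotient.mk_surjective
    (fun t => ?_)
  · rw [Ideal.mem_comap, Ideal.mem_span_singleton]; rfl
  · rw [Ideal.Quotient.eq_zero_iff_mem, Ideal.mem_span_singleton]

/-- elements in the integral basis for the quintic field -/
def E5 {R : Type} [CommRing R] (f b : R) (a0 a1 a2 a3 a4 : ℤ) : R :=
  a0 + a1*f + a2*f^2 + a3*b + a4*(f*b)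

structure RelL {R : Type} [CommRing R] (f b : R) : Prop where
  r1 : f^3 = 2*b - 1
  r2 : f^2*b = -6 + 8*f - 10*f^2 + 7*b + f*b
  r3 : b^2 = 2 + f - f^2 - 6*b + 4*(f*b)

theorem E5_mul {R : Type} [CommRing R] {f b : R} (h : RelL f b) (a0 a1 a2 a3 a4 b0 b1 b2 b3 b4 : ℤ) :
    E5 f b a0 a1 a2 a3 a4*E5 f b b0 b1 b2 b3 b4 = E5 f b
      (a0*b0 - (a1*b2+a2*b1) - 6*(a1*b4+a4*b1+a2*b3+a3*b2) + 4*(a2*b4+a4*b2) + 2*a3*b3 - 23*(a3*b4+a4*b3) + 51*a4*b4)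
      (a0*b1+a1*b0 + 8*(a1*b4+a4*b1+a2*b3+a3*b2) - a2*b2 + 2*(a2*b4+a4*b2) + a3*b3 + 34*(a3*b4+a4*b3) - 39*a4*b4)
      (a0*b2+a2*b0+a1*b1 - 10*(a1*b4+a4*b1+a2*b3+a3*b2) - 2*(a2*b4+a4*b2) - a3*b3 - 39*(a3*b4+a4*b3) + 54*a4*b4)
      (a0*b3+a3*b0+2*(a1*b2+a2*b1) + 7*(a1*b4+a4*b1+a2*b3+a3*b2) - 13*(a2*b4+a4*b2) - 6*a3*b3 + 26*(a3*b4+a4*b3) - 92*a4*b4)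
      (a0*b4+a4*b0+a1*b3+a3*b1 + (a1*b4+a4*b1+a2*b3+a3*b2) + 2*a2*b2 + 8*(a2*b4+a4*b2) + 4*a3*b3 - 2*(a3*b4+a4*b3) + 24*a4*b4) := by
  obtain ⟨r1, r2, r3⟩ := h
  unfold E5
  push_cast
  linear_combination ((a1:R)*b2+a2*b1)*r1 + (a2:R)*b2*f*r1 + ((a1:R)*b4+a4*b1+a2*b3+a3*b2)*r2 + ((a2:R)*b4+a4*b2)*(f*r2 -10*r1+r2) + (a3:R)*b3*r3 + ((a3:R)*b4+a4*b3)*(f*r3 - r1+4*r2) + (a4:R)*b4*(f^2*r3 + r1 -f*r1 -6*r2+4*(f*r2-10*r1+r2))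

theorem relL_of {R : Type} [CommRing R] [IsDomain R] [CharZero R] (f b : R)
    (hf : f^5 - f^4 - 7*f^3 + 21*f^2 - 17*f + 5 = 0) (hb : 2*b = 1 + f^3) :
    RelL f b := by
  have h2 : (2 : R) ≠ 0 := two_ne_zero
  have h4 : (4 : R) ≠ 0 := by norm_num
  refine ⟨by linear_combination -hb, ?_, ?_⟩
  · apply mul_left_cancel₀ h2
    linear_combination (f^2 - f - 7)*hb + hf
  · apply mul_left_cancel₀ h4
    linear_combination (2*b + f^3 + 1 - 8*f + 12)*hb + (f+1)*hf

theorem irrH : Irreducible (X^5 - X^4 - 7*X^3 + 21*X^2 - 17*X + 5 : ℤ[X]) := by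
  have hm : (X^5 - X^4 - 7*X^3 + 21*X^2 - 17*X + 5 : ℤ[X]).Monic := by monicity!
  have hd : (X^5 - X^4 - 7*X^3 + 21*X^2 - 17*X + 5 : ℤ[X]).natDegree = 5 := by
    compute_degree!
  have hc : ∀ i, (X^5 - X^4 - 7*X^3 + 21*X^2 - 17*X + 5 : ℤ[X]).coeff i =
      if i = 5 then 1 else if i = 4 then -1 else if i = 3 then -7 else if i = 2 then 21
        else if i = 1 then -17 else if i = 0 then 5 else 0 := by
    intro i
    have : (X^5 - X^4 - 7*X^3 + 21*X^2 - 17*X + 5 : ℤ[X]) =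
      X^5 - X^4 - C 7*X^3 + C 21*X^2 - C 17*X^1 + C 5*X^0 := by simp
    rw [this]
    simp only [coeff_add, coeff_sub, coeff_C_mul, coeff_X_pow]
    split_ifs <;> first | omega | simp
  rw [hm.irreducible_iff_natDegree']
  refine ⟨fun h => by rw [h] at hd; simp at hd, ?_⟩
  intro f g hf hg hfg hgd
  rw [hd] at hgd
  have hdd := hf.natDegree_mul hg
  rw [hfg, hd] at hdd
  have hgd' : g.natDegree = 1 ∨ g.natDegree = 2 := by
    rw [Finset.mem_Ioc] at hgd; omega
  have key : ∀ i, (X^5 - X^4 - 7*X^3 + 21*X^2 - 17*X + 5 : ℤ[X]).coeff i =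
      ∑ j ∈ Finset.range (i+1), f.coeff j*g.coeff (i - j) := fun i => by
    rw [← hfg, coeff_mul, Finset.Nat.sum_antidiagonal_eq_sum_range_succ_mk]
  have k0 := key 0
  have k1 := key 1
  have k2 := key 2
  have k3 := key 3
  have k4 := key 4
  rw [hc] at k0 k1 k2 k3 k4
  norm_num [Finset.sum_range_succ] at k0 k1 k2 k3 k4
  rcases hgd' with h | h
  · have hf4 : f.coeff 4 = 1 := by
      have := hf.coeff_natDegree; rwa [show f.natDegree = 4 by omega] at this
    have hg1 : g.coeff 1 = 1 := by
      have := hg.coeff_natDegree; rwa [h] at this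
    have hg2 : ∀ i, 2 ≤ i → g.coeff i = 0 := fun i hi => coeff_eq_zero_of_natDegree_lt (by omega)
    simp only [hg2 4 (by omega), hg2 3 (by omega), hg2 2 (by omega), hg1, hf4] at k0 k1 k2 k3 k4
    have q0 := congrArg (Int.cast : ℤ → ZMod 7) k0
    have q1 := congrArg (Int.cast : ℤ → ZMod 7) k1
    have q2 := congrArg (Int.cast : ℤ → ZMod 7) k2
    have q3 := congrArg (Int.cast : ℤ → ZMod 7) k3
    have q4 := congrArg (Int.cast : ℤ → ZMod 7) k4
    push_cast at q0 q1 q2 q3 q4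
    generalize (f.coeff 0 : ZMod 7) = u0 at *
    generalize (f.coeff 1 : ZMod 7) = u1 at *
    generalize (f.coeff 2 : ZMod 7) = u2 at *
    generalize (f.coeff 3 : ZMod 7) = u3 at *
    generalize (g.coeff 0 : ZMod 7) = v0 at *
    have e3 : u3 = -1 - v0 := by linear_combination -q4
    have e2 : u2 = -7 - u3*v0 := by linear_combination -q3
    have e1 : u1 = 21 - u2*v0 := by linear_combination -q2
    have e0 : u0 = -17 - u1*v0 := by linear_combination -q1
    subst e3 e2 e1 e0
    revert v0
    decide
  · have hf4 : f.coeff 3 = 1 := by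
      have := hf.coeff_natDegree; rwa [show f.natDegree = 3 by omega] at this
    have hf5 : f.coeff 4 = 0 := coeff_eq_zero_of_natDegree_lt (by omega)
    have hg1 : g.coeff 2 = 1 := by
      have := hg.coeff_natDegree; rwa [h] at this
    have hg2 : ∀ i, 3 ≤ i → g.coeff i = 0 := fun i hi => coeff_eq_zero_of_natDegree_lt (by omega)
    simp only [hg2 4 (by omega), hg2 3 (by omega), hg1, hf4, hf5] at k0 k1 k2 k3 k4
    have q0 := congrArg (Int.cast : ℤ → ZMod 7) k0
    have q1 := congrArg (Int.cast : ℤ → ZMod 7) k1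
    have q2 := congrArg (Int.cast : ℤ → ZMod 7) k2
    have q3 := congrArg (Int.cast : ℤ → ZMod 7) k3
    have q4 := congrArg (Int.cast : ℤ → ZMod 7) k4
    push_cast at q0 q1 q2 q3 q4
    generalize (f.coeff 0 : ZMod 7) = u0 at *
    generalize (f.coeff 1 : ZMod 7) = u1 at *
    generalize (f.coeff 2 : ZMod 7) = u2 at *
    generalize (g.coeff 0 : ZMod 7) = v0 at *
    generalize (g.coeff 1 : ZMod 7) = v1 at *
    have e2 : u2 = -1 - v1 := by linear_combination -q4
    have e1 : u1 = -7 - u2*v1 - v0 := by linear_combination -q3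
    have e0 : u0 = 21 - u2*v0 - u1*v1 := by linear_combination -q2
    subst e2 e1 e0
    revert v0 v1
    decide

structure FL (L : Type) [Field L] [NumberField L] (f b : 𝓞 L) : Prop where
  hf : f^5 - f^4 - 7*f^3 + 21*f^2 - 17*f + 5 = 0
  hb : 2*b = 1 + f^3
  hfr : Module.finrank ℚ L = 5

theorem irrHQ : Irreducible (X^5 - X^4 - 7*X^3 + 21*X^2 - 17*X + 5 : ℚ[X]) := by
  have hm : (X^5 - X^4 - 7*X^3 + 21*X^2 - 17*X + 5 : ℤ[X]).Monic := by monicity!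
  have := (hm.irreducible_iff_irreducible_map_fraction_map (K := ℚ)).1 irrH
  simpa using this

theorem minpolyH {L : Type} [Field L] [CharZero L] (x : L)
    (hx : x^5 - x^4 - 7*x^3 + 21*x^2 - 17*x + 5 = 0) :
    minpoly ℚ x = X^5 - X^4 - 7*X^3 + 21*X^2 - 17*X + 5 := by
  symm
  apply minpoly.eq_of_irreducible_of_monic irrHQ
  · simpa [map_ofNat] using hx
  · monicity!

theorem indepH {L : Type} [Field L] [CharZero L] (x : L)
    (hx : x^5 - x^4 - 7*x^3 + 21*x^2 - 17*x + 5 = 0) (c0 c1 c2 c3 c4 : ℚ)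
    (h : (c0 : L) + c1*x + c2*x^2 + c3*x^3 + c4*x^4 = 0) :
    c0 = 0 ∧ c1 = 0 ∧ c2 = 0 ∧ c3 = 0 ∧ c4 = 0 := by
  set p : ℚ[X] := C c4*X^4 + C c3*X^3 + C c2*X^2 + C c1*X + C c0 with hp
  have h1 : aeval x p = 0 := by
    simp only [hp, map_add, map_mul, aeval_C, map_pow, aeval_X, eq_ratCast]
    linear_combination h
  have h2 : p = 0 := by
    by_contra hne
    have h3 := minpoly.degree_le_of_ne_zero ℚ x hne h1
    rw [minpolyH x hx] at h3
    have h4 : (X^5 - X^4 - 7*X^3 + 21*X^2 - 17*X + 5 : ℚ[X]).degree = 5 := by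
      compute_degree!
    have h5 : p.degree ≤ 4 := by rw [hp]; compute_degree
    rw [h4] at h3
    exact absurd (h3.trans h5) (by decide)
  have hc : ∀ i, p.coeff i = 0 := fun i => by rw [h2]; simp
  refine ⟨?_, ?_, ?_, ?_, ?_⟩
  · have := hc 0; simpa [hp, coeff_X, coeff_X_pow, coeff_C] using this
  · have := hc 1; simpa [hp, coeff_X, coeff_X_pow, coeff_C] using this
  · have := hc 2; simpa [hp, coeff_X, coeff_X_pow, coeff_C] using this
  · have := hc 3; simpa [hp, coeff_X, coeff_X_pow, coeff_C] using this
  · have := hc 4; simpa [hp, coeff_X, coeff_X_pow, coeff_C] using this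

theorem exFL {L : Type} [Field L] [NumberField L] (x : L)
    (hx : x^5 - x^4 - 7*x^3 + 21*x^2 - 17*x + 5 = 0)
    (hfr : Module.finrank ℚ L = 5) : ∃ f b : 𝓞 L, (f : L) = x ∧ FL L f b := by
  have hxi : IsIntegral ℤ x := ⟨X^5 - X^4 - 7*X^3 + 21*X^2 - 17*X + 5, by monicity!,
    by simpa using hx⟩
  have hr : RelL x ((1 + x^3) / 2) := relL_of x _ hx (by ring)
  have hbi : IsIntegral ℤ ((1 + x^3) / 2) := by
    refine ⟨X^5 + 18*X^4 - 2*X^3 + 250*X^2 - 263*X + 72, by monicity!, ?_⟩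
    have e1 : (1 + x^3) / 2 = E5 x ((1 + x^3) / 2) 0 0 0 1 0 := by simp [E5]
    have e2 : ((1 + x^3) / 2)^2 = E5 x ((1 + x^3) / 2) 2 1 (-1) (-6) 4 := by
      rw [hr.r3]; simp [E5]; ring
    have e3 : ((1 + x^3) / 2)^3 = ((1 + x^3) / 2)^2*((1 + x^3) / 2) := by ring
    have e4 : ((1 + x^3) / 2)^4 = ((1 + x^3) / 2)^2*((1 + x^3) / 2)^2 := by ring
    have e5 : ((1 + x^3) / 2)^5 = ((1 + x^3) / 2)^2*((1 + x^3) / 2)^2*((1 + x^3) / 2) := by ring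
    rw [e2] at e3 e4 e5
    generalize (1 + x^3) / 2 = b at *
    have e6 : E5 x b 2 1 (-1) (-6) 4*b = E5 x b 2 1 (-1) (-6) 4*E5 x b 0 0 0 1 0 := by rw [← e1]
    rw [e6, E5_mul hr] at e3
    rw [E5_mul hr] at e4
    rw [E5_mul hr] at e5
    have e7 : ∀ a0 a1 a2 a3 a4, E5 x b a0 a1 a2 a3 a4*b = E5 x b a0 a1 a2 a3 a4*E5 x b 0 0 0 1 0 := by
      intros; rw [← e1]
    rw [e7, E5_mul hr] at e5
    simp only [eval₂_add, eval₂_sub, eval₂_mul, eval₂_pow, eval₂_X, eval₂_ofNat, e2, e3, e4, e5]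
    simp only [E5]
    push_cast
    ring
  refine ⟨⟨x, hxi⟩, ⟨_, hbi⟩, rfl, ⟨?_, ?_, hfr⟩⟩
  · apply RingOfIntegers.ext
    simp only [map_add, map_sub, map_mul, map_pow, map_ofNat, map_zero]
    exact hx
  · apply RingOfIntegers.ext
    simp only [map_add, map_sub, map_mul, map_pow, map_ofNat, map_one]
    change 2*((1 + x^3) / 2) = 1 + x^3
    ring

theorem index_gen {F : Type} [Field F] [NumberField F] (n : ℕ) (hn : finrank ℚ F = n) (w : Fin n → 𝓞 F) :
    ∃ d : ℤ, Algebra.discr ℤ w = d^2*discr F ∧ ∀ y : 𝓞 F, ∃ c : Fin n → ℤ,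
      d • y = ∑ i, c i • w i := by
  classical
  have hc : Fintype.card (Free.ChooseBasisIndex ℤ (𝓞 F)) = n := by
    rw [← hn, ← RingOfIntegers.rank F, finrank_eq_card_basis (RingOfIntegers.basis F)]
  let e := Fintype.equivFinOfCardEq hc
  let b : Basis (Fin n) ℤ (𝓞 F) := (RingOfIntegers.basis F).reindex e
  have hb : Algebra.discr ℤ b = discr F := by
    rw [Basis.coe_reindex]
    exact Algebra.discr_reindex ℤ (RingOfIntegers.basis F) e
  refine ⟨(b.toMatrix w).det, ?_, fun y => ⟨(b.toMatrix w).adjugate.mulVec (b.repr y), ?_⟩⟩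
  · rw [← hb, ← Algebra.discr_of_matrix_vecMul, Basis.toMatrix_map_vecMul]
  · set P := b.toMatrix w with hP
    set c := P.adjugate.mulVec (b.repr y)
    have h1 : P.mulVec c = P.det • (b.repr y : Fin n → ℤ) := by
      rw [Matrix.mulVec_mulVec, Matrix.mul_adjugate, Matrix.smul_mulVec, Matrix.one_mulVec]
    have h2 : ∑ i, c i • w i = ∑ k, (P.mulVec c) k • b k := by
      simp_rw [← b.sum_toMatrix_smul_self w, Finset.smul_sum, Matrix.mulVec, dotProduct,
        Finset.sum_smul]
      rw [Finset.sum_comm]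
      refine Finset.sum_congr rfl fun i _ => Finset.sum_congr rfl fun j _ => ?_
      rw [smul_smul, mul_comm]
    rw [h2, h1]
    simp only [Pi.smul_apply, smul_eq_mul, mul_smul, ← Finset.smul_sum]
    rw [b.sum_repr]

section
variable {L : Type} [Field L] [NumberField L] {f b : 𝓞 L}

theorem FL.hx (h : FL L f b) : (f : L)^5 - (f : L)^4 - 7*(f : L)^3 + 21*(f : L)^2 - 17*(f : L) + 5 = 0 := by
  have := congrArg (algebraMap (𝓞 L) L) h.hf
  simpa only [map_add, map_sub, map_mul, map_pow, map_ofNat, map_zero] using this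

theorem FL.hbx (h : FL L f b) : 2*(b : L) = 1 + (f : L)^3 := by
  have := congrArg (algebraMap (𝓞 L) L) h.hb
  simpa only [map_add, map_sub, map_mul, map_pow, map_ofNat, map_one] using this

theorem FL.rel (h : FL L f b) : RelL f b := relL_of f b h.hf h.hb
theorem FL.relx (h : FL L f b) : RelL (f : L) (b : L) := relL_of _ _ h.hx h.hbx

theorem E5_coe (a0 a1 a2 a3 a4 : ℤ) : ((E5 f b a0 a1 a2 a3 a4 : 𝓞 L) : L) = E5 (f : L) (b : L) a0 a1 a2 a3 a4 := by
  simp [E5]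

theorem FL.exBasis (h : FL L f b) : ∃ w : Basis (Fin 5) ℚ L, (∀ i, w i = ![1, (f : L), (f : L)^2, (b : L), f*b] i) ∧
    ∀ a0 a1 a2 a3 a4 : ℤ, ∀ i, w.repr (E5 (f : L) (b : L) a0 a1 a2 a3 a4) i = ![(a0 : ℚ), a1, a2, a3, a4] i := by
  have hli : LinearIndependent ℚ ![1, (f : L), (f : L)^2, (b : L), (f : L)*b] := by
    rw [Fintype.linearIndependent_iff]
    intro g hg
    simp only [Fin.sum_univ_five, Matrix.cons_val, Algebra.smul_def, eq_ratCast] at hg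
    have := indepH (f : L) h.hx (g 0 + g 3 / 2) (g 1 + g 4 / 2) (g 2) (g 3 / 2) (g 4 / 2) (by
      push_cast
      linear_combination hg - (g 3 / 2 + g 4 / 2*(f : L))*h.hbx)
    obtain ⟨h0, h1, h2, h3, h4⟩ := this
    intro i
    fin_cases i <;> simp only [Fin.zero_eta, Fin.mk_one, Fin.reduceFinMk] <;> linarith
  let w := basisOfLinearIndependentOfCardEqFinrank hli (by rw [h.hfr]; rfl)
  have hw : ∀ i, w i = ![1, (f : L), (f : L)^2, (b : L), (f : L)*b] i := fun i => by
    simp [w]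
  refine ⟨w, hw, fun a0 a1 a2 a3 a4 i => ?_⟩
  have : E5 (f : L) (b : L) a0 a1 a2 a3 a4 = ∑ j, (![(a0 : ℚ), a1, a2, a3, a4] j) • w j := by
    simp only [hw, Fin.sum_univ_five, Matrix.cons_val, Algebra.smul_def, eq_ratCast, E5]
    push_cast
    ring
  rw [this, Basis.repr_sum_self]

def M5 (a0 a1 a2 a3 a4 : ℤ) : Matrix (Fin 5) (Fin 5) ℤ :=
  !![a0, -a2-6*a4, -a1-6*a3+4*a4, -6*a2+2*a3-23*a4, -6*a1+4*a2-23*a3+51*a4;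
     a1, a0+8*a4, -a2+8*a3+2*a4, 8*a2+a3+34*a4, 8*a1+2*a2+34*a3-39*a4;
     a2, a1-10*a4, a0-10*a3-2*a4, -10*a2-a3-39*a4, -10*a1-2*a2-39*a3+54*a4;
     a3, 2*a2+7*a4, 2*a1+7*a3-13*a4, a0+7*a2-6*a3+26*a4, 7*a1-13*a2+26*a3-92*a4;
     a4, a3+a4, 2*a2+a3+8*a4, a1+a2+4*a3-2*a4, a0+a1+8*a2-2*a3+24*a4]

theorem FL.leftMul (h : FL L f b) (w : Basis (Fin 5) ℚ L)
    (hw : ∀ i, w i = ![1, (f : L), (f : L)^2, (b : L), f*b] i)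
    (hr : ∀ a0 a1 a2 a3 a4 : ℤ, ∀ i, w.repr (E5 (f : L) (b : L) a0 a1 a2 a3 a4) i = ![(a0 : ℚ), a1, a2, a3, a4] i)
    (a0 a1 a2 a3 a4 : ℤ) :
    Algebra.leftMulMatrix w (E5 (f : L) (b : L) a0 a1 a2 a3 a4) = (M5 a0 a1 a2 a3 a4).map (Int.cast : ℤ → ℚ) := by
  have e : ∀ j, w j = E5 (f : L) (b : L) (![1,0,0,0,0] j) (![0,1,0,0,0] j) (![0,0,1,0,0] j) (![0,0,0,1,0] j) (![0,0,0,0,1] j) := by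
    intro j
    rw [hw]
    fin_cases j <;> simp [E5]
  ext i j
  rw [Algebra.leftMulMatrix_eq_repr_mul, e j, E5_mul h.relx, hr, Matrix.map_apply]
  fin_cases i <;> fin_cases j <;> simp [M5] <;> ring

theorem FL.trace (h : FL L f b) (a0 a1 a2 a3 a4 : ℤ) :
    Algebra.trace ℤ (𝓞 L) (E5 f b a0 a1 a2 a3 a4) = 5*a0 + a1 + 15*a2 - 18*a3 + 56*a4 := by
  obtain ⟨w, hw, hr⟩ := h.exBasis
  have : ((Algebra.trace ℤ (𝓞 L) (E5 f b a0 a1 a2 a3 a4) : ℤ) : ℚ) = ((5*a0 + a1 + 15*a2 - 18*a3 + 56*a4 : ℤ) : ℚ) := by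
    rw [Algebra.coe_trace_int, E5_coe, Algebra.trace_eq_matrix_trace w, h.leftMul w hw hr]
    simp [Matrix.trace, Fin.sum_univ_five, M5]
    ring
  exact_mod_cast this

theorem FL.norm (h : FL L f b) (a0 a1 a2 a3 a4 : ℤ) :
    Algebra.norm ℤ (E5 f b a0 a1 a2 a3 a4) = (M5 a0 a1 a2 a3 a4).det := by
  obtain ⟨w, hw, hr⟩ := h.exBasis
  have : ((Algebra.norm ℤ (E5 f b a0 a1 a2 a3 a4) : ℤ) : ℚ) = (((M5 a0 a1 a2 a3 a4).det : ℤ) : ℚ) := by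
    rw [Algebra.coe_norm_int, E5_coe, Algebra.norm_eq_matrix_det w, h.leftMul w hw hr, Int.cast_det]
  exact_mod_cast this

theorem FL.discrE (h : FL L f b) : Algebra.discr ℤ ![1, f, f^2, b, f*b] = 509744 := by
  have e : ∀ j, (![1, f, f^2, b, f*b] : Fin 5 → 𝓞 L) j = E5 f b (![1,0,0,0,0] j) (![0,1,0,0,0] j) (![0,0,1,0,0] j) (![0,0,0,1,0] j) (![0,0,0,0,1] j) := by
    intro j
    fin_cases j <;> simp [E5]
  have hm : Algebra.traceMatrix ℤ (![1, f, f^2, b, f*b] : Fin 5 → 𝓞 L) =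
    !![5, 1, 15, -18, 56; 1, 15, -41, 56, -242; 15, -41, 111, -242, 674; -18, 56, -242, 328, -1246; 56, -242, 674, -1246, 4026] := by
    ext i j
    rw [Algebra.traceMatrix_apply, Algebra.traceForm_apply, e i, e j, E5_mul h.rel, h.trace]
    fin_cases i <;> fin_cases j <;> simp
  rw [Algebra.discr_def, hm]
  decide +kernel

end

section
variable {L : Type} [Field L] [NumberField L] {f b : 𝓞 L}

def IsE (f b : 𝓞 L) (y : 𝓞 L) : Prop := ∃ a0 a1 a2 a3 a4 : ℤ, y = E5 f b a0 a1 a2 a3 a4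

theorem IsE.add {y z : 𝓞 L} (hy : IsE f b y) (hz : IsE f b z) : IsE f b (y + z) := by
  obtain ⟨a0, a1, a2, a3, a4, rfl⟩ := hy
  obtain ⟨b0, b1, b2, b3, b4, rfl⟩ := hz
  refine ⟨a0 + b0, a1 + b1, a2 + b2, a3 + b3, a4 + b4, ?_⟩
  simp only [E5]; push_cast; ring

theorem FL.isE_mul (h : FL L f b) {y z : 𝓞 L} (hy : IsE f b y) (hz : IsE f b z) : IsE f b (y*z) := by
  obtain ⟨a0, a1, a2, a3, a4, rfl⟩ := hy
  obtain ⟨b0, b1, b2, b3, b4, rfl⟩ := hz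
  exact ⟨_, _, _, _, _, E5_mul h.rel _ _ _ _ _ _ _ _ _ _⟩

theorem IsE.int (k : ℤ) : IsE f b (k : 𝓞 L) := ⟨k, 0, 0, 0, 0, by simp [E5]⟩
theorem IsE.mk (a0 a1 a2 a3 a4 : ℤ) : IsE f b (E5 f b a0 a1 a2 a3 a4) := ⟨a0, a1, a2, a3, a4, rfl⟩

theorem FL.dvd_norm (h : FL L f b) (a0 a1 a2 a3 a4 b0 b1 b2 b3 b4 : ℤ)
    (hd : E5 f b a0 a1 a2 a3 a4 ∣ E5 f b b0 b1 b2 b3 b4) :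
    (M5 a0 a1 a2 a3 a4).det ∣ (M5 b0 b1 b2 b3 b4).det := by
  rw [← h.norm, ← h.norm]
  exact map_dvd _ hd

theorem E5_eqs {R : Type} [CommRing R] (f b : R) : f = E5 f b 0 1 0 0 0 ∧ f^2 = E5 f b 0 0 1 0 0 ∧ b = E5 f b 0 0 0 1 0 ∧
    f*b = E5 f b 0 0 0 0 1 ∧ 1 = E5 f b 1 0 0 0 0 ∧ 2 = E5 f b 2 0 0 0 0 := by
  simp [E5]

theorem FL.div1 (h : FL L f b) (y : 𝓞 L) (hy : IsE f b (E5 f b (-1) 1 0 0 0*y)) : IsE f b y := by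
  obtain ⟨c0, c1, c2, c3, c4, hc⟩ := hy
  have e1 : E5 f b (-1) 1 0 0 0*E5 f b 3 (-13) 7 0 (-2) = 2 := by
    rw [E5_mul h.rel]; simp [E5]
  have e2 : E5 f b (-1) 1 0 0 0*E5 f b 2 (-6) 4 0 (-1) = b := by
    rw [E5_mul h.rel]; simp [E5]
  have e3 : E5 f b (-1) 1 0 0 0*E5 f b 2 (-6) 4 1 (-1) = f*b := by
    rw [E5_mul h.rel]; simp [E5]
  have e4 : E5 f b (-1) 1 0 0 0 = f - 1 := by simp [E5]; ring
  have key : E5 f b (-1) 1 0 0 0*y = E5 f b (-1) 1 0 0 0*(E5 f b (c1 + c2) c2 0 0 0 +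
      c3*E5 f b 2 (-6) 4 0 (-1) + c4*E5 f b 2 (-6) 4 1 (-1)) + (c0 + c1 + c2 : ℤ) := by
    rw [mul_add, mul_add, mul_left_comm, e2, mul_left_comm, e3, hc, e4]
    simp only [E5]; push_cast; ring
  have hn1 : ¬ E5 f b (-1) 1 0 0 0 ∣ E5 f b 1 0 0 0 0 := fun hd => by
    have := h.dvd_norm _ _ _ _ _ _ _ _ _ _ hd
    revert this; decide +kernel
  have hne : E5 f b (-1) 1 0 0 0 ≠ 0 := by
    intro h0; rw [h0] at e1; simp at e1
  rcases Int.even_or_odd' (c0 + c1 + c2) with ⟨k, hk | hk⟩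
  · rw [hk] at key
    push_cast at key
    rw [← e1, mul_assoc, ← mul_add] at key
    rw [mul_left_cancel₀ hne key]
    exact (((IsE.mk _ _ _ _ _).add (h.isE_mul (IsE.int _) (IsE.mk _ _ _ _ _))).add
      (h.isE_mul (IsE.int _) (IsE.mk _ _ _ _ _))).add (h.isE_mul (IsE.mk _ _ _ _ _) (IsE.int _))
  · exfalso
    apply hn1
    rw [hk] at key
    push_cast at key
    rw [← (E5_eqs f b).2.2.2.2.1]
    exact ⟨y - (E5 f b (c1 + c2) c2 0 0 0 + c3*E5 f b 2 (-6) 4 0 (-1) + c4*E5 f b 2 (-6) 4 1 (-1)) -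
      E5 f b 3 (-13) 7 0 (-2)*k, by linear_combination -key + k*e1⟩

theorem FL.div2 (h : FL L f b) (y : 𝓞 L) (hy : IsE f b (E5 f b (-2) 5 (-4) 0 1*y)) : IsE f b y := by
  obtain ⟨c0, c1, c2, c3, c4, hc⟩ := hy
  have e1 : E5 f b (-2) 5 (-4) 0 1*E5 f b 13 (-26) 11 2 (-3) = 2 := by
    rw [E5_mul h.rel]; simp [E5]
  have e2 : E5 f b (-2) 5 (-4) 0 1*E5 f b (-9) 18 (-8) (-1) 2 = f^2 - 1 - f := by
    rw [E5_mul h.rel]; simp [E5]; ring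
  have e3 : E5 f b (-2) 5 (-4) 0 1*E5 f b (-3) 7 (-3) (-1) 1 = b - 1 := by
    rw [E5_mul h.rel]; simp [E5]; ring
  have e4 : E5 f b (-2) 5 (-4) 0 1*E5 f b (-3) 5 (-3) 1 0 = f*b - f := by
    rw [E5_mul h.rel]; simp [E5]; ring
  set p := E5 f b (-2) 5 (-4) 0 1 with hp
  obtain ⟨G, hG, key⟩ : ∃ G, IsE f b G ∧ p*y = p*G + (c0 + c2 + c3 : ℤ) + (c1 + c2 + c4 : ℤ)*f := by
    refine ⟨c2*E5 f b (-9) 18 (-8) (-1) 2 + c3*E5 f b (-3) 7 (-3) (-1) 1 + c4*E5 f b (-3) 5 (-3) 1 0,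
      ((h.isE_mul (IsE.int _) (IsE.mk _ _ _ _ _)).add
      (h.isE_mul (IsE.int _) (IsE.mk _ _ _ _ _))).add (h.isE_mul (IsE.int _) (IsE.mk _ _ _ _ _)), ?_⟩
    rw [hc, mul_add, mul_add, mul_left_comm, e2, mul_left_comm, e3, mul_left_comm, e4]
    simp only [E5]; push_cast; ring
  have hn1 : ¬ p ∣ 1 := fun hd => by
    rw [(E5_eqs f b).2.2.2.2.1] at hd
    have := h.dvd_norm _ _ _ _ _ _ _ _ _ _ hd
    revert this; decide +kernel
  have hnf : ¬ p ∣ E5 f b 0 1 0 0 0 := fun hd => by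
    have := h.dvd_norm _ _ _ _ _ _ _ _ _ _ hd
    revert this; decide +kernel
  rw [← (E5_eqs f b).1] at hnf
  have hnf2 : ¬ p ∣ E5 f b 0 0 1 0 0 := fun hd => by
    have := h.dvd_norm _ _ _ _ _ _ _ _ _ _ hd
    revert this; decide +kernel
  rw [← (E5_eqs f b).2.1] at hnf2
  have hnf1 : ¬ p ∣ 1 + f := fun hd => hnf2 (by
    have := dvd_add (Dvd.intro _ e2) hd
    rwa [show f^2 - 1 - f + (1 + f) = f^2 by ring] at this)
  have hne : p ≠ 0 := by
    intro h0; rw [h0] at e1; simp at e1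
  rcases Int.even_or_odd' (c0 + c2 + c3) with ⟨k, hk | hk⟩ <;>
  rcases Int.even_or_odd' (c1 + c2 + c4) with ⟨l, hl | hl⟩ <;> rw [hk, hl] at key <;> push_cast at key
  · have : y = G + E5 f b 13 (-26) 11 2 (-3)*k + E5 f b 13 (-26) 11 2 (-3)*l*E5 f b 0 1 0 0 0 := by
      apply mul_left_cancel₀ hne
      rw [← (E5_eqs f b).1]
      linear_combination key - (k + l*f)*e1
    rw [this]
    exact (hG.add (h.isE_mul (IsE.mk _ _ _ _ _) (IsE.int _))).add
      (h.isE_mul (h.isE_mul (IsE.mk _ _ _ _ _) (IsE.int _)) (IsE.mk _ _ _ _ _))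
  · exact absurd ⟨y - G - E5 f b 13 (-26) 11 2 (-3)*(k + l*f), by linear_combination -key + (k + l*f)*e1⟩ hnf
  · exact absurd ⟨y - G - E5 f b 13 (-26) 11 2 (-3)*(k + l*f), by linear_combination -key + (k + l*f)*e1⟩ hn1
  · exact absurd ⟨y - G - E5 f b 13 (-26) 11 2 (-3)*(k + l*f), by linear_combination -key + (k + l*f)*e1⟩ hnf1

theorem FL.two_eq (h : FL L f b) : (2 : 𝓞 L) = E5 f b (-1) 1 0 0 0*(E5 f b (-2) 5 (-4) 0 1*(E5 f b (-2) 5 (-4) 0 1*E5 f b (-45) 117 (-55) (-6) 15)) := by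
  rw [E5_mul h.rel, E5_mul h.rel, E5_mul h.rel]; simp [E5]

theorem FL.half (h : FL L f b) (y : 𝓞 L) (hy : IsE f b (2*y)) : IsE f b y := by
  rw [h.two_eq, mul_assoc] at hy
  have := h.div1 _ hy
  rw [mul_assoc] at this
  have := h.div2 _ this
  rw [mul_assoc] at this
  have := h.div2 _ this
  have e : E5 f b (-1) (-1) (-1) 3 1*E5 f b (-45) 117 (-55) (-6) 15 = 1 := by
    rw [E5_mul h.rel]; simp [E5]
  have h2 := h.isE_mul (IsE.mk (-1) (-1) (-1) 3 1) this
  rwa [← mul_assoc, e, one_mul] at h2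

theorem FL.all (h : FL L f b) : (∀ y, IsE f b y) ∧ |discr L| ≤ 509744 := by
  obtain ⟨d, hd, hy⟩ := index_gen 5 h.hfr ![1, f, f^2, b, f*b]
  rw [h.discrE] at hd
  have hdb : |d| ≤ 713 := by
    have h0 : discr L ≠ 0 := discr_ne_zero L
    rw [abs_le]
    have : 0 < d^2 := by
      rcases eq_or_ne d 0 with h | h
      · subst h; norm_num at hd
      · positivity
    have : 0 < discr L := by nlinarith
    constructor <;> nlinarith
  have hdd : d = 1 ∨ d = -1 ∨ d = 2 ∨ d = -2 ∨ d = 4 ∨ d = -4 := by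
    have hk : ∀ n : Fin 714, ((n : ℕ)^2 ∣ 509744) → (n : ℕ) = 1 ∨ (n : ℕ) = 2 ∨ (n : ℕ) = 4 := by decide +kernel
    have h1 : d.natAbs^2 ∣ 509744 := by
      have : d^2 ∣ 509744 := ⟨_, hd⟩
      have := Int.natAbs_dvd_natAbs.2 this
      rwa [Int.natAbs_pow] at this
    have := hk ⟨d.natAbs, by rw [abs_le] at hdb; omega⟩ h1
    simp only at this
    omega
  have hy' : ∀ y, IsE f b ((d : 𝓞 L)*y) := fun y => by
    obtain ⟨c, hc⟩ := hy y
    refine ⟨c 0, c 1, c 2, c 3, c 4, ?_⟩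
    rw [zsmul_eq_mul] at hc
    rw [hc]
    simp [Fin.sum_univ_five, E5]
  refine ⟨fun y => ?_, ?_⟩
  · rcases hdd with rfl | rfl | rfl | rfl | rfl | rfl
    · simpa using hy' y
    · simpa using hy' (-y)
    · apply h.half; simpa using hy' y
    · apply h.half; simpa using hy' (-y)
    · apply h.half; apply h.half; convert hy' y using 1; push_cast; ring
    · apply h.half; apply h.half; convert hy' (-y) using 1; push_cast; ring
  · have : d^2*|discr L| = 509744 := by
      rw [← abs_sq d, ← abs_mul, ← hd]; rfl
    have h1 : 0 < d^2 := by
      rcases eq_or_ne d 0 with h | h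
      · subst h; norm_num at hd
      · positivity
    nlinarith [abs_nonneg (discr L)]
end

theorem int_mem_prime {R : Type} [CommRing R] (P : Ideal R) (hP : P.IsPrime) (p : ℕ) (hp : p.Prime) (hpP : (p : R) ∈ P)
    (n : ℤ) (hn : (n : R) ∈ P) : (p : ℤ) ∣ n := by
  by_contra h
  have hc : IsCoprime (p : ℤ) n := (Prime.coprime_iff_not_dvd (Nat.prime_iff_prime_int.1 hp)).2 h
  obtain ⟨a, c, hac⟩ := hc
  apply hP.ne_top
  rw [Ideal.eq_top_iff_one]
  have : (1 : R) = a*p + c*n := by exact_mod_cast congrArg (Int.cast : ℤ → R) hac.symm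
  rw [this]
  exact P.add_mem (P.mul_mem_left _ hpP) (P.mul_mem_left _ hn)

theorem principal_of_norm {F : Type} [Field F] [NumberField F] (P : Ideal (𝓞 F)) (hP : P ≠ ⊥) (x : 𝓞 F) (hx : x ∈ P)
    (hn : (Algebra.norm ℤ x).natAbs ∣ P.absNorm) : Submodule.IsPrincipal P := by
  have h1 : P ∣ Ideal.span {x} := Ideal.dvd_span_singleton.2 hx
  obtain ⟨J, hJ⟩ := h1
  have h2 := congrArg Ideal.absNorm hJ
  rw [map_mul, Ideal.absNorm_span_singleton] at h2
  have h0 : P.absNorm ≠ 0 := fun h => hP (Ideal.absNorm_eq_zero_iff.1 h)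
  rw [h2] at hn
  have h3 : J.absNorm = 1 := by
    have := Nat.dvd_of_mul_dvd_mul_left (Nat.pos_of_ne_zero h0) (by simpa using hn : P.absNorm*J.absNorm ∣ P.absNorm*1)
    exact Nat.dvd_one.1 this
  rw [Ideal.absNorm_eq_one_iff] at h3
  rw [h3, Ideal.mul_top] at hJ
  exact ⟨x, hJ.symm⟩

theorem resid {F : Type} [Field F] [NumberField F] (P : Ideal (𝓞 F)) (p : ℕ) (hp : p.Prime)
    (hn : P.absNorm = p) (x : 𝓞 F) : ∃ r : Fin p, x - (r : ℕ) ∈ P := by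
  haveI : Fact p.Prime := ⟨hp⟩
  have hpP : (p : 𝓞 F) ∈ P := by rw [← hn]; exact Ideal.absNorm_mem P
  have hcard : Nat.card (𝓞 F ⧸ P) = p := by rw [← hn]; rfl
  haveI : CharP (𝓞 F ⧸ P) p := by
    have : CharP (𝓞 F ⧸ P) (ringChar (𝓞 F ⧸ P)) := inferInstance
    have h0 : ((p : ℕ) : 𝓞 F ⧸ P) = 0 := by
      have := Ideal.Quotient.eq_zero_iff_mem.2 hpP
      simpa using this
    have h1 := (ringChar.spec (𝓞 F ⧸ P) p).1 h0
    rcases (Nat.dvd_prime hp).1 h1 with h | h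
    · exfalso
      have : Subsingleton (𝓞 F ⧸ P) := by
        rw [h] at this; exact CharP.CharOne.subsingleton
      rw [Nat.card_eq_one_iff_unique.2 ⟨this, ⟨0⟩⟩] at hcard
      exact hp.one_lt.ne hcard
    · rwa [h] at this
  have hb : Function.Bijective (ZMod.castHom (dvd_refl p) (𝓞 F ⧸ P)) := by
    haveI : Finite (𝓞 F ⧸ P) := Nat.finite_of_card_ne_zero (by rw [hcard]; exact hp.ne_zero)
    exact (Nat.bijective_iff_injective_and_card _).2 ⟨ZMod.castHom_injective _, by simp [hcard]⟩
  obtain ⟨z, hz⟩ := hb.2 (Ideal.Quotient.mk P x)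
  refine ⟨⟨z.val, ZMod.val_lt z⟩, ?_⟩
  rw [← Ideal.Quotient.eq_zero_iff_mem, map_sub, ← hz]
  have := ZMod.natCast_zmod_val z
  nth_rewrite 1 [← this]
  simp only [map_natCast, sub_self]

theorem prime_card {F : Type} [Field F] [NumberField F] (P : Ideal (𝓞 F)) (hP : P.IsPrime) (h0 : P ≠ ⊥) :
    ∃ p k : ℕ, p.Prime ∧ 0 < k ∧ P.absNorm = p^k ∧ (p : 𝓞 F) ∈ P ∧ ∀ x : 𝓞 F, x^(p^k) - x ∈ P := by
  have hmax : P.IsMaximal := hP.isMaximal h0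
  letI := Ideal.Quotient.field P
  haveI : Finite (𝓞 F ⧸ P) := Ideal.finiteQuotientOfFreeOfNeBot P h0
  letI := Fintype.ofFinite (𝓞 F ⧸ P)
  have hq : ∀ x : 𝓞 F ⧸ P, x^Fintype.card (𝓞 F ⧸ P) = x := FiniteField.pow_card
  have hc : P.absNorm = Fintype.card (𝓞 F ⧸ P) := by rw [← Nat.card_eq_fintype_card]; rfl
  obtain ⟨p, _, n, hp, hn⟩ := FiniteField.card' (𝓞 F ⧸ P)
  refine ⟨p, n, hp, n.pos, hc.trans hn, ?_, fun x => ?_⟩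
  · have h1 : ((p^(n : ℕ) : ℕ) : 𝓞 F) ∈ P := by rw [← hn, ← hc]; exact Ideal.absNorm_mem P
    push_cast at h1
    exact hP.mem_of_pow_mem _ h1
  · rw [← Ideal.Quotient.eq_zero_iff_mem, map_sub, map_pow, ← hn, hq, sub_self]

section
variable {L : Type} [Field L] [NumberField L] {f b : 𝓞 L}

theorem FL.mem_root (h : FL L f b) (P : Ideal (𝓞 L)) (hP : P.IsPrime) (p : ℕ) (hp : p.Prime) (hpP : (p : 𝓞 L) ∈ P)
    (hp2 : ¬ p ∣ 2) (r : ℤ) (hr : f - r ∈ P) (a0 a1 a2 a3 a4 : ℤ)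
    (hd : (p : ℤ) ∣ 2*(a0 + a1*r + a2*r^2) + (a3 + a4*r)*(1 + r^3)) : E5 f b a0 a1 a2 a3 a4 ∈ P := by
  have h2 : (2 : 𝓞 L) ∉ P := fun h2 => by
    have := int_mem_prime P hP p hp hpP 2 (by exact_mod_cast h2)
    exact hp2 (by exact_mod_cast this)
  refine (hP.mem_or_mem (?_ : 2*_ ∈ P)).resolve_left h2
  obtain ⟨m, hm⟩ := hd
  have hm' := congrArg (Int.cast : ℤ → 𝓞 L) hm
  push_cast at hm'
  have : 2*E5 f b a0 a1 a2 a3 a4 = (2*a1 + 2*a2*(f + r) + a3*(f^2 + f*r + r^2) + a4*(1 + f^3 + f^2*r + f*r^2 + r^3))*(f - r) + m*p := by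
    unfold E5
    linear_combination hm' + (a3 + a4*f)*h.hb
  rw [this]
  exact P.add_mem (P.mul_mem_left _ hr) (P.mul_mem_left _ hpP)

theorem FL.root (h : FL L f b) (P : Ideal (𝓞 L)) (hP : P.IsPrime) (p : ℕ) (hp : p.Prime)
    (hn : P.absNorm = p) : ∃ r : Fin p, f - ((r : ℕ) : ℤ) ∈ P ∧ (p : ℤ) ∣ ((r : ℕ) : ℤ)^5 - ((r : ℕ) : ℤ)^4 - 7*((r : ℕ) : ℤ)^3 + 21*((r : ℕ) : ℤ)^2 - 17*((r : ℕ) : ℤ) + 5 := by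
  obtain ⟨r, hr⟩ := resid P p hp hn f
  have hr' : f - ((r : ℕ) : ℤ) ∈ P := by simpa using hr
  refine ⟨r, hr', ?_⟩
  apply int_mem_prime P hP p hp
  · rw [← hn]; exact Ideal.absNorm_mem P
  · generalize ((r : ℕ) : ℤ) = s at *
    have : ((s^5 - s^4 - 7*s^3 + 21*s^2 - 17*s + 5 : ℤ) : 𝓞 L) = -(f - s) *
      (f^4+f^3*s+f^2*s^2+f*s^3+s^4 - (f^3+f^2*s+f*s^2+s^3) - 7*(f^2+f*s+s^2) + 21*(f+s) - 17) := by
      push_cast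
      linear_combination h.hf
    rw [this]
    exact P.mul_mem_right _ (P.neg_mem hr')

theorem FL.use (h : FL L f b) (P : Ideal (𝓞 L)) (hP : P.IsPrime) (h0 : P ≠ ⊥) (p k : ℕ) (hp : p.Prime) (hk : 0 < k)
    (hn : P.absNorm = p^k) (hpP : (p : 𝓞 L) ∈ P)
    (hp2 : ¬ p ∣ 2) (r : ℤ) (hr : f - r ∈ P) (a0 a1 a2 a3 a4 : ℤ)
    (hd : (p : ℤ) ∣ 2*(a0 + a1*r + a2*r^2) + (a3 + a4*r)*(1 + r^3))
    (hN : (M5 a0 a1 a2 a3 a4).det.natAbs = p) : Submodule.IsPrincipal P := by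
  apply principal_of_norm P h0 _ (h.mem_root P hP p hp hpP hp2 r hr a0 a1 a2 a3 a4 hd)
  rw [h.norm, hN, hn]
  exact dvd_pow_self p hk.ne'

theorem FL.pid_aux (h : FL L f b) (P : Ideal (𝓞 L)) (hP : P.IsPrime) (h0 : P ≠ ⊥) (hle : P.absNorm ≤ 44) :
    Submodule.IsPrincipal P := by
  obtain ⟨p, k, hp, hk, hn, hpP, hpow⟩ := prime_card P hP h0
  have hpk : p ≤ p^k := Nat.le_self_pow hk.ne' p
  have hk1 : 7 ≤ p → P.absNorm = p := fun h7 => by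
    rcases Nat.lt_or_ge k 2 with hk2 | hk2
    · rw [hn, show k = 1 by omega, pow_one]
    · have := Nat.pow_le_pow_right hp.pos hk2
      nlinarith
  have hp44 : p ≤ 44 := by omega
  have hP2 := hp.two_le
  have h1 : (1 : 𝓞 L) ∉ P := fun h => hP.ne_top ((Ideal.eq_top_iff_one _).2 h)
  have root' : 7 ≤ p → ∃ r : Fin p, f - ((r : ℕ) : ℤ) ∈ P ∧ (p : ℤ) ∣ ((r : ℕ) : ℤ)^5 - ((r : ℕ) : ℤ)^4 - 7*((r : ℕ) : ℤ)^3 + 21*((r : ℕ) : ℤ)^2 - 17*((r : ℕ) : ℤ) + 5 :=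
    fun h7 => h.root P hP p hp (hk1 h7)
  have hpc : p = 2 ∨ p = 3 ∨ p = 5 ∨ p = 7 ∨ p = 11 ∨ p = 13 ∨ p = 17 ∨ p = 19 ∨ p = 23 ∨ p = 29 ∨ p = 31 ∨ p = 37 ∨ p = 41 ∨ p = 43 := by
    have : ∀ q : Fin 45, (q : ℕ).Prime → (q : ℕ) = 2 ∨ (q : ℕ) = 3 ∨ (q : ℕ) = 5 ∨ (q : ℕ) = 7 ∨ (q : ℕ) = 11 ∨ (q : ℕ) = 13 ∨ (q : ℕ) = 17 ∨ (q : ℕ) = 19 ∨ (q : ℕ) = 23 ∨ (q : ℕ) = 29 ∨ (q : ℕ) = 31 ∨ (q : ℕ) = 37 ∨ (q : ℕ) = 41 ∨ (q : ℕ) = 43 := by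
      decide +kernel
    exact this ⟨p, by omega⟩ hp
  rcases hpc with rfl | rfl | rfl | rfl | rfl | rfl | rfl | rfl | rfl | rfl | rfl | rfl | rfl | rfl
  · have h2 : (2 : 𝓞 L) ∈ P := by exact_mod_cast hpP
    have h2' := h2
    rw [h.two_eq] at h2'
    rcases hP.mem_or_mem h2' with h3 | h3
    · apply principal_of_norm P h0 _ h3
      rw [h.norm, hn, show (M5 (-1) 1 0 0 0).det.natAbs = 2 by decide +kernel]
      exact dvd_pow_self 2 hk.ne'
    · have h4 : E5 f b (-2) 5 (-4) 0 1 ∈ P := by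
        rcases hP.mem_or_mem h3 with h4 | h4
        · exact h4
        rcases hP.mem_or_mem h4 with h4 | h4
        · exact h4
        exfalso
        apply h1
        have e : E5 f b (-1) (-1) (-1) 3 1*E5 f b (-45) 117 (-55) (-6) 15 = 1 := by
          rw [E5_mul h.rel]; simp [E5]
        rw [← e]
        exact P.mul_mem_left _ h4
      apply principal_of_norm P h0 _ h4
      rw [h.norm, hn, show (M5 (-2) 5 (-4) 0 1).det.natAbs = 4 by decide +kernel]
      rcases Nat.lt_or_ge k 2 with hk2 | hk2
      · exfalso
        obtain ⟨r, hr, hr2⟩ := h.root P hP 2 hp (by rw [hn, show k = 1 by omega, pow_one])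
        have e2 : E5 f b (-2) 5 (-4) 0 1*E5 f b 11 (-19) 7 2 (-2) = 1 + f + f^2 := by
          rw [E5_mul h.rel]; simp [E5]
        have h5 : 1 + f + f^2 ∈ P := by rw [← e2]; exact P.mul_mem_right _ h4
        have h6 : ((1 + ((r : ℕ) : ℤ) + ((r : ℕ) : ℤ)^2 : ℤ) : 𝓞 L) ∈ P := by
          have := P.sub_mem h5 (P.mul_mem_left (1 + f + ((r : ℕ) : ℤ)) hr)
          convert this using 1
          push_cast
          ring
        have := int_mem_prime P hP 2 hp hpP _ h6
        revert this
        clear * -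
        revert r
        decide
      · exact pow_dvd_pow 2 hk2
  · have hk3 : k = 1 ∨ k = 2 ∨ k = 3 := by
      rcases Nat.lt_or_ge k 4 with h4 | h4
      · omega
      · have := Nat.pow_le_pow_right (show 0 < 3 by norm_num) h4
        omega
    have hr : f + 1 ∈ P := by
      rcases hk3 with rfl | rfl | rfl
      · obtain ⟨r, hr, hr2⟩ := h.root P hP 3 hp (by simpa using hn)
        have h3 : (3 : 𝓞 L) ∈ P := by exact_mod_cast hpP
        fin_cases r
        · norm_num at hr2
        · norm_num at hr2
        · have := P.add_mem hr h3
          convert this using 1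
          push_cast; ring
      · have := P.sub_mem (P.mul_mem_left (1 + f + f^2 + f^3) (hpow f)) (P.mul_mem_left (-2 + 5*f - 9*f^2 + 6*f^3 - 3*f^4 - f^5 + 3*f^6 - 12*f^7 + 15*f^8 - 9*f^9 + 2*f^10 + f^11) hpP)
        convert this using 1
        push_cast
        linear_combination ((-1 - f^2 - f^3 - f^4 - f^5 + f^6 - f^7))*h.hf
      · have := P.sub_mem (P.mul_mem_left (f - f^2) (hpow f)) (P.mul_mem_left (-2 + 7*f - 13*f^2 + 8*f^3 + 2*f^4 - 2*f^5 - 6*f^6 + 10*f^7 - 11*f^8 + 5*f^9 + f^10 - f^12 + 3*f^13 + 5*f^14 - 11*f^15 + 4*f^16 + 5*f^17 - 3*f^18 + 2*f^20 - 4*f^21 + 3*f^22 - f^23 + 6*f^24 - 8*f^25 + 7*f^26 - 2*f^27) hpP)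
        convert this using 1
        push_cast
        linear_combination ((-1 + f - f^3 - f^4 - f^6 + f^7 + f^8 + f^9 + f^10 + f^11 - f^13 + f^14 + f^15 + f^20 + f^21 + f^22 + f^24))*h.hf
    exact h.use P hP h0 3 k hp hk hn hpP (by norm_num) (-1) (by simpa using hr) (-4) (15) (-8) (0) (2) (by norm_num) (by decide +kernel)
  · have hk3 : k = 1 ∨ k = 2 := by
      rcases Nat.lt_or_ge k 3 with h4 | h4
      · omega
      · have := Nat.pow_le_pow_right (show 0 < 5 by norm_num) h4
        omega
    have hr : f*(f - 2) ∈ P := by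
      rcases hk3 with rfl | rfl
      · obtain ⟨r, hr, hr2⟩ := h.root P hP 5 hp (by simpa using hn)
        fin_cases r
        · simp at hr
          exact P.mul_mem_right _ hr
        · norm_num at hr2
        · simp at hr
          exact P.mul_mem_left _ hr
        · norm_num at hr2
        · norm_num at hr2
      · have := P.sub_mem (P.mul_mem_left (-2 - f^2) (hpow f)) (P.mul_mem_left (2 - 8*f + 15*f^2 - 10*f^3 - f^4 + 3*f^5 + 6*f^6 - 14*f^7 + 13*f^8 - 6*f^9 - 2*f^10 + 4*f^11 - 9*f^12 + 17*f^13 - 16*f^14 + 5*f^15 + 2*f^16 + 5*f^17 - 7*f^18 + 4*f^20 + 2*f^21 - 4*f^22 + f^23 + 3*f^24 - 2*f^25) hpP)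
        convert this using 1
        push_cast
        linear_combination ((2 - 2*f + f^3 - 2*f^5 + f^6 - 2*f^7 - f^8 + 2*f^11 - 2*f^12 + 2*f^13 + 2*f^14 + f^15 - f^16 + f^17 + 2*f^18 + f^19 + f^21 + f^22))*h.hf
    rcases hP.mem_or_mem hr with hr | hr
    · exact h.use P hP h0 5 k hp hk hn hpP (by norm_num) 0 (by simpa using hr) (0) (1) (0) (0) (0) (by norm_num) (by decide +kernel)
    · exact h.use P hP h0 5 k hp hk hn hpP (by norm_num) 2 (by simpa using hr) (41) (-104) (48) (6) (-13) (by norm_num) (by decide +kernel)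
  · obtain ⟨r, hr, hr2⟩ := root' (by norm_num)
    have hrr : False := by
      clear * - hr2
      revert r
      decide +kernel
    exact hrr.elim
  · obtain ⟨r, hr, hr2⟩ := root' (by norm_num)
    have hrr : (r : ℕ) = 8 := by
      clear * - hr2
      revert r
      decide +kernel
    rw [hrr] at hr
    exact h.use P hP h0 11 k hp hk hn hpP (by norm_num) 8 (by simpa using hr) (-1) (3) (-3) (1) (1) (by norm_num) (by decide +kernel)
  · obtain ⟨r, hr, hr2⟩ := root' (by norm_num)
    have hrr : False := by
      clear * - hr2
      revert r
      decide +kernel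
    exact hrr.elim
  · obtain ⟨r, hr, hr2⟩ := root' (by norm_num)
    have hrr : (r : ℕ) = 6 ∨ (r : ℕ) = 7 := by
      clear * - hr2
      revert r
      decide +kernel
    rcases hrr with hrr | hrr <;> rw [hrr] at hr
    · exact h.use P hP h0 17 k hp hk hn hpP (by norm_num) 6 (by simpa using hr) (-12) (7) (0) (-2) (0) (by norm_num) (by decide +kernel)
    · exact h.use P hP h0 17 k hp hk hn hpP (by norm_num) 7 (by simpa using hr) (8) (-30) (15) (-2) (-5) (by norm_num) (by decide +kernel)
  · obtain ⟨r, hr, hr2⟩ := root' (by norm_num)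
    have hrr : (r : ℕ) = 7 := by
      clear * - hr2
      revert r
      decide +kernel
    rw [hrr] at hr
    exact h.use P hP h0 19 k hp hk hn hpP (by norm_num) 7 (by simpa using hr) (-6) (9) (-4) (-1) (1) (by norm_num) (by decide +kernel)
  · obtain ⟨r, hr, hr2⟩ := root' (by norm_num)
    have hrr : (r : ℕ) = 5 := by
      clear * - hr2
      revert r
      decide +kernel
    rw [hrr] at hr
    exact h.use P hP h0 23 k hp hk hn hpP (by norm_num) 5 (by simpa using hr) (0) (-3) (2) (2) (0) (by norm_num) (by decide +kernel)
  · obtain ⟨r, hr, hr2⟩ := root' (by norm_num)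
    have hrr : (r : ℕ) = 3 := by
      clear * - hr2
      revert r
      decide +kernel
    rw [hrr] at hr
    exact h.use P hP h0 29 k hp hk hn hpP (by norm_num) 3 (by simpa using hr) (16) (-45) (22) (2) (-6) (by norm_num) (by decide +kernel)
  · obtain ⟨r, hr, hr2⟩ := root' (by norm_num)
    have hrr : False := by
      clear * - hr2
      revert r
      decide +kernel
    exact hrr.elim
  · obtain ⟨r, hr, hr2⟩ := root' (by norm_num)
    have hrr : (r : ℕ) = 31 := by
      clear * - hr2
      revert r
      decide +kernel
    rw [hrr] at hr
    exact h.use P hP h0 37 k hp hk hn hpP (by norm_num) 31 (by simpa using hr) (1) (-3) (3) (0) (-1) (by norm_num) (by decide +kernel)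
  · obtain ⟨r, hr, hr2⟩ := root' (by norm_num)
    have hrr : False := by
      clear * - hr2
      revert r
      decide +kernel
    exact hrr.elim
  · obtain ⟨r, hr, hr2⟩ := root' (by norm_num)
    have hrr : False := by
      clear * - hr2
      revert r
      decide +kernel
    exact hrr.elim

theorem FL.pid (h : FL L f b) : IsPrincipalIdealRing (𝓞 L) := by
  apply RingOfIntegers.isPrincipalIdealRing_of_isPrincipal_of_norm_le_of_isPrime
  intro I hI hle
  apply h.pid_aux _ hI (nonZeroDivisors.coe_ne_zero I)
  have h2 : InfinitePlace.nrComplexPlaces L ≤ 2 := by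
    have := InfinitePlace.card_add_two_mul_card_eq_rank L
    rw [h.hfr] at this
    omega
  have hd := h.all.2
  rw [h.hfr] at hle
  have hpi := Real.pi_gt_d4
  have e1 : (4 / Real.pi)^InfinitePlace.nrComplexPlaces L ≤ 1.6213 := by
    have : (1 : ℝ) ≤ 4 / Real.pi := by
      rw [one_le_div Real.pi_pos]; exact Real.pi_le_four
    calc (4 / Real.pi)^InfinitePlace.nrComplexPlaces L ≤ (4 / Real.pi)^2 := pow_le_pow_right₀ this h2
      _ ≤ (4 / 3.1415)^2 := by gcongr
      _ ≤ 1.6213 := by norm_num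
  have e2 : √|(discr L : ℝ)| ≤ 714 := by
    rw [Real.sqrt_le_left (by norm_num)]
    have : (|discr L| : ℝ) ≤ 509744 := by exact_mod_cast hd
    linarith
  have e3 : (Ideal.absNorm (I : Ideal (𝓞 L)) : ℝ) < 45 := by
    refine hle.trans_lt ?_
    calc _ ≤ 1.6213*(((5 : ℕ).factorial : ℝ) / ((5 : ℕ) : ℝ)^5*714) := by
          gcongr
      _ < 45 := by norm_num [Nat.factorial]
  have : Ideal.absNorm (I : Ideal (𝓞 L)) < 45 := by exact_mod_cast e3
  omega
end

theorem units_classes {F : Type} [Field F] [NumberField F] (hodd : Odd (finrank ℚ F)) (n : ℕ)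
    (hr : Units.rank F ≤ n) {ι : Type} [Fintype ι] (hι : Fintype.card ι = 2^(n + 1)) (s : ι → (𝓞 F)ˣ)
    (hs : ∀ i j, i ≠ j → ¬ IsSquare (s i*s j)) (u : (𝓞 F)ˣ) : ∃ i, IsSquare (u*s i) := by
  classical
  have hex : ∀ x : (𝓞 F)ˣ, ∃ ζ : Bool, ∃ e : Fin (Units.rank F) → ℤ,
      x = (bif ζ then -1 else 1)*∏ i, (Units.fundSystem F i)^(e i) := by
    intro x
    obtain ⟨⟨ζ, e⟩, h, -⟩ := Units.exist_unique_eq_mul_prod F x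
    rcases Units.torsion_eq_one_or_neg_one_of_odd_finrank hodd ζ with h1 | h1
    · exact ⟨false, e, by simpa [h1] using h⟩
    · exact ⟨true, e, by simpa [h1] using h⟩
  choose ζ e he using hex
  let c : (𝓞 F)ˣ → Bool × (Fin (Units.rank F) → ZMod 2) := fun x => (ζ x, fun i => (e x i : ZMod 2))
  have hc : ∀ x y, c x = c y → IsSquare (x*y) := by
    intro x y hxy
    have h1 : ζ x = ζ y := congrArg Prod.fst hxy
    have h2 : ∀ i, (e x i : ZMod 2) = e y i := fun i => congrFun (congrArg Prod.snd hxy) i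
    have h3 : ∀ i, ∃ k, e x i + e y i = k + k := fun i => by
      have : ((e x i + e y i : ℤ) : ZMod 2) = 0 := by
        push_cast; rw [h2 i]; exact CharTwo.add_self_eq_zero _
      have := (ZMod.intCast_zmod_eq_zero_iff_dvd _ 2).1 this
      obtain ⟨k, hk⟩ := this
      exact ⟨k, by push_cast at hk; omega⟩
    choose k hk using h3
    refine ⟨∏ i, (Units.fundSystem F i)^(k i), ?_⟩
    rw [he x, he y, h1]
    rw [mul_mul_mul_comm, ← Finset.prod_mul_distrib, ← Finset.prod_mul_distrib]
    have : (bif ζ y then (-1 : (𝓞 F)ˣ) else 1)*(bif ζ y then -1 else 1) = 1 := by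
      cases ζ y <;> simp
    rw [this, one_mul]
    refine Finset.prod_congr rfl fun i _ => ?_
    rw [← zpow_add, ← zpow_add, hk i]
  have hinj : Function.Injective (fun i => c (s i)) := fun i j hij => by
    by_contra hne
    exact hs i j hne (hc _ _ hij)
  have hcard : Fintype.card (Bool × (Fin (Units.rank F) → ZMod 2)) ≤ Fintype.card ι := by
    rw [hι]
    simp only [Fintype.card_prod, Fintype.card_bool, Fintype.card_fun, ZMod.card, Fintype.card_fin]
    rw [pow_succ']
    exact Nat.mul_le_mul_left 2 (Nat.pow_le_pow_right (by norm_num) hr)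
  have hsurj := (Function.Injective.bijective_of_nat_card_le hinj (by simpa [Nat.card_eq_fintype_card] using hcard)).2
  obtain ⟨i, hi⟩ := hsurj (c u)
  exact ⟨i, hc _ _ hi.symm⟩

theorem real_le_one {F : Type} [Field F] [NumberField F] (x : F) (hx : Algebra.adjoin ℚ {x} = ⊤)
    (hu : ∀ σ τ : F →+* ℝ, σ x = τ x) : InfinitePlace.nrRealPlaces F ≤ 1 := by
  classical
  apply Fintype.card_le_one_iff.2
  rintro ⟨v, hv⟩ ⟨w, hw⟩
  have h1 := hu (InfinitePlace.embedding_of_isReal hv) (InfinitePlace.embedding_of_isReal hw)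
  have h2 : v.embedding x = w.embedding x := by
    rw [← InfinitePlace.embedding_of_isReal_apply hv, ← InfinitePlace.embedding_of_isReal_apply hw, h1]
  have h3 : v.embedding = w.embedding := by
    have : (v.embedding.toRatAlgHom) = w.embedding.toRatAlgHom := by
      apply AlgHom.ext_of_adjoin_eq_top hx
      intro y hy
      rw [Set.mem_singleton_iff] at hy
      subst hy
      exact h2
    ext y
    exact congrArg (fun (g : F →ₐ[ℚ] ℂ) => g y) this
  apply Subtype.ext
  show v = w
  rw [← InfinitePlace.mk_embedding v, h3, InfinitePlace.mk_embedding]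

theorem realH (x y : ℝ) (hx : x^5 - x^4 - 7*x^3 + 21*x^2 - 17*x + 5 = 0)
    (hy : y^5 - y^4 - 7*y^3 + 21*y^2 - 17*y + 5 = 0) : x = y := by
  have key : ∀ x : ℝ, x^5 - x^4 - 7*x^3 + 21*x^2 - 17*x + 5 = 0 → x < -3 := by
    intro x hx
    by_contra! h
    obtain ⟨t, rfl⟩ : ∃ t, x = 1 + t := ⟨x - 1, by ring⟩
    have h4 : 0 ≤ t^4*(t + 4) := mul_nonneg (by positivity) (by linarith)
    have e : t^4*(t + 4) - t^3 + 4*t^2 + 5*t + 2 = 0 := by linear_combination hx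
    rcases le_total t 0 with ht | ht
    · have : 0 ≤ t^2*(-t) := mul_nonneg (by positivity) (by linarith)
      nlinarith [sq_nonneg (8*t + 5)]
    · have h5 : 0 ≤ t^5 := by positivity
      have : 0 ≤ t^2*(2*t - 1/4)^2 := by positivity
      nlinarith [sq_nonneg t]
  obtain ⟨s, hs, rfl⟩ : ∃ s > 0, x = -3 - s := ⟨-3 - x, by linarith [key x hx], by ring⟩
  obtain ⟨t, ht, rfl⟩ : ∃ s > 0, y = -3 - s := ⟨-3 - y, by linarith [key y hy], by ring⟩
  by_contra hne
  have hne' : s - t ≠ 0 := fun h => hne (by linarith)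
  have : (s - t)*((s^4+s^3*t+s^2*t^2+s*t^3+t^4) + 16*(s^3+s^2*t+s*t^2+t^3) + 95*(s^2+s*t+t^2) + 240*(s+t) + 181) = 0 := by
    linear_combination hy - hx
  rcases mul_eq_zero.1 this with h | h
  · exact hne' h
  · have : 0 < (s^4+s^3*t+s^2*t^2+s*t^3+t^4) + 16*(s^3+s^2*t+s*t^2+t^3) + 95*(s^2+s*t+t^2) + 240*(s+t) + 181 := by positivity
    linarith

section
variable {L : Type} [Field L] [NumberField L] {f b : 𝓞 L}

theorem FL.adjoin (h : FL L f b) : Algebra.adjoin ℚ {(f : L)} = ⊤ := by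
  obtain ⟨w, hw, -⟩ := h.exBasis
  rw [eq_top_iff]
  intro y _
  rw [← w.sum_repr y]
  have hf : (f : L) ∈ Algebra.adjoin ℚ {(f : L)} := Algebra.subset_adjoin rfl
  have hb : (b : L) ∈ Algebra.adjoin ℚ {(f : L)} := by
    have : (b : L) = (1 / 2 : ℚ) • (1 + (f : L)^3) := by
      rw [← h.hbx, Algebra.smul_def]; simp
    rw [this]
    exact Subalgebra.smul_mem _ (Subalgebra.add_mem _ (Subalgebra.one_mem _) (Subalgebra.pow_mem _ hf 3)) _
  refine Subalgebra.sum_mem _ fun i _ => Subalgebra.smul_mem _ ?_ _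
  rw [hw]
  fin_cases i
  · exact Subalgebra.one_mem _
  · exact hf
  · exact Subalgebra.pow_mem _ hf 2
  · exact hb
  · exact Subalgebra.mul_mem _ hf hb

theorem FL.rank (h : FL L f b) : Units.rank L ≤ 2 := by
  have h1 : InfinitePlace.nrRealPlaces L ≤ 1 := by
    apply real_le_one (f : L) h.adjoin
    intro σ τ
    have hs := congrArg σ h.hx
    have ht := congrArg τ h.hx
    simp only [map_add, map_sub, map_mul, map_pow, map_ofNat, map_zero] at hs ht
    exact realH _ _ hs ht
  have h2 := InfinitePlace.card_add_two_mul_card_eq_rank L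
  rw [h.hfr] at h2
  rw [Units.rank, InfinitePlace.card_eq_nrRealPlaces_add_nrComplexPlaces]
  omega

theorem FL.resP (h : FL L f b) (p : ℕ) (hp : p.Prime) (hp2 : ¬ p ∣ 2) (a0 a1 a2 a3 a4 : ℤ)
    (hN : (M5 a0 a1 a2 a3 a4).det.natAbs = p) (r : ℤ)
    (hr : ∀ r' : Fin p, (p : ℤ) ∣ ((r' : ℕ) : ℤ)^5 - ((r' : ℕ) : ℤ)^4 - 7*((r' : ℕ) : ℤ)^3 + 21*((r' : ℕ) : ℤ)^2 - 17*((r' : ℕ) : ℤ) + 5 → ((r' : ℕ) : ℤ) = r) :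
    ∃ P : Ideal (𝓞 L), P.IsPrime ∧ P.absNorm = p ∧ ∀ c0 c1 c2 c3 c4 v : ℤ,
     (p : ℤ) ∣ 2*(c0 + c1*r + c2*r^2 - v) + (c3 + c4*r)*(1 + r^3) → E5 f b c0 c1 c2 c3 c4 - v ∈ P := by
  have hn : (Ideal.span {E5 f b a0 a1 a2 a3 a4}).absNorm = p := by
    rw [Ideal.absNorm_span_singleton, h.norm, hN]
  have hP : (Ideal.span {E5 f b a0 a1 a2 a3 a4}).IsPrime :=
    Ideal.isPrime_of_irreducible_absNorm (by rw [hn]; exact hp)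
  refine ⟨_, hP, hn, fun c0 c1 c2 c3 c4 v hv => ?_⟩
  obtain ⟨r', h1, h2⟩ := h.root _ hP p hp hn
  rw [hr r' h2] at h1
  have := h.mem_root _ hP p hp (by nth_rewrite 1 [← hn]; exact Ideal.absNorm_mem _) hp2 r h1 (c0 - v) c1 c2 c3 c4 (by
    convert hv using 1; ring)
  convert this using 1
  simp [E5]; ring

/-- if `u*v` is a square and residues are known -/
theorem sq_resid {F : Type} [Field F] [NumberField F] (P : Ideal (𝓞 F)) (hP : P.IsPrime) (p : ℕ) (hp : p.Prime)
    (hn : P.absNorm = p) (x : 𝓞 F) (v : ℤ) (hx : x - v ∈ P) (hs : IsSquare x) : ∃ m : Fin p, (p : ℤ) ∣ v - ((m : ℕ) : ℤ)^2 := by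
  obtain ⟨y, rfl⟩ := hs
  obtain ⟨m, hm⟩ := resid P p hp hn y
  refine ⟨m, int_mem_prime P hP p hp (by nth_rewrite 1 [← hn]; exact Ideal.absNorm_mem _) _ ?_⟩
  have := P.sub_mem (P.mul_mem_left (y + ((m : ℕ) : 𝓞 F)) hm) hx
  convert this using 1
  push_cast
  ring

def FL.e1 (h : FL L f b) : (𝓞 L)ˣ := Units.mkOfMulEqOne (E5 f b (-3) 10 (-4) (-1) 1) (E5 f b 2 (-3) 2 (-1) 0) (by
  rw [E5_mul h.rel]; simp [E5])
def FL.e2 (h : FL L f b) : (𝓞 L)ˣ := Units.mkOfMulEqOne (E5 f b 1 1 1 (-3) (-1)) (E5 f b 45 (-117) 55 6 (-15)) (by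
  rw [E5_mul h.rel]; simp [E5])

theorem FL.e1v (h : FL L f b) : (h.e1 : 𝓞 L) = E5 f b (-3) 10 (-4) (-1) 1 := rfl
theorem FL.e2v (h : FL L f b) : (h.e2 : 𝓞 L) = E5 f b 1 1 1 (-3) (-1) := rfl

theorem mul_sub_mem {R : Type} [CommRing R] (P : Ideal R) {x y : R} {u v : ℤ} (hx : x - u ∈ P) (hy : y - v ∈ P) :
    x*y - (u*v : ℤ) ∈ P := by
  have := P.add_mem (P.mul_mem_left x hy) (P.mul_mem_right (v : R) hx)
  convert this using 1
  push_cast; ring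

def FL.s (h : FL L f b) (i : Bool × Bool × Bool) : (𝓞 L)ˣ :=
  (bif i.1 then -1 else 1)*((bif i.2.1 then h.e1 else 1)*(bif i.2.2 then h.e2 else 1))

theorem FL.s_res (h : FL L f b) (P : Ideal (𝓞 L)) (u v : ℤ) (h1 : E5 f b (-3) 10 (-4) (-1) 1 - u ∈ P)
    (h2 : E5 f b 1 1 1 (-3) (-1) - v ∈ P) (i : Bool × Bool × Bool) :
    (h.s i : 𝓞 L) - (((bif i.1 then -1 else 1)*((bif i.2.1 then u else 1)*(bif i.2.2 then v else 1)) : ℤ) : 𝓞 L) ∈ P := by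
  unfold FL.s
  push_cast
  obtain ⟨a, b, c⟩ := i
  have := mul_sub_mem P (x := (bif a then -1 else 1)) (u := (bif a then -1 else 1)) (by cases a <;> simp)
    (mul_sub_mem P (x := (bif b then (h.e1 : 𝓞 L) else 1)) (u := (bif b then u else 1)) (by cases b <;> simp [FL.e1v, h1])
    (by cases c <;> simp [FL.e2v, h2] : (bif c then (h.e2 : 𝓞 L) else 1) - ((bif c then v else 1 : ℤ) : 𝓞 L) ∈ P))
  convert this using 2
  · cases a <;> cases b <;> cases c <;> rfl
  · push_cast; rfl

theorem FL.indep (h : FL L f b) (i j : Bool × Bool × Bool) (hij : i ≠ j) : ¬ IsSquare (h.s i*h.s j) := by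
  intro hs
  have hs' : IsSquare ((h.s i : 𝓞 L)*h.s j) := by
    obtain ⟨y, hy⟩ := hs
    exact ⟨y, by rw [← Units.val_mul, hy]; rfl⟩
  obtain ⟨P, hP, hPn, hPv⟩ := h.resP 3 (by norm_num) (by norm_num) (-4) 15 (-8) 0 2 (by decide +kernel) 2 (by decide)
  obtain ⟨Q, hQ, hQn, hQv⟩ := h.resP 29 (by norm_num) (by norm_num) 16 (-45) 22 2 (-6) (by decide +kernel) 3 (by decide +kernel)
  obtain ⟨R, hR, hRn, hRv⟩ := h.resP 37 (by norm_num) (by norm_num) 1 (-3) 3 0 (-1) (by decide +kernel) 31 (by decide +kernel)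
  have p1 := h.s_res P 1 1 (hPv _ _ _ _ _ _ (by norm_num)) (hPv _ _ _ _ _ _ (by norm_num))
  have q1 := h.s_res Q 19 16 (hQv _ _ _ _ _ _ (by norm_num)) (hQv _ _ _ _ _ _ (by norm_num))
  have r1 := h.s_res R 9 23 (hRv _ _ _ _ _ _ (by norm_num)) (hRv _ _ _ _ _ _ (by norm_num))
  have p2 := sq_resid P hP 3 (by norm_num) hPn _ _ (mul_sub_mem P (p1 i) (p1 j)) hs'
  have q2 := sq_resid Q hQ 29 (by norm_num) hQn _ _ (mul_sub_mem Q (q1 i) (q1 j)) hs'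
  have r2 := sq_resid R hR 37 (by norm_num) hRn _ _ (mul_sub_mem R (r1 i) (r1 j)) hs'
  clear p1 q1 r1 hPv hQv hRv hs hs' hP hQ hR hPn hQn hRn P Q R
  obtain ⟨i1, i2, i3⟩ := i
  obtain ⟨j1, j2, j3⟩ := j
  revert i1 i2 i3 j1 j2 j3
  decide +kernel

theorem FL.units (h : FL L f b) (u : (𝓞 L)ˣ) : ∃ i, IsSquare (u*h.s i) :=
  units_classes (by rw [h.hfr]; decide) 2 h.rank (by simp) h.s h.indep u
end

theorem unit_sq {O : Type} [CommRing O] [IsDomain O] [IsPrincipalIdealRing O] (x : O) (hx : x ≠ 0)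
    (h : ∀ π v c, Irreducible π → x = π^v*c → ¬ π ∣ c → Even v) : ∃ (u : Oˣ) (w : O), x = u*w^2 := by
  revert hx h
  refine WellFounded.induction (C := fun x => x ≠ 0 → (∀ π v c, Irreducible π → x = π^v*c → ¬ π ∣ c → Even v) → ∃ (u : Oˣ) (w : O), x = u*w^2) wellFounded_dvdNotUnit x ?_
  intro x ih hx h
  ·
    by_cases hu : IsUnit x
    · obtain ⟨u, rfl⟩ := hu
      exact ⟨u, 1, by simp⟩
    obtain ⟨π, hπ, hd⟩ := WfDvdMonoid.exists_irreducible_factor hu hx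
    have hfin : FiniteMultiplicity π x := FiniteMultiplicity.of_prime_left hπ.prime hx
    obtain ⟨c, hc, hnd⟩ := hfin.exists_eq_pow_mul_and_not_dvd
    set v := multiplicity π x with hv
    have hev := h π v c hπ hc hnd
    have hc0 : c ≠ 0 := by rintro rfl; simp at hnd
    have hv0 : v ≠ 0 := fun h0 => by
      rw [h0, pow_zero, one_mul] at hc; rw [hc] at hd; exact hnd hd
    have hcx : DvdNotUnit c x := ⟨hc0, π^v, fun hu' => hπ.not_isUnit ((isUnit_pow_iff hv0).1 hu'), by rw [hc, mul_comm]⟩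
    obtain ⟨u, w, hw⟩ := ih c hcx hc0 (by
      intro π' v' c' hπ' hc' hnd'
      by_cases hass : Associated π π'
      · rcases Nat.eq_zero_or_pos v' with h0 | h0
        · rw [h0]; exact Even.zero
        · exact absurd ((hass.dvd.trans (dvd_pow_self π' h0.ne')).trans (Dvd.intro _ hc'.symm)) hnd
      · apply h π' v' (π^v*c') hπ' (by rw [hc]; nth_rewrite 1 [hc']; ring)
        intro hdv
        rcases hπ'.prime.dvd_or_dvd hdv with h1 | h1
        · exact hass ((hπ'.associated_of_dvd hπ (hπ'.prime.dvd_of_dvd_pow h1)).symm)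
        · exact hnd' h1)
    obtain ⟨k, hk⟩ := hev
    exact ⟨u, π^k*w, by rw [hc, hw, hk]; ring⟩

theorem hker_of {O : Type} [CommRing O] [IsDomain O] [CharZero O] (φ : O) (H : ℤ[X]) (hm : H.Monic) (hi : Irreducible H)
    (h0 : aeval φ H = 0) (P : ℤ[X]) (hP : aeval φ P = 0) : H ∣ P := by
  have hint : IsIntegral ℤ φ := ⟨H, hm, by simpa [aeval_def] using h0⟩
  have h1 := minpoly.isIntegrallyClosed_dvd hint h0
  have h2 := minpoly.isIntegrallyClosed_dvd hint hP
  have h3 : ¬ IsUnit (minpoly ℤ φ) := minpoly.not_isUnit ℤ φ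
  have := (hi.dvd_iff.1 h1).resolve_left h3
  exact this.dvd.trans h2

theorem nzd_int (A : ℤ[X]) (hA : A.IsPrimitive) (Q : ℤ[X])
    (hQ : IsCoprime (A.map (Int.castRingHom ℚ)) (Q.map (Int.castRingHom ℚ))) (u : ℤ[X]) (h : A ∣ Q*u) : A ∣ u := by
  by_cases hu : u = 0
  · rw [hu]; exact dvd_zero _
  have h1 : A.map (Int.castRingHom ℚ) ∣ u.map (Int.castRingHom ℚ) := by
    apply hQ.dvd_of_dvd_mul_left
    rw [← Polynomial.map_mul]
    exact map_dvd (mapRingHom (Int.castRingHom ℚ)) h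
  rw [u.eq_C_content_mul_primPart, Polynomial.map_mul, map_C] at h1
  have hc : IsUnit (C (Int.castRingHom ℚ u.content)) := by
    rw [isUnit_C]
    simpa [content_eq_zero_iff] using hu
  rw [hc.dvd_mul_left] at h1
  have := (IsPrimitive.Int.dvd_iff_map_cast_dvd_map_cast A u.primPart hA).2 h1
  exact this.trans u.primPart_dvd

/-- unit times square at a field where `H(φ)=0` -/
theorem selmer_us {O : Type} [CommRing O] [IsDomain O] [CharZero O] [IsPrincipalIdealRing O] (φ : O) (H G : ℤ[X])
    (hm : H.Monic) (hi : Irreducible H) (h0 : aeval φ H = 0) (h2 : ∀ y : O, ∃ (n : ℕ) (P : ℤ[X]), aeval φ P = 2^n*y)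
    (hres : aeval φ G ∣ 4) (A B : ℤ[X]) (D : ℤ) (hD : D ≠ 0) (hA : A.IsPrimitive)
    (hcop : IsCoprime (A.map (Int.castRingHom ℚ)) (H.map (Int.castRingHom ℚ)))
    (hAB : A ∣ B^2 - C D^2*G*H) (hx : ∀ π : O, Irreducible π → π ∣ 2 → ¬ π ∣ aeval φ A) :
    ∃ (u : Oˣ) (w : O), aeval φ A = u*w^2 := by
  have hne : aeval φ A ≠ 0 := fun h => by
    have := hker_of φ H hm hi h0 A h
    have h3 := map_dvd (mapRingHom (Int.castRingHom ℚ)) this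
    have h4 := hcop.symm.isUnit_of_dvd h3
    have h5 : (H.map (Int.castRingHom ℚ)).natDegree = 0 := natDegree_eq_zero_of_isUnit h4
    rw [hm.natDegree_map] at h5
    exact hi.not_isUnit (by rw [hm.natDegree_eq_zero.1 h5]; exact isUnit_one)
  apply unit_sq _ hne
  intro π v c hπ hv hc
  by_cases hπ2 : π ∣ 2
  · rcases Nat.eq_zero_or_pos v with h | h
    · rw [h]; exact Even.zero
    · exact absurd ((dvd_pow_self π h.ne').trans (Dvd.intro _ hv.symm)) (hx π hπ hπ2)
  · refine parity_aux φ H G (hker_of φ H hm hi h0) h0 h2 π hπ hπ2 ?_ A B D ?_ hAB ?_ ?_ v c hv hc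
    · intro h
      have h4 := h.trans hres
      rw [show (4 : O) = 2*2 by norm_num] at h4
      exact (hπ.prime.dvd_or_dvd h4).elim hπ2 hπ2
    · exact hA.ne_zero
    · intro u
      apply nzd_int A hA
      rw [map_C]
      apply isCoprime_one_right.of_isCoprime_of_dvd_right
      rw [← isUnit_iff_dvd_one, isUnit_C]
      simpa using hD
    · exact fun u => nzd_int A hA H hcop u

abbrev T5 := ℤ × ℤ × ℤ × ℤ × ℤ

def mul5 : T5 → T5 → T5 := fun ⟨a0, a1, a2, a3, a4⟩ ⟨b0, b1, b2, b3, b4⟩ =>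
  ⟨(a0*b0 - (a1*b2+a2*b1) - 6*(a1*b4+a4*b1+a2*b3+a3*b2) + 4*(a2*b4+a4*b2) + 2*a3*b3 - 23*(a3*b4+a4*b3) + 51*a4*b4),
   (a0*b1+a1*b0 + 8*(a1*b4+a4*b1+a2*b3+a3*b2) - a2*b2 + 2*(a2*b4+a4*b2) + a3*b3 + 34*(a3*b4+a4*b3) - 39*a4*b4),
   (a0*b2+a2*b0+a1*b1 - 10*(a1*b4+a4*b1+a2*b3+a3*b2) - 2*(a2*b4+a4*b2) - a3*b3 - 39*(a3*b4+a4*b3) + 54*a4*b4),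
   (a0*b3+a3*b0+2*(a1*b2+a2*b1) + 7*(a1*b4+a4*b1+a2*b3+a3*b2) - 13*(a2*b4+a4*b2) - 6*a3*b3 + 26*(a3*b4+a4*b3) - 92*a4*b4),
   (a0*b4+a4*b0+a1*b3+a3*b1 + (a1*b4+a4*b1+a2*b3+a3*b2) + 2*a2*b2 + 8*(a2*b4+a4*b2) + 4*a3*b3 - 2*(a3*b4+a4*b3) + 24*a4*b4)⟩

def EE {R : Type} [CommRing R] (f b : R) (t : T5) : R := E5 f b t.1 t.2.1 t.2.2.1 t.2.2.2.1 t.2.2.2.2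

theorem EE_mul {R : Type} [CommRing R] {f b : R} (h : RelL f b) (s t : T5) : EE f b s*EE f b t = EE f b (mul5 s t) := by
  obtain ⟨a0, a1, a2, a3, a4⟩ := s
  obtain ⟨b0, b1, b2, b3, b4⟩ := t
  exact E5_mul h _ _ _ _ _ _ _ _ _ _

def sInv (i : Bool × Bool × Bool) : T5 := mul5 (bif i.1 then (-1, 0, 0, 0, 0) else (1, 0, 0, 0, 0))
  (mul5 (bif i.2.1 then (2, -3, 2, -1, 0) else (1, 0, 0, 0, 0)) (bif i.2.2 then (45, -117, 55, 6, -15) else (1, 0, 0, 0, 0)))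

def b2z (b : Bool) : ℤ := bif b then 1 else 0

def ker (i : Bool × Bool × Bool) (e0 e1 e2 e3 e4 : Bool) : T5 :=
  mul5 (sInv i) (mul5 (b2z e0, b2z e1, b2z e2, b2z e3, b2z e4) (b2z e0, b2z e1, b2z e2, b2z e3, b2z e4))

theorem ex_b2z (a : ℤ) : ∃ e : Bool, ∃ d, a = b2z e + 2*d := by
  rcases Int.even_or_odd' a with ⟨k, hk | hk⟩
  · exact ⟨false, k, by simp [b2z, hk]⟩
  · exact ⟨true, k, by simp [b2z, hk]; ring⟩

section
variable {L : Type} [Field L] [NumberField L] {f b : 𝓞 L}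

theorem FL.inj (h : FL L f b) {a0 a1 a2 a3 a4 c0 c1 c2 c3 c4 : ℤ} (he : E5 f b a0 a1 a2 a3 a4 = E5 f b c0 c1 c2 c3 c4) :
    a0 = c0 ∧ a1 = c1 ∧ a2 = c2 ∧ a3 = c3 ∧ a4 = c4 := by
  obtain ⟨w, -, hr⟩ := h.exBasis
  have this : E5 (f : L) (b : L) a0 a1 a2 a3 a4 = E5 (f : L) (b : L) c0 c1 c2 c3 c4 := by
    rw [← E5_coe, ← E5_coe, he]
  have h1 : ∀ i, ![(a0 : ℚ), a1, a2, a3, a4] i = ![(c0 : ℚ), c1, c2, c3, c4] i := fun i => by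
    rw [← hr, ← hr, this]
  refine ⟨?_, ?_, ?_, ?_, ?_⟩
  · simpa using h1 0
  · simpa using h1 1
  · simpa using h1 2
  · simpa using h1 3
  · simpa using h1 4

theorem FL.sInv (h : FL L f b) (i : Bool × Bool × Bool) : (h.s i : 𝓞 L)*EE f b (sInv i) = 1 := by
  unfold _root_.sInv FL.s
  rw [← EE_mul h.rel, ← EE_mul h.rel]
  obtain ⟨x, y, z⟩ := i
  have e1 : E5 f b (-3) 10 (-4) (-1) 1*EE f b (2, -3, 2, -1, 0) = 1 := by
    unfold EE; rw [E5_mul h.rel]; simp [E5]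
  have e2 : E5 f b 1 1 1 (-3) (-1)*EE f b (45, -117, 55, 6, -15) = 1 := by
    unfold EE; rw [E5_mul h.rel]; simp [E5]
  have e3 : EE f b (1, 0, 0, 0, 0) = 1 := by simp [EE, E5]
  have e4 : EE f b (-1, 0, 0, 0, 0) = -1 := by simp [EE, E5]
  rw [← h.e1v] at e1
  rw [← h.e2v] at e2
  cases x <;> cases y <;> cases z <;> simp only [cond_true, cond_false, e3, e4, one_mul, mul_one, Units.val_neg, Units.val_one, Units.val_mul, e1, e2]
  · linear_combination (h.e2 : 𝓞 L)*EE f b (45, -117, 55, 6, -15)*e1 + e2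
  · ring
  · linear_combination e2
  · linear_combination e1
  · linear_combination (h.e2 : 𝓞 L)*EE f b (45, -117, 55, 6, -15)*e1 + e2

theorem FL.mod4 (h : FL L f b) (a0 a1 a2 a3 a4 : ℤ) (u : (𝓞 L)ˣ) (w : 𝓞 L) (hx : E5 f b a0 a1 a2 a3 a4 = u*w^2) :
    ∃ i e0 e1 e2 e3 e4, IsSquare (E5 f b a0 a1 a2 a3 a4*h.s i) ∧ (4 : ℤ) ∣ a0 - (ker i e0 e1 e2 e3 e4).1 ∧
     (4 : ℤ) ∣ a1 - (ker i e0 e1 e2 e3 e4).2.1 ∧ (4 : ℤ) ∣ a2 - (ker i e0 e1 e2 e3 e4).2.2.1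
     ∧ (4 : ℤ) ∣ a3 - (ker i e0 e1 e2 e3 e4).2.2.2.1 ∧ (4 : ℤ) ∣ a4 - (ker i e0 e1 e2 e3 e4).2.2.2.2 := by
  obtain ⟨i, v, hv⟩ := h.units u
  have hv' : (u : 𝓞 L)*h.s i = v*v := by rw [← Units.val_mul, hv]; rfl
  have hy : E5 f b a0 a1 a2 a3 a4*h.s i = (v*w)*(v*w) := by
    rw [hx]; linear_combination w^2*hv'
  obtain ⟨c0, c1, c2, c3, c4, hc⟩ := h.all.1 (v*w)
  obtain ⟨e0, d0, rfl⟩ := ex_b2z c0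
  obtain ⟨e1, d1, rfl⟩ := ex_b2z c1
  obtain ⟨e2, d2, rfl⟩ := ex_b2z c2
  obtain ⟨e3, d3, rfl⟩ := ex_b2z c3
  obtain ⟨e4, d4, rfl⟩ := ex_b2z c4
  refine ⟨i, e0, e1, e2, e3, e4, ⟨_, hy⟩, ?_⟩
  set t : T5 := (b2z e0, b2z e1, b2z e2, b2z e3, b2z e4) with ht
  have h1 : (v : 𝓞 L)*w = EE f b t + 2*E5 f b d0 d1 d2 d3 d4 := by
    rw [hc]; simp only [EE, E5, ht]; push_cast; ring
  obtain ⟨g0, g1, g2, g3, g4, hg⟩ := h.all.1 (EE f b (_root_.sInv i)*(EE f b t*E5 f b d0 d1 d2 d3 d4 + E5 f b d0 d1 d2 d3 d4^2))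
  have h2 : E5 f b a0 a1 a2 a3 a4 = EE f b (ker i e0 e1 e2 e3 e4) + 4*E5 f b g0 g1 g2 g3 g4 := by
    rw [h1] at hy
    unfold ker
    rw [← EE_mul h.rel, ← EE_mul h.rel, ← ht]
    linear_combination EE f b (_root_.sInv i)*hy - E5 f b a0 a1 a2 a3 a4*h.sInv i + 4*hg
  generalize ker i e0 e1 e2 e3 e4 = K at *
  obtain ⟨k0, k1, k2, k3, k4⟩ := K
  have h3 : E5 f b a0 a1 a2 a3 a4 = E5 f b (k0 + 4*g0) (k1 + 4*g1) (k2 + 4*g2) (k3 + 4*g3) (k4 + 4*g4) := by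
    rw [h2]; simp only [EE, E5]; push_cast; ring
  obtain ⟨r0, r1, r2, r3, r4⟩ := h.inj h3
  simp only
  refine ⟨?_, ?_, ?_, ?_, ?_⟩ <;> omega

theorem ker_chk : ∀ i e0 e1 e2 e3 e4, (ker i e0 e1 e2 e3 e4).2.2.2.2 % 4 = 0 → (ker i e0 e1 e2 e3 e4).2.2.2.1 % 2 = 0 →
    (ker i e0 e1 e2 e3 e4).2.2.1 % 2 = 0 →
    ((ker i e0 e1 e2 e3 e4).2.2.2.1 % 4 = 2 → (ker i e0 e1 e2 e3 e4).2.1 % 2 = 1 → (ker i e0 e1 e2 e3 e4).1 % 2 = 0 → False) ∧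
    ((ker i e0 e1 e2 e3 e4).2.2.2.1 % 4 = 0 → (ker i e0 e1 e2 e3 e4).2.1 % 2 = 0 → (ker i e0 e1 e2 e3 e4).1 % 2 = 1 →
     (ker i e0 e1 e2 e3 e4).2.2.1 % 4 = 0 ∧ (i = (false, false, false) ∨ i = (true, false, false) ∧ ((ker i e0 e1 e2 e3 e4).1 + (ker i e0 e1 e2 e3 e4).2.1) % 4 ≠ 1)) := by
  decide +kernel

theorem FL.sel2 (h : FL L f b) (A0 A1 A2 A3 : ℤ) (h0 : A0 % 2 = 1) (h1 : A1 % 2 = 1) (h2 : A2 % 2 = 0) (h3 : A3 % 2 = 1)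
    (u : (𝓞 L)ˣ) (w : 𝓞 L) (hx : E5 f b (A0 - A3) A1 A2 (2*A3) 0 = u*w^2) : False := by
  obtain ⟨i, e0, e1, e2, e3, e4, -, r0, r1, r2, r3, r4⟩ := h.mod4 _ _ _ _ _ u w hx
  have := ker_chk i e0 e1 e2 e3 e4
  generalize ker i e0 e1 e2 e3 e4 = K at *
  exact (this (by omega) (by omega) (by omega)).1 (by omega) (by omega) (by omega)

theorem FL.sel1 (h : FL L f b) (A0 A1 A2 A3 : ℤ) (h0 : A0 % 4 = 1) (h1 : A1 % 2 = 0) (h2 : A2 % 2 = 0) (h3 : A3 % 2 = 0)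
    (u : (𝓞 L)ˣ) (w : 𝓞 L) (hx : E5 f b (A0 - A3) A1 A2 (2*A3) 0 = u*w^2) :
    A2 % 4 = 0 ∧ ((A1 - A3) % 4 = 0 → IsSquare (E5 f b (A0 - A3) A1 A2 (2*A3) 0)) := by
  obtain ⟨i, e0, e1, e2, e3, e4, hs, r0, r1, r2, r3, r4⟩ := h.mod4 _ _ _ _ _ u w hx
  have := ker_chk i e0 e1 e2 e3 e4
  generalize ker i e0 e1 e2 e3 e4 = K at *
  obtain ⟨p, q⟩ := (this (by omega) (by omega) (by omega)).2 (by omega) (by omega) (by omega)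
  refine ⟨by omega, fun h4 => ?_⟩
  rcases q with rfl | ⟨-, q⟩
  · simpa [FL.s] using hs
  · omega
end

def E3 {R : Type} [CommRing R] (f c : R) (a0 a1 a2 : ℤ) : R := a0 + a1*f + a2*c

theorem E3_mul {R : Type} [CommRing R] {f c : R} (r1 : f^2 = 2*c - 1) (r2 : f*c = 1 + f - 3*c)
    (r3 : c^2 = -2 - f + 6*c) (a0 a1 a2 b0 b1 b2 : ℤ) :
    E3 f c a0 a1 a2*E3 f c b0 b1 b2 = E3 f c (a0*b0 - a1*b1 + (a1*b2 + a2*b1) - 2*a2*b2)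
      (a0*b1 + a1*b0 + (a1*b2 + a2*b1) - a2*b2)
      (a0*b2 + a2*b0 + 2*a1*b1 - 3*(a1*b2 + a2*b1) + 6*a2*b2) := by
  unfold E3
  push_cast
  linear_combination (a1 : R)*b1*r1 + ((a1 : R)*b2 + a2*b1)*r2 + (a2 : R)*b2*r3

theorem irrG : Irreducible (X^3 + 3*X^2 - X + 1 : ℤ[X]) := by
  have hm : (X^3 + 3*X^2 - X + 1 : ℤ[X]).Monic := by monicity!
  have hd : (X^3 + 3*X^2 - X + 1 : ℤ[X]).natDegree = 3 := by compute_degree!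
  rw [hm.irreducible_iff_roots_eq_zero_of_degree_le_three (by omega) (by omega)]
  rw [Multiset.eq_zero_iff_forall_notMem]
  intro a ha
  have h := isRoot_of_mem_roots ha
  simp [IsRoot] at h
  have h' := congrArg (Int.cast : ℤ → ZMod 3) h
  push_cast at h'
  generalize (a : ZMod 3) = t at h'
  revert t; decide

theorem irrGQ : Irreducible (X^3 + 3*X^2 - X + 1 : ℚ[X]) := by
  have hm : (X^3 + 3*X^2 - X + 1 : ℤ[X]).Monic := by monicity!
  have := (hm.irreducible_iff_irreducible_map_fraction_map (K := ℚ)).1 irrG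
  simpa using this

structure FK (K : Type) [Field K] [NumberField K] (f c : 𝓞 K) : Prop where
  hf : f^3 + 3*f^2 - f + 1 = 0
  hc : 2*c = 1 + f^2
  hfr : Module.finrank ℚ K = 3

theorem realG (x y : ℝ) (hx : x^3 + 3*x^2 - x + 1 = 0) (hy : y^3 + 3*y^2 - y + 1 = 0) : x = y := by
  have key : ∀ x : ℝ, x^3 + 3*x^2 - x + 1 = 0 → x < -3 := by
    intro x hx
    by_contra! h
    nlinarith [mul_nonneg (by linarith : 0 ≤ x + 3) (sq_nonneg (x - 1/6))]
  by_contra hne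
  have : (x - y)*((x + 1)^2 + (x + 1)*(y + 1) + (y + 1)^2 - 4) = 0 := by linear_combination hx - hy
  rcases mul_eq_zero.1 this with h | h
  · exact hne (by linarith)
  · have h1 := key x hx
    have h2 := key y hy
    nlinarith

theorem exFK {K : Type} [Field K] [NumberField K] (x : K) (hx : x^3 + 3*x^2 - x + 1 = 0)
    (hfr : Module.finrank ℚ K = 3) : ∃ f c : 𝓞 K, (f : K) = x ∧ FK K f c := by
  have hxi : IsIntegral ℤ x := ⟨X^3 + 3*X^2 - X + 1, by monicity!, by simpa using hx⟩
  have hbi : IsIntegral ℤ ((1 + x^2) / 2) := by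
    refine ⟨X^3 - 7*X^2 + 5*X - 1, by monicity!, ?_⟩
    simp
    linear_combination (x^3 - 3*x^2 - x - 1) / 8*hx
  refine ⟨⟨x, hxi⟩, ⟨_, hbi⟩, rfl, ⟨?_, ?_, hfr⟩⟩
  · apply RingOfIntegers.ext
    simp only [map_add, map_sub, map_mul, map_pow, map_ofNat, map_zero, map_one]
    exact hx
  · apply RingOfIntegers.ext
    simp only [map_add, map_sub, map_mul, map_pow, map_ofNat, map_one]
    change 2*((1 + x^2) / 2) = 1 + x^2
    ring

section
variable {K : Type} [Field K] [NumberField K] {f c : 𝓞 K}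

theorem FK.hx (h : FK K f c) : (f : K)^3 + 3*(f : K)^2 - (f : K) + 1 = 0 := by
  have := congrArg (algebraMap (𝓞 K) K) h.hf
  simpa only [map_add, map_sub, map_mul, map_pow, map_ofNat, map_zero, map_one] using this

theorem FK.hcx (h : FK K f c) : 2*(c : K) = 1 + (f : K)^2 := by
  have := congrArg (algebraMap (𝓞 K) K) h.hc
  simpa only [map_add, map_sub, map_mul, map_pow, map_ofNat, map_one] using this

theorem relK_of {R : Type} [CommRing R] [IsDomain R] [CharZero R] {f c : R}
    (hf : f^3 + 3*f^2 - f + 1 = 0) (hc : 2*c = 1 + f^2) (a0 a1 a2 b0 b1 b2 : ℤ) :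
    E3 f c a0 a1 a2*E3 f c b0 b1 b2 = E3 f c (a0*b0 - a1*b1 + (a1*b2 + a2*b1) - 2*a2*b2)
      (a0*b1 + a1*b0 + (a1*b2 + a2*b1) - a2*b2)
      (a0*b2 + a2*b0 + 2*a1*b1 - 3*(a1*b2 + a2*b1) + 6*a2*b2) := by
  have h2 : (2 : R) ≠ 0 := two_ne_zero
  have h4 : (4 : R) ≠ 0 := by norm_num
  apply E3_mul
  · linear_combination -hc
  · apply mul_left_cancel₀ h2
    linear_combination (f + 3)*hc + hf
  · apply mul_left_cancel₀ h4
    linear_combination (2*c + f^2 + 1 - 12)*hc + (f - 3)*hf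

theorem E3_coe (a0 a1 a2 : ℤ) : ((E3 f c a0 a1 a2 : 𝓞 K) : K) = E3 (f : K) (c : K) a0 a1 a2 := by
  simp [E3]

theorem indepG {L : Type} [Field L] [CharZero L] (x : L)
    (hx : x^3 + 3*x^2 - x + 1 = 0) (c0 c1 c2 : ℚ)
    (h : (c0 : L) + c1*x + c2*x^2 = 0) : c0 = 0 ∧ c1 = 0 ∧ c2 = 0 := by
  have hmp : minpoly ℚ x = X^3 + 3*X^2 - X + 1 := by
    symm
    apply minpoly.eq_of_irreducible_of_monic irrGQ
    · simpa [map_ofNat] using hx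
    · monicity!
  set p : ℚ[X] := C c2*X^2 + C c1*X + C c0 with hp
  have h1 : aeval x p = 0 := by
    simp only [hp, map_add, map_mul, aeval_C, map_pow, aeval_X, eq_ratCast]
    linear_combination h
  have h2 : p = 0 := by
    by_contra hne
    have h3 := minpoly.degree_le_of_ne_zero ℚ x hne h1
    rw [hmp] at h3
    have h4 : (X^3 + 3*X^2 - X + 1 : ℚ[X]).degree = 3 := by
      compute_degree!
    have h5 : p.degree ≤ 2 := by rw [hp]; compute_degree
    rw [h4] at h3
    exact absurd (h3.trans h5) (by decide)
  have hc : ∀ i, p.coeff i = 0 := fun i => by rw [h2]; simp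
  refine ⟨?_, ?_, ?_⟩
  · have := hc 0; simpa [hp, coeff_X, coeff_X_pow, coeff_C] using this
  · have := hc 1; simpa [hp, coeff_X, coeff_X_pow, coeff_C] using this
  · have := hc 2; simpa [hp, coeff_X, coeff_X_pow, coeff_C] using this

theorem FK.exBasis (h : FK K f c) : ∃ w : Basis (Fin 3) ℚ K, (∀ i, w i = ![1, (f : K), (c : K)] i) ∧
    ∀ a0 a1 a2 : ℤ, ∀ i, w.repr (E3 (f : K) (c : K) a0 a1 a2) i = ![(a0 : ℚ), a1, a2] i := by
  have hli : LinearIndependent ℚ ![1, (f : K), (c : K)] := by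
    rw [Fintype.linearIndependent_iff]
    intro g hg
    simp only [Fin.sum_univ_three, Matrix.cons_val, Algebra.smul_def, eq_ratCast] at hg
    have := indepG (f : K) h.hx (g 0 + g 2 / 2) (g 1) (g 2 / 2) (by
      push_cast
      linear_combination hg - (g 2 / 2)*h.hcx)
    obtain ⟨h0, h1, h2⟩ := this
    intro i
    fin_cases i <;> simp only [Fin.zero_eta, Fin.mk_one, Fin.reduceFinMk] <;> linarith
  let w := basisOfLinearIndependentOfCardEqFinrank hli (by rw [h.hfr]; rfl)
  have hw : ∀ i, w i = ![1, (f : K), (c : K)] i := fun i => by simp [w]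
  refine ⟨w, hw, fun a0 a1 a2 i => ?_⟩
  have : E3 (f : K) (c : K) a0 a1 a2 = ∑ j, (![(a0 : ℚ), a1, a2] j) • w j := by
    simp only [hw, Fin.sum_univ_three, Matrix.cons_val, Algebra.smul_def, eq_ratCast, E3]
    push_cast
    ring
  rw [this, Basis.repr_sum_self]

def M3 (a0 a1 a2 : ℤ) : Matrix (Fin 3) (Fin 3) ℤ :=
  !![a0, -a1 + a2, a1 - 2*a2; a1, a0 + a2, a1 - a2; a2, 2*a1 - 3*a2, a0 - 3*a1 + 6*a2]

theorem FK.leftMul (h : FK K f c) (w : Basis (Fin 3) ℚ K) (hw : ∀ i, w i = ![1, (f : K), (c : K)] i)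
    (hr : ∀ a0 a1 a2 : ℤ, ∀ i, w.repr (E3 (f : K) (c : K) a0 a1 a2) i = ![(a0 : ℚ), a1, a2] i)
    (a0 a1 a2 : ℤ) :
    Algebra.leftMulMatrix w (E3 (f : K) (c : K) a0 a1 a2) = (M3 a0 a1 a2).map (Int.cast : ℤ → ℚ) := by
  have e : ∀ j, w j = E3 (f : K) (c : K) (![1,0,0] j) (![0,1,0] j) (![0,0,1] j) := by
    intro j
    rw [hw]
    fin_cases j <;> simp [E3]
  ext i j
  rw [Algebra.leftMulMatrix_eq_repr_mul, e j, relK_of h.hx h.hcx, hr, Matrix.map_apply]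
  fin_cases i <;> fin_cases j <;> simp [M3] <;> ring

theorem FK.trace (h : FK K f c) (a0 a1 a2 : ℤ) :
    Algebra.trace ℤ (𝓞 K) (E3 f c a0 a1 a2) = 3*a0 - 3*a1 + 7*a2 := by
  obtain ⟨w, hw, hr⟩ := h.exBasis
  have : ((Algebra.trace ℤ (𝓞 K) (E3 f c a0 a1 a2) : ℤ) : ℚ) = ((3*a0 - 3*a1 + 7*a2 : ℤ) : ℚ) := by
    rw [Algebra.coe_trace_int, E3_coe, Algebra.trace_eq_matrix_trace w, h.leftMul w hw hr]
    simp [Matrix.trace, Fin.sum_univ_three, M3]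
    ring
  exact_mod_cast this

theorem FK.norm (h : FK K f c) (a0 a1 a2 : ℤ) :
    Algebra.norm ℤ (E3 f c a0 a1 a2) = (M3 a0 a1 a2).det := by
  obtain ⟨w, hw, hr⟩ := h.exBasis
  have : ((Algebra.norm ℤ (E3 f c a0 a1 a2) : ℤ) : ℚ) = (((M3 a0 a1 a2).det : ℤ) : ℚ) := by
    rw [Algebra.coe_norm_int, E3_coe, Algebra.norm_eq_matrix_det w, h.leftMul w hw hr, Int.cast_det]
  exact_mod_cast this

theorem FK.discrE (h : FK K f c) : Algebra.discr ℤ ![1, f, c] = -44 := by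
  have e : ∀ j, (![1, f, c] : Fin 3 → 𝓞 K) j = E3 f c (![1,0,0] j) (![0,1,0] j) (![0,0,1] j) := by
    intro j
    fin_cases j <;> simp [E3]
  have hm : Algebra.traceMatrix ℤ (![1, f, c] : Fin 3 → 𝓞 K) =
    !![3, -3, 7; -3, 11, -21; 7, -21, 39] := by
    ext i j
    rw [Algebra.traceMatrix_apply, Algebra.traceForm_apply, e i, e j, relK_of h.hf h.hc, h.trace]
    fin_cases i <;> fin_cases j <;> simp
  rw [Algebra.discr_def, hm]
  decide +kernel

theorem FK.half (h : FK K f c) (y : 𝓞 K) (a0 a1 a2 : ℤ) (hy : 2*y = E3 f c a0 a1 a2) :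
    ∃ b0 b1 b2 : ℤ, y = E3 f c b0 b1 b2 := by
  have ht := h.trace a0 a1 a2
  rw [← hy, two_mul, map_add] at ht
  have hn : ∀ (b0 b1 b2 : ℤ) (z : 𝓞 K), 2*z = E3 f c b0 b1 b2 → (8 : ℤ) ∣ (M3 b0 b1 b2).det := by
    intro b0 b1 b2 z hz
    rw [← h.norm, ← hz, map_mul]
    have e : (2 : 𝓞 K) = E3 f c 2 0 0 := by simp [E3]
    rw [e, h.norm]
    exact Dvd.intro _ (by congr 1)
  obtain ⟨e0, d0, rfl⟩ := ex_b2z a0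
  obtain ⟨e1, d1, rfl⟩ := ex_b2z a1
  obtain ⟨e2, d2, rfl⟩ := ex_b2z a2
  have h1 := hn (b2z e0) (b2z e1) (b2z e2) (y - E3 f c d0 d1 d2) (by
    rw [mul_sub, hy]; simp only [E3]; push_cast; ring)
  have h2 : (2 : ℤ) ∣ b2z e0 + b2z e1 + b2z e2 := by omega
  have h3 : e0 = false ∧ e1 = false ∧ e2 = false := by
    clear * - h1 h2
    revert e0 e1 e2
    decide +kernel
  obtain ⟨rfl, rfl, rfl⟩ := h3
  refine ⟨d0, d1, d2, mul_left_cancel₀ (two_ne_zero (α := 𝓞 K)) ?_⟩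
  rw [hy]; simp [E3, b2z]; ring

theorem FK.all (h : FK K f c) : (∀ y, ∃ b0 b1 b2 : ℤ, y = E3 f c b0 b1 b2) ∧ |discr K| ≤ 44 := by
  obtain ⟨d, hd, hy⟩ := index_gen 3 h.hfr ![1, f, c]
  rw [h.discrE] at hd
  have hd0 : d ≠ 0 := by rintro rfl; norm_num at hd
  have h1 : 0 < d^2 := by positivity
  have hab : d^2*|discr K| = 44 := by
    rw [← abs_sq d, ← abs_mul, ← hd]; rfl
  have hdd : d = 1 ∨ d = -1 ∨ d = 2 ∨ d = -2 := by
    have h0 : discr K ≠ 0 := discr_ne_zero K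
    have h0' : 0 < |discr K| := abs_pos.2 h0
    have hb1 : d ≤ 6 := by nlinarith
    have hb2 : -6 ≤ d := by nlinarith
    interval_cases d <;> first | omega | simp
  have hy' : ∀ y : 𝓞 K, ∃ b0 b1 b2 : ℤ, (d : 𝓞 K)*y = E3 f c b0 b1 b2 := fun y => by
    obtain ⟨e, hc⟩ := hy y
    refine ⟨e 0, e 1, e 2, ?_⟩
    rw [zsmul_eq_mul] at hc
    rw [hc]
    simp [Fin.sum_univ_three, E3]
  refine ⟨fun y => ?_, by nlinarith [abs_nonneg (discr K)]⟩
  rcases hdd with rfl | rfl | rfl | rfl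
  · simpa using hy' y
  · simpa using hy' (-y)
  · obtain ⟨b0, b1, b2, hb⟩ := hy' y
    exact h.half y b0 b1 b2 (by simpa using hb)
  · obtain ⟨b0, b1, b2, hb⟩ := hy' (-y)
    exact h.half y b0 b1 b2 (by simpa using hb)

theorem FK.inj (h : FK K f c) {a0 a1 a2 c0 c1 c2 : ℤ} (he : E3 f c a0 a1 a2 = E3 f c c0 c1 c2) :
    a0 = c0 ∧ a1 = c1 ∧ a2 = c2 := by
  obtain ⟨w, -, hr⟩ := h.exBasis
  have this : E3 (f : K) (c : K) a0 a1 a2 = E3 (f : K) (c : K) c0 c1 c2 := by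
    rw [← E3_coe, ← E3_coe, he]
  have h1 : ∀ i, ![(a0 : ℚ), a1, a2] i = ![(c0 : ℚ), c1, c2] i := fun i => by
    rw [← hr, ← hr, this]
  refine ⟨?_, ?_, ?_⟩
  · simpa using h1 0
  · simpa using h1 1
  · simpa using h1 2

theorem FK.rank (h : FK K f c) : Units.rank K ≤ 1 ∧ InfinitePlace.nrComplexPlaces K ≤ 1 := by
  obtain ⟨w, hw, -⟩ := h.exBasis
  have had : Algebra.adjoin ℚ {(f : K)} = ⊤ := by
    rw [eq_top_iff]
    intro y _
    rw [← w.sum_repr y]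
    have hf : (f : K) ∈ Algebra.adjoin ℚ {(f : K)} := Algebra.subset_adjoin rfl
    have hb : (c : K) ∈ Algebra.adjoin ℚ {(f : K)} := by
      have : (c : K) = (1 / 2 : ℚ) • (1 + (f : K)^2) := by
        rw [← h.hcx, Algebra.smul_def]; simp
      rw [this]
      exact Subalgebra.smul_mem _ (Subalgebra.add_mem _ (Subalgebra.one_mem _) (Subalgebra.pow_mem _ hf 2)) _
    refine Subalgebra.sum_mem _ fun i _ => Subalgebra.smul_mem _ ?_ _
    rw [hw]
    fin_cases i
    · exact Subalgebra.one_mem _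
    · exact hf
    · exact hb
  have h1 : InfinitePlace.nrRealPlaces K ≤ 1 := by
    apply real_le_one (f : K) had
    intro σ τ
    have hs := congrArg σ h.hx
    have ht := congrArg τ h.hx
    simp only [map_add, map_sub, map_mul, map_pow, map_ofNat, map_zero, map_one] at hs ht
    exact realG _ _ hs ht
  have h2 := InfinitePlace.card_add_two_mul_card_eq_rank K
  rw [h.hfr] at h2
  rw [Units.rank, InfinitePlace.card_eq_nrRealPlaces_add_nrComplexPlaces]
  omega

theorem FK.pid (h : FK K f c) : IsPrincipalIdealRing (𝓞 K) := by
  apply RingOfIntegers.isPrincipalIdealRing_of_abs_discr_lt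
  have h2 := h.rank.2
  have hd : (|discr K| : ℝ) ≤ 44 := by exact_mod_cast h.all.2
  have hpi := Real.pi_gt_d4
  have e1 : Real.pi / 4 ≤ (Real.pi / 4)^InfinitePlace.nrComplexPlaces K := by
    nth_rewrite 1 [← pow_one (Real.pi / 4)]
    exact pow_le_pow_of_le_one (by positivity) (by linarith [Real.pi_le_four]) h2
  rw [h.hfr]
  have e2 : (7.0 : ℝ) ≤ 2*(Real.pi / 4)^InfinitePlace.nrComplexPlaces K*(((3 : ℕ) : ℝ)^3 / ((3 : ℕ).factorial : ℝ)) := by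
    norm_num [Nat.factorial]
    linarith
  push_cast at hd e2 ⊢
  nlinarith

def FK.w (h : FK K f c) : (𝓞 K)ˣ := Units.mkOfMulEqOne (E3 f c (-1) 1 1) (E3 f c 0 (-2) (-1)) (by
  rw [relK_of h.hf h.hc]; simp [E3])

def FK.s (h : FK K f c) (i : Bool × Bool) : (𝓞 K)ˣ := (bif i.1 then -1 else 1)*(bif i.2 then h.w else 1)

def ker3 (i : Bool × Bool) (e0 e1 e2 : Bool) : ℤ × ℤ × ℤ :=
  let m : ℤ × ℤ × ℤ → ℤ × ℤ × ℤ → ℤ × ℤ × ℤ := fun a b =>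
    (a.1*b.1 - a.2.1*b.2.1 + (a.2.1*b.2.2 + a.2.2*b.2.1) - 2*a.2.2*b.2.2,
      a.1*b.2.1 + a.2.1*b.1 + (a.2.1*b.2.2 + a.2.2*b.2.1) - a.2.2*b.2.2,
      a.1*b.2.2 + a.2.2*b.1 + 2*a.2.1*b.2.1 - 3*(a.2.1*b.2.2 + a.2.2*b.2.1) + 6*a.2.2*b.2.2)
  m (bif i.1 then -1 else 1, 0, 0) (m (bif i.2 then (0, -2, -1) else (1, 0, 0)) (m (b2z e0, b2z e1, b2z e2) (b2z e0, b2z e1, b2z e2)))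

theorem FK.mod4 (h : FK K f c) (a0 a1 a2 : ℤ) (i : Bool × Bool) (w : 𝓞 K) (hx : E3 f c a0 a1 a2*h.s i = w*w) :
    ∃ e0 e1 e2, (4 : ℤ) ∣ a0 - (ker3 i e0 e1 e2).1 ∧
     (4 : ℤ) ∣ a1 - (ker3 i e0 e1 e2).2.1 ∧ (4 : ℤ) ∣ a2 - (ker3 i e0 e1 e2).2.2 := by
  obtain ⟨c0, c1, c2, rfl⟩ := h.all.1 w
  obtain ⟨e0, d0, rfl⟩ := ex_b2z c0
  obtain ⟨e1, d1, rfl⟩ := ex_b2z c1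
  obtain ⟨e2, d2, rfl⟩ := ex_b2z c2
  refine ⟨e0, e1, e2, ?_⟩
  have hwv : (h.w : 𝓞 K)*E3 f c 0 (-2) (-1) = 1 := h.w.mul_inv
  set si := E3 f c (bif i.1 then -1 else 1) 0 0*E3 f c (bif i.2 then 0 else 1) (bif i.2 then -2 else 0) (bif i.2 then -1 else 0) with hsi
  have hs : (h.s i : 𝓞 K)*si = 1 := by
    rw [hsi]
    unfold FK.s
    obtain ⟨x, y⟩ := i
    have e3 : E3 f c 1 0 0 = 1 := by simp [E3]
    have e4 : E3 f c (-1) 0 0 = -1 := by simp [E3]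
    cases x <;> cases y <;> simp only [cond_true, cond_false, e3, e4, one_mul, mul_one, Units.val_neg, Units.val_one, Units.val_mul, hwv]
    · ring
    · linear_combination hwv
  set T := E3 f c (b2z e0) (b2z e1) (b2z e2) with hT
  set S := E3 f c d0 d1 d2 with hS
  have h1 : E3 f c (b2z e0 + 2*d0) (b2z e1 + 2*d1) (b2z e2 + 2*d2) = T + 2*S := by
    simp only [hT, hS, E3]; push_cast; ring
  obtain ⟨g0, g1, g2, hg⟩ := h.all.1 (si*(T*S + S^2))
  have h2 : E3 f c a0 a1 a2 = si*(T*T) + 4*E3 f c g0 g1 g2 := by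
    rw [h1] at hx
    linear_combination si*hx - E3 f c a0 a1 a2*hs + 4*hg
  rw [hsi, hT, relK_of h.hf h.hc, mul_assoc, relK_of h.hf h.hc, relK_of h.hf h.hc] at h2
  have h3 : E3 f c a0 a1 a2 = E3 f c ((ker3 i e0 e1 e2).1 + 4*g0) ((ker3 i e0 e1 e2).2.1 + 4*g1) ((ker3 i e0 e1 e2).2.2 + 4*g2) := by
    rw [h2]
    obtain ⟨x, y⟩ := i
    cases x <;> cases y <;> simp only [ker3, E3, cond_true, cond_false] <;> push_cast <;> ring
  obtain ⟨r0, r1, r2⟩ := h.inj h3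
  refine ⟨?_, ?_, ?_⟩ <;> omega
end

section
variable {K : Type} [Field K] [NumberField K] {f c : 𝓞 K}

theorem FK.indep (h : FK K f c) (i j : Bool × Bool) (hij : i ≠ j) : ¬ IsSquare (h.s i*h.s j) := by
  rintro ⟨v, hv⟩
  have hv' : (h.s i : 𝓞 K)*h.s j = v*v := by rw [← Units.val_mul, hv]; rfl
  have hn := congrArg (Algebra.norm ℤ) hv'
  have hw : Algebra.norm ℤ (h.w : 𝓞 K) = 1 := by
    change Algebra.norm ℤ (E3 f c (-1) 1 1) = 1
    rw [h.norm]; decide +kernel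
  have hm : Algebra.norm ℤ (-1 : 𝓞 K) = -1 := by
    rw [show (-1 : 𝓞 K) = E3 f c (-1) 0 0 by simp [E3], h.norm]; decide +kernel
  have hmw : Algebra.norm ℤ (-(h.w : 𝓞 K)) = -1 := by
    rw [← neg_one_mul, map_mul, hw, hm]; rfl
  rw [map_mul, map_mul] at hn
  have hww : ∀ v : 𝓞 K, ¬ (h.w : 𝓞 K) = v*v := by
    intro v hv
    obtain ⟨e0, e1, e2, r⟩ := h.mod4 (-1) 1 1 (false, false) v (by
      simp only [FK.s, cond_false, mul_one, Units.val_one]; exact hv)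
    revert e0 e1 e2
    decide +kernel
  have hsq := mul_self_nonneg (Algebra.norm ℤ (v : 𝓞 K))
  rw [← hn] at hsq
  obtain ⟨i1, i2⟩ := i
  obtain ⟨j1, j2⟩ := j
  cases i1 <;> cases i2 <;> cases j1 <;> cases j2 <;> simp [FK.s, hw, hm, hmw] at hij hsq hv' <;>
  first | exact hww _ hv' | (norm_num at hsq; done)

theorem FK.sel1 (h : FK K f c) (A0 A1 A2 A3 : ℤ) (h0 : A0 % 4 = 1) (h1 : A1 % 2 = 0) (h2 : A2 % 4 = 0) (h3 : A3 % 2 = 0)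
    (u : (𝓞 K)ˣ) (w : 𝓞 K) (hx : E3 f c (A0 - A2 + 2*A3) (A1 + A3) (2*A2 - 6*A3) = u*w^2) :
    (A1 - A3) % 4 = 0 ∧ IsSquare (E3 f c (A0 - A2 + 2*A3) (A1 + A3) (2*A2 - 6*A3)) := by
  obtain ⟨i, v, hv⟩ := units_classes (by rw [h.hfr]; decide) 1 h.rank.1 (by simp) h.s h.indep u
  have hv' : (u : 𝓞 K)*h.s i = v*v := by rw [← Units.val_mul, hv]; rfl
  have hy : E3 f c (A0 - A2 + 2*A3) (A1 + A3) (2*A2 - 6*A3)*h.s i = (v*w)*(v*w) := by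
    rw [hx]; linear_combination w^2*hv'
  obtain ⟨e0, e1, e2, r0, r1, r2⟩ := h.mod4 _ _ _ i _ hy
  have key : ∀ i e0 e1 e2, (ker3 i e0 e1 e2).1 % 4 = 1 → (ker3 i e0 e1 e2).2.1 % 2 = 0 → (ker3 i e0 e1 e2).2.2 % 4 = 0 →
    (ker3 i e0 e1 e2).2.1 % 4 = 0 ∧ i = (false, false) := by decide +kernel
  have := key i e0 e1 e2
  generalize ker3 i e0 e1 e2 = k at *
  obtain ⟨p, rfl⟩ := this (by omega) (by omega) (by omega)
  refine ⟨by omega, v*w, ?_⟩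
  simpa [FK.s] using hy
end

noncomputable def cub (a0 a1 a2 a3 : ℤ) : ℤ[X] := C a0 + C a1*X + C a2*X^2 + C a3*X^3

theorem cub_aeval {R : Type} [CommRing R] (x : R) (a0 a1 a2 a3 : ℤ) :
    aeval x (cub a0 a1 a2 a3) = a0 + a1*x + a2*x^2 + a3*x^3 := by
  simp [cub]

theorem cub_deg (a0 a1 a2 a3 : ℤ) : (cub a0 a1 a2 a3).natDegree ≤ 3 := by
  unfold cub; compute_degree

theorem cub_coeff (a0 a1 a2 a3 : ℤ) : (cub a0 a1 a2 a3).coeff 0 = a0 ∧ (cub a0 a1 a2 a3).coeff 1 = a1 ∧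
    (cub a0 a1 a2 a3).coeff 2 = a2 ∧ (cub a0 a1 a2 a3).coeff 3 = a3 := by
  refine ⟨?_, ?_, ?_, ?_⟩ <;> simp [-eq_intCast, cub, coeff_X, coeff_C, coeff_X_pow]

theorem cub_map_coeff (a0 a1 a2 a3 : ℤ) (i : ℕ) : ((cub a0 a1 a2 a3).map (Int.castRingHom ℚ)).coeff i =
    ((cub a0 a1 a2 a3).coeff i : ℚ) := by simp

theorem FL.us {L : Type} [Field L] [NumberField L] {f b : 𝓞 L} (h : FL L f b) (A0 A1 A2 A3 : ℤ)
    (hA : (cub A0 A1 A2 A3).IsPrimitive) (B : ℤ[X]) (D : ℤ) (hD : D ≠ 0)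
    (hAB : cub A0 A1 A2 A3 ∣ B^2 - C D^2*(X^3 + 3*X^2 - X + 1)*(X^5 - X^4 - 7*X^3 + 21*X^2 - 17*X + 5))
    (hs : A0 % 2 = 1 ∧ A1 % 2 = 0 ∧ A2 % 2 = 0 ∧ A3 % 2 = 0 ∨ A0 % 2 = 1 ∧ A1 % 2 = 1 ∧ A2 % 2 = 0 ∧ A3 % 2 = 1) :
    ∃ (u : (𝓞 L)ˣ) (w : 𝓞 L), E5 f b (A0 - A3) A1 A2 (2*A3) 0 = u*w^2 := by
  have e : aeval f (cub A0 A1 A2 A3) = E5 f b (A0 - A3) A1 A2 (2*A3) 0 := by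
    rw [cub_aeval]; simp only [E5]; push_cast; linear_combination - (A3 : 𝓞 L)*h.hb
  have := h.pid
  rw [← e]
  have hf := h.hf
  refine selmer_us f (X^5 - X^4 - 7*X^3 + 21*X^2 - 17*X + 5) (X^3 + 3*X^2 - X + 1)
    (by monicity!) irrH (by simpa [map_ofNat] using h.hf) ?_ ?_ _ B D hD hA ?_ hAB ?_
  · intro y
    obtain ⟨a0, a1, a2, a3, a4, rfl⟩ := h.all.1 y
    refine ⟨1, C (2*a0) + C (2*a1)*X + C (2*a2)*X^2 + C a3*(1 + X^3) + C a4*(X*(1 + X^3)), ?_⟩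
    simp [E5, map_ofNat]
    linear_combination (- (a3 : 𝓞 L) - a4*f)*h.hb
  · refine ⟨9 - 18*f + 15*f^2 - 6*f^3 + f^4, ?_⟩
    simp [map_ofNat]
    linear_combination (-1 + 2*f - f^2)*h.hf
  · have hi : Irreducible ((X^5 - X^4 - 7*X^3 + 21*X^2 - 17*X + 5 : ℤ[X]).map (Int.castRingHom ℚ)) := by
      simpa using irrHQ
    refine ((hi.coprime_iff_not_dvd).2 fun hd => ?_).symm
    have hne : (cub A0 A1 A2 A3).map (Int.castRingHom ℚ) ≠ 0 := by
      rw [Ne, Polynomial.map_eq_zero_iff (RingHom.injective_int _)]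
      exact hA.ne_zero
    have := natDegree_le_of_dvd hd hne
    rw [Monic.natDegree_map (by monicity!)] at this
    have h3 := natDegree_map_le (f := Int.castRingHom ℚ) (p := cub A0 A1 A2 A3)
    have h4 := cub_deg A0 A1 A2 A3
    have h5 : (X^5 - X^4 - 7*X^3 + 21*X^2 - 17*X + 5 : ℤ[X]).natDegree = 5 := by compute_degree!
    omega
  · intro π hπ h2 hd
    rw [cub_aeval] at hd
    apply hπ.not_isUnit
    rw [isUnit_iff_dvd_one]
    rcases hs with ⟨r0, r1, r2, r3⟩ | ⟨r0, r1, r2, r3⟩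
    · have : (1 : 𝓞 L) = (A0 + A1*f + A2*f^2 + A3*f^3) - 2*((A0 / 2 : ℤ) + (A1 / 2 : ℤ)*f + (A2 / 2 : ℤ)*f^2 + (A3 / 2 : ℤ)*f^3) := by
        have q0 : A0 = 2*(A0 / 2) + 1 := by omega
        have q1 : A1 = 2*(A1 / 2) := by omega
        have q2 : A2 = 2*(A2 / 2) := by omega
        have q3 : A3 = 2*(A3 / 2) := by omega
        generalize A0 / 2 = B0 at *
        generalize A1 / 2 = B1 at *
        generalize A2 / 2 = B2 at *
        generalize A3 / 2 = B3 at *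
        subst q0 q1 q2 q3
        push_cast
        ring
      rw [this]
      exact dvd_sub hd (h2.mul_right _)
    · have hpf : π ∣ f := by
        have : f = (A0 + A1*f + A2*f^2 + A3*f^3) - 2*((A0 / 2 : ℤ) + (A1 / 2 : ℤ)*f + (A2 / 2 : ℤ)*f^2 + (A3 / 2 : ℤ)*f^3 + b) := by
          have q0 : A0 = 2*(A0 / 2) + 1 := by omega
          have q1 : A1 = 2*(A1 / 2) + 1 := by omega
          have q2 : A2 = 2*(A2 / 2) := by omega
          have q3 : A3 = 2*(A3 / 2) + 1 := by omega
          generalize A0 / 2 = B0 at *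
          generalize A1 / 2 = B1 at *
          generalize A2 / 2 = B2 at *
          generalize A3 / 2 = B3 at *
          subst q0 q1 q2 q3
          push_cast
          linear_combination h.hb
        rw [this]
        exact dvd_sub hd (h2.mul_right _)
      have : (1 : 𝓞 L) = f*(f^4 - f^3 - 7*f^2 + 21*f - 17) + 2*3 := by
        linear_combination -h.hf
      rw [this]
      exact dvd_add (hpf.mul_right _) (h2.mul_right _)

theorem FK.us {K : Type} [Field K] [NumberField K] {f c : 𝓞 K} (h : FK K f c) (A0 A1 A2 A3 : ℤ)
    (hA : (cub A0 A1 A2 A3).IsPrimitive) (B : ℤ[X]) (D : ℤ) (hD : D ≠ 0)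
    (hAB : cub A0 A1 A2 A3 ∣ B^2 - C D^2*(X^3 + 3*X^2 - X + 1)*(X^5 - X^4 - 7*X^3 + 21*X^2 - 17*X + 5))
    (hs : A0 % 2 = 1 ∧ A1 % 2 = 0 ∧ A2 % 2 = 0 ∧ A3 % 2 = 0) :
    ∃ (u : (𝓞 K)ˣ) (w : 𝓞 K), E3 f c (A0 - A2 + 2*A3) (A1 + A3) (2*A2 - 6*A3) = u*w^2 := by
  have e : aeval f (cub A0 A1 A2 A3) = E3 f c (A0 - A2 + 2*A3) (A1 + A3) (2*A2 - 6*A3) := by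
    rw [cub_aeval]; simp only [E3]; push_cast; linear_combination (-(A2 : 𝓞 K) + 3*A3)*h.hc + A3*h.hf
  have := h.pid
  rw [← e]
  refine selmer_us f (X^3 + 3*X^2 - X + 1) (X^5 - X^4 - 7*X^3 + 21*X^2 - 17*X + 5)
    (by monicity!) irrG (by simpa [map_ofNat] using h.hf) ?_ ?_ _ B D hD hA ?_ (by convert hAB using 2; ring) ?_
  · intro y
    obtain ⟨a0, a1, a2, rfl⟩ := h.all.1 y
    refine ⟨1, C (2*a0) + C (2*a1)*X + C a2*(1 + X^2), ?_⟩
    simp [E3, map_ofNat]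
    linear_combination (- (a2 : 𝓞 K))*h.hc
  · refine ⟨-1 + 2*f - f^2, ?_⟩
    simp [map_ofNat]
    linear_combination (9 - 18*f + 15*f^2 - 6*f^3 + f^4)*h.hf
  · have hi : Irreducible ((X^3 + 3*X^2 - X + 1 : ℤ[X]).map (Int.castRingHom ℚ)) := by
      simpa using irrGQ
    refine ((hi.coprime_iff_not_dvd).2 fun hd => ?_).symm
    rw [← IsPrimitive.Int.dvd_iff_map_cast_dvd_map_cast _ _ (Monic.isPrimitive (by monicity!))] at hd
    obtain ⟨k, hk⟩ := hd
    have h5 : (X^3 + 3*X^2 - X + 1 : ℤ[X]).natDegree = 3 := by compute_degree!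
    have h4 := cub_deg A0 A1 A2 A3
    have hk0 : k ≠ 0 := by rintro rfl; exact hA.ne_zero (by simpa using hk)
    have h6 := congrArg natDegree hk
    rw [Monic.natDegree_mul' (by monicity!) hk0, h5] at h6
    obtain ⟨k0, rfl⟩ : ∃ k0, k = C k0 := ⟨_, eq_C_of_natDegree_eq_zero (by omega)⟩
    have e0 := congrArg (fun p => coeff p 0) hk
    have e1 := congrArg (fun p => coeff p 1) hk
    simp [-eq_intCast, cub, coeff_X, coeff_one, coeff_C, coeff_X_pow, coeff_mul_C, coeff_ofNat_mul] at e0 e1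
    omega
  · intro π hπ h2 hd
    rw [cub_aeval] at hd
    apply hπ.not_isUnit
    rw [isUnit_iff_dvd_one]
    obtain ⟨r0, r1, r2, r3⟩ := hs
    have : (1 : 𝓞 K) = (A0 + A1*f + A2*f^2 + A3*f^3) - 2*((A0 / 2 : ℤ) + (A1 / 2 : ℤ)*f + (A2 / 2 : ℤ)*f^2 + (A3 / 2 : ℤ)*f^3) := by
      have q0 : A0 = 2*(A0 / 2) + 1 := by omega
      have q1 : A1 = 2*(A1 / 2) := by omega
      have q2 : A2 = 2*(A2 / 2) := by omega
      have q3 : A3 = 2*(A3 / 2) := by omega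
      generalize A0 / 2 = B0 at *
      generalize A1 / 2 = B1 at *
      generalize A2 / 2 = B2 at *
      generalize A3 / 2 = B3 at *
      subst q0 q1 q2 q3
      push_cast
      ring
    rw [this]
    exact dvd_sub hd (h2.mul_right _)

noncomputable def gz : ℚ[X] := X^3 - X^2 + 3*X + 1
noncomputable def hz : ℚ[X] := 5*X^5 - 17*X^4 + 21*X^3 - 7*X^2 - X + 1
noncomputable def cq (a0 a1 a2 a3 : ℤ) : ℚ[X] := C (a0 : ℚ) + C (a1 : ℚ)*X + C (a2 : ℚ)*X^2 + C (a3 : ℚ)*X^3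

def Pr4 (a0 a1 a2 a3 : ℤ) : Prop := ∀ d : ℤ, d ∣ a0 → d ∣ a1 → d ∣ a2 → d ∣ a3 → IsUnit d

theorem Pr4.prim {a0 a1 a2 a3 : ℤ} (h : Pr4 a0 a1 a2 a3) : (cub a0 a1 a2 a3).IsPrimitive := by
  intro r hr
  obtain ⟨e0, e1, e2, e3⟩ := cub_coeff a0 a1 a2 a3
  rw [C_dvd_iff_dvd_coeff] at hr
  exact h r (e0 ▸ hr 0) (e1 ▸ hr 1) (e2 ▸ hr 2) (e3 ▸ hr 3)

theorem cub_map (a0 a1 a2 a3 : ℤ) : (cub a0 a1 a2 a3).map (Int.castRingHom ℚ) = cq a0 a1 a2 a3 := by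
  simp [-eq_intCast, cub, cq]

theorem cq_deg (a0 a1 a2 a3 : ℤ) (h : a3 ≠ 0) : (cq a0 a1 a2 a3).natDegree = 3 := by
  have : (a3 : ℚ) ≠ 0 := by exact_mod_cast h
  unfold cq; compute_degree!

theorem cq_deg_le (a0 a1 a2 a3 : ℤ) : (cq a0 a1 a2 a3).natDegree ≤ 3 := by
  unfold cq; compute_degree

theorem rv {N i j : ℕ} (h : i + j = N) : revAt N i = j := by
  rw [revAt_le (by omega)]; omega

theorem refl_cq (a0 a1 a2 a3 : ℤ) : reflect 3 (cq a0 a1 a2 a3) = cq a3 a2 a1 a0 := by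
  have e : cq a0 a1 a2 a3 = C (a0 : ℚ)*X^0 + C (a1 : ℚ)*X^1 + C (a2 : ℚ)*X^2 + C (a3 : ℚ)*X^3 := by
    simp [cq]
  rw [e]
  simp only [reflect_add, reflect_C_mul_X_pow, rv (show 0 + 3 = 3 from rfl), rv (show 1 + 2 = 3 from rfl),
    rv (show 2 + 1 = 3 from rfl), rv (show 3 + 0 = 3 from rfl), cq]
  ring

theorem refl_gz : reflect 3 gz = X^3 + 3*X^2 - X + 1 := by
  have e : gz = cq 1 3 (-1) 1 := by simp [gz, cq, map_ofNat]; ring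
  rw [e, refl_cq]; simp [cq, map_ofNat]; ring

theorem refl_hz : reflect 5 hz = X^5 - X^4 - 7*X^3 + 21*X^2 - 17*X + 5 := by
  have e : hz = C 1*X^0 + C (-1)*X^1 + C (-7)*X^2 + C 21*X^3 + C (-17)*X^4 + C 5*X^5 := by
    simp [hz, map_ofNat]; ring
  rw [e]
  simp only [reflect_add, reflect_C_mul_X_pow, rv (show 0 + 5 = 5 from rfl), rv (show 1 + 4 = 5 from rfl),
    rv (show 2 + 3 = 5 from rfl), rv (show 3 + 2 = 5 from rfl), rv (show 4 + 1 = 5 from rfl), rv (show 5 + 0 = 5 from rfl)]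
  simp [map_ofNat]; ring

theorem gz_deg : gz.natDegree = 3 := by unfold gz; compute_degree!
theorem hz_deg : hz.natDegree = 5 := by unfold hz; compute_degree!

theorem zred (a0 a1 a2 n : ℤ) (hn : n ≠ 0) (hp : Pr4 n a2 a1 a0) (y : ℚ[X]) (hy : cq a0 a1 a2 n ∣ y^2 - gz*hz) :
    ∃ (B : ℤ[X]) (D : ℤ), D ≠ 0 ∧ cub n a2 a1 a0 ∣ B^2 - C D^2*(X^3 + 3*X^2 - X + 1)*(X^5 - X^4 - 7*X^3 + 21*X^2 - 17*X + 5) := by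
  set a := cq a0 a1 a2 n with ha
  have had : a.natDegree = 3 := cq_deg _ _ _ _ hn
  have ha0 : a ≠ 0 := fun h => by rw [h] at had; simp at had
  obtain ⟨b, hb, c, hc⟩ : ∃ b : ℚ[X], b.natDegree ≤ 4 ∧ a ∣ b^2 - gz*hz := by
    refine ⟨y % a, ?_, ?_⟩
    · have := natDegree_mod_lt y (q := a) (by omega)
      omega
    · have h1 : a ∣ y - y % a := ⟨y / a, by linear_combination -EuclideanDomain.div_add_mod y a⟩
      have : (y % a)^2 - gz*hz = (y^2 - gz*hz) - (y - y % a)*(y + y % a) := by ring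
      rw [this]
      exact dvd_sub hy (h1.mul_right _)
  have hcd : c.natDegree ≤ 5 := by
    by_cases h0 : c = 0
    · simp [h0]
    have h1 : (a*c).natDegree ≤ 8 := by
      rw [← hc]
      refine (natDegree_sub_le _ _).trans (max_le ?_ ?_)
      · exact natDegree_pow_le.trans (by omega)
      · exact natDegree_mul_le.trans (by rw [gz_deg, hz_deg])
    rw [natDegree_mul ha0 h0] at h1
    omega
  have hr := congrArg (reflect 8) hc
  rw [sub_eq_add_neg, reflect_add, reflect_neg, pow_two, show (8 : ℕ) = 4 + 4 from rfl, reflect_mul _ _ hb hb, show (4 + 4 : ℕ) = 3 + 5 from rfl,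
    reflect_mul _ _ gz_deg.le hz_deg.le, reflect_mul _ _ had.le hcd, refl_cq, refl_gz, refl_hz] at hr
  obtain ⟨⟨D, hD⟩, hB⟩ := IsLocalization.integerNormalization_map_to_map (nonZeroDivisors ℤ) (reflect 4 b)
  have hD0 : D ≠ 0 := nonZeroDivisors.ne_zero hD
  refine ⟨IsLocalization.integerNormalization (nonZeroDivisors ℤ) (reflect 4 b), D, hD0, ?_⟩
  generalize IsLocalization.integerNormalization (nonZeroDivisors ℤ) (reflect 4 b) = B at *
  rw [IsPrimitive.Int.dvd_iff_map_cast_dvd_map_cast _ _ hp.prim, cub_map]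
  have hB' : B.map (Int.castRingHom ℚ) = C (D : ℚ)*reflect 4 b := by
    have : (algebraMap ℤ ℚ) = Int.castRingHom ℚ := rfl
    rw [this] at hB
    rw [hB]
    ext i
    simp [Submonoid.smul_def]
  refine ⟨C (D : ℚ)^2*reflect 5 c, ?_⟩
  simp only [Polynomial.map_sub, Polynomial.map_pow, Polynomial.map_mul, hB', Polynomial.map_C, Polynomial.map_add, Polynomial.map_X, Polynomial.map_ofNat, Polynomial.map_one, Int.coe_castRingHom]
  linear_combination (C (D : ℚ))^2*hr

theorem irr_refl {p P : ℚ[X]} (N : ℕ) (hp : p.natDegree = N) (h0 : p.coeff 0 ≠ 0) (hr : reflect N p = P) (hi : Irreducible P) : Irreducible p := by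
  have hrev : p.reverse = P := by rw [reverse, hp, hr]
  refine ⟨fun hu => hi.not_isUnit ?_, fun a b hab => ?_⟩
  · obtain ⟨c, hc, rfl⟩ := isUnit_iff.1 hu
    rw [← hrev, reverse_C]; exact hu
  · have := congrArg reverse hab
    rw [reverse_mul_of_domain, hrev] at this
    have key : ∀ a : ℚ[X], a.coeff 0 ≠ 0 → IsUnit a.reverse → IsUnit a := by
      intro a ha hu
      have h1 := natDegree_eq_zero_of_isUnit hu
      rw [reverse_natDegree, natTrailingDegree_eq_zero_of_constantCoeff_ne_zero (by simpa using ha)] at h1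
      rw [eq_C_of_natDegree_eq_zero (p := a) (by simpa using h1)]
      exact isUnit_C.2 (isUnit_iff_ne_zero.2 ha)
    rw [hab, mul_coeff_zero] at h0
    exact (hi.isUnit_or_isUnit this).imp (key _ (left_ne_zero_of_mul h0)) (key _ (right_ne_zero_of_mul h0))

theorem irr_gz : Irreducible gz := irr_refl 3 gz_deg (by simp [gz]) refl_gz irrGQ
theorem irr_hz : Irreducible hz := irr_refl 5 hz_deg (by simp [hz]) refl_hz irrHQ

theorem ex_nf (p : ℚ[X]) (hp : Irreducible p) (h0 : p.coeff 0 ≠ 0) : ∃ (L : Type) (_ : Field L) (_ : NumberField L) (θ : L),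
    Module.finrank ℚ L = p.natDegree ∧ θ ≠ 0 ∧ aeval θ p = 0 ∧ ∀ (Q : ℚ[X]), (∃ w : L, aeval θ Q = w^2) → ∃ T : ℚ[X], p ∣ T^2 - Q := by
  haveI := Fact.mk hp
  have hp0 := hp.ne_zero
  let pb := AdjoinRoot.powerBasis hp0
  haveI : Module.Finite ℚ (AdjoinRoot p) := pb.finite
  haveI : CharZero (AdjoinRoot p) := charZero_of_injective_algebraMap (algebraMap ℚ (AdjoinRoot p)).injective
  haveI : NumberField (AdjoinRoot p) := ⟨⟩
  have key : ∀ Q : ℚ[X], aeval (AdjoinRoot.root p) Q = AdjoinRoot.mk p Q := by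
    intro Q
    rw [← AdjoinRoot.aeval_eq]
    simp only [aeval_def]
    congr 1
  refine ⟨AdjoinRoot p, inferInstance, inferInstance, AdjoinRoot.root p, ?_, ?_, ?_, ?_⟩
  · rw [pb.finrank]; rfl
  · intro h
    have := AdjoinRoot.aeval_eq p (f := p)
    rw [AdjoinRoot.mk_self, h] at this
    rw [← coeff_zero_eq_aeval_zero'] at this
    exact h0 ((map_eq_zero _).1 this)
  · rw [key, AdjoinRoot.mk_self]
  · rintro Q ⟨w, hw⟩
    obtain ⟨T, rfl⟩ := AdjoinRoot.mk_surjective w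
    rw [key, ← map_pow, eq_comm, AdjoinRoot.mk_eq_mk] at hw
    exact ⟨T, hw⟩

theorem coe_E5 {L : Type} [Field L] [NumberField L] {f b : 𝓞 L} (h : FL L f b) (A0 A1 A2 A3 : ℤ) :
    ((E5 f b (A0 - A3) A1 A2 (2*A3) 0 : 𝓞 L) : L) = A0 + A1*(f : L) + A2*(f : L)^2 + A3*(f : L)^3 := by
  have hb : 2*(b : L) = 1 + (f : L)^3 := by
    have := congrArg (fun x : 𝓞 L => (x : L)) h.hb
    simpa [map_ofNat] using this
  rw [E5_coe]; simp only [E5]; push_cast; linear_combination (A3 : L)*hb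

theorem coe_E3 {K : Type} [Field K] [NumberField K] {f c : 𝓞 K} (h : FK K f c) (A0 A1 A2 A3 : ℤ) :
    ((E3 f c (A0 - A2 + 2*A3) (A1 + A3) (2*A2 - 6*A3) : 𝓞 K) : K) = A0 + A1*(f : K) + A2*(f : K)^2 + A3*(f : K)^3 := by
  rw [E3_coe]; simp only [E3]; push_cast; linear_combination ((A2 : K) - 3*A3)*h.hcx - A3*h.hx

theorem exL : ∃ (L : Type) (_ : Field L) (_ : NumberField L) (θ : L) (f b : 𝓞 L),
    FL L f b ∧ (f : L) = θ⁻¹ ∧ θ ≠ 0 ∧ ∀ (Q : ℚ[X]), (∃ w : L, aeval θ Q = w^2) → ∃ T : ℚ[X], hz ∣ T^2 - Q := by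
  obtain ⟨L, i1, i2, θ, h1, h2, h3, h4⟩ := ex_nf hz irr_hz (by simp [hz])
  obtain ⟨f, b, hf, h⟩ := exFL θ⁻¹ (by
    simp [hz, map_ofNat] at h3
    field_simp
    linear_combination h3) (by rw [h1, hz_deg])
  exact ⟨L, i1, i2, θ, f, b, h, hf, h2, h4⟩

theorem exK : ∃ (L : Type) (_ : Field L) (_ : NumberField L) (θ : L) (f b : 𝓞 L),
    FK L f b ∧ (f : L) = θ⁻¹ ∧ θ ≠ 0 ∧ ∀ (Q : ℚ[X]), (∃ w : L, aeval θ Q = w^2) → ∃ T : ℚ[X], gz ∣ T^2 - Q := by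
  obtain ⟨L, i1, i2, θ, h1, h2, h3, h4⟩ := ex_nf gz irr_gz (by simp [gz])
  obtain ⟨f, b, hf, h⟩ := exFK θ⁻¹ (by
    simp [gz, map_ofNat] at h3
    field_simp
    linear_combination h3) (by rw [h1, gz_deg])
  exact ⟨L, i1, i2, θ, f, b, h, hf, h2, h4⟩

theorem selz2 (a0 a1 a2 n : ℤ) (hn : n % 2 = 1) (h2 : a2 % 2 = 1) (h1 : a1 % 2 = 0) (h0 : a0 % 2 = 1)
    (hp : Pr4 n a2 a1 a0) (y : ℚ[X]) (hy : cq a0 a1 a2 n ∣ y^2 - gz*hz) : False := by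
  obtain ⟨B, D, hD, hB⟩ := zred a0 a1 a2 n (by omega) hp y hy
  obtain ⟨L, i1, i2, θ, f, b, h, -⟩ := exL
  obtain ⟨u, w, hw⟩ := h.us _ _ _ _ hp.prim B D hD hB (Or.inr ⟨hn, h2, h1, h0⟩)
  exact h.sel2 _ _ _ _ hn h2 h1 h0 u w hw

theorem cop_gh : IsCoprime gz hz := by
  refine ⟨C (1 / 4)*(-7469 + 32742*X - 58455*X^2 + 40818*X^3 - 11045*X^4), C (1 / 4)*(7473 - 2862*X + 2209*X^2), ?_⟩
  have : (1 : ℚ[X]) = C (1 / 4)*4 := by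
    rw [show (4 : ℚ[X]) = C 4 from rfl, ← C_mul]; norm_num
  rw [this]
  simp only [gz, hz]
  ring

theorem selz1 (a0 a1 a2 n : ℤ) (hn : n % 4 = 1) (h2 : a2 % 2 = 0) (h1 : a1 % 2 = 0) (h0 : a0 % 2 = 0)
    (hp : Pr4 n a2 a1 a0) (y : ℚ[X]) (hy : cq a0 a1 a2 n ∣ y^2 - gz*hz) :
    ∃ σ : ℚ[X], gz*hz ∣ σ^2 - X^3*cq a0 a1 a2 n := by
  obtain ⟨B, D, hD, hB⟩ := zred a0 a1 a2 n (by omega) hp y hy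
  obtain ⟨L, i1, i2, θ, f, b, h, hf, hθ, hQ⟩ := exL
  obtain ⟨u, w, hw⟩ := h.us _ _ _ _ hp.prim B D hD hB (Or.inl ⟨by omega, h2, h1, h0⟩)
  obtain ⟨k1, k2⟩ := h.sel1 _ _ _ _ hn h2 h1 h0 u w hw
  obtain ⟨L', i1', i2', θ', f', b', h', hf', hθ', hQ'⟩ := exK
  obtain ⟨u', w', hw'⟩ := h'.us _ _ _ _ hp.prim B D hD hB ⟨by omega, h2, h1, h0⟩
  obtain ⟨k3, r', k4⟩ := h'.sel1 _ _ _ _ hn h2 k1 h0 u' w' hw'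
  obtain ⟨r, k2⟩ := k2 k3
  have e : ∃ T : ℚ[X], hz ∣ T^2 - X^3*cq a0 a1 a2 n := by
    apply hQ
    refine ⟨θ^3*(r : L), ?_⟩
    have := congrArg (fun x : 𝓞 L => (x : L)) k2
    simp only [coe_E5 h, map_mul, hf] at this
    simp [cq]
    rw [mul_pow, pow_two (r : L), ← this]
    field_simp
    ring
  have e' : ∃ T : ℚ[X], gz ∣ T^2 - X^3*cq a0 a1 a2 n := by
    apply hQ'
    refine ⟨θ'^3*(r' : L'), ?_⟩
    have := congrArg (fun x : 𝓞 L' => (x : L')) k4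
    simp only [coe_E3 h', map_mul, hf'] at this
    simp [cq]
    rw [mul_pow, pow_two (r' : L'), ← this]
    field_simp
    ring
  obtain ⟨T, p, hT⟩ := e
  obtain ⟨S, q, hS⟩ := e'
  obtain ⟨u, v, huv⟩ := cop_gh
  refine ⟨S*(v*hz) + T*(u*gz), cop_gh.mul_dvd ⟨q + (T - S)*u*(S*(v*hz) + T*(u*gz) + S), ?_⟩ ⟨p + (S - T)*v*(S*(v*hz) + T*(u*gz) + T), ?_⟩⟩
  · linear_combination hS + S*(S*(v*hz) + T*(u*gz) + S)*huv
  · linear_combination hT + T*(S*(v*hz) + T*(u*gz) + T)*huv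

theorem lag {V : Type} [AddCommGroup V] [Module ℚ V] [Module.Finite ℚ V] (hV : Module.finrank ℚ V = 8)
    (B : V →ₗ[ℚ] V →ₗ[ℚ] ℚ) (hs : ∀ x y, B x y = B y x) (hnd : ∀ y, (∀ x, B x y = 0) → y = 0)
    (e : V →ₗ[ℚ] V) (he : ∀ x, e (e x) = x) (hB : ∀ x y, B x (e y) = B (e x) y) (hd : LinearMap.det e ≠ 1)
    (U W : Fin 4 → V) (hU : ∀ i j, B (U i) (U j) = 0) (hW : ∀ i j, B (W i) (W j) = 0)
    (h1 : LinearIndependent ℚ (Sum.elim U W)) (h2 : LinearIndependent ℚ (Sum.elim U (fun i => e (W i)))) : False := by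
  have h2' : LinearIndependent ℚ (Sum.elim (fun i => e (W i)) U) := by
    have := h2.comp Sum.swap Sum.swap_leftInverse.injective
    convert this using 1
    ext (i | i) <;> rfl
  have hc : Fintype.card (Fin 4 ⊕ Fin 4) = Module.finrank ℚ V := by rw [hV]; rfl
  let M := basisOfLinearIndependentOfCardEqFinrank h1 hc
  let M' := basisOfLinearIndependentOfCardEqFinrank h2' hc
  have hM : ∀ i, M i = Sum.elim U W i := fun i => by simp [M]
  have hM' : ∀ i, M' i = Sum.elim (fun i => e (W i)) U i := fun i => by simp [M']
  let G : Matrix (Fin 4 ⊕ Fin 4) (Fin 4 ⊕ Fin 4) ℚ := Matrix.of fun i j => B (M i) (M' j)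
  have hG0 : G.det ≠ 0 := by
    intro h0
    obtain ⟨v, hv, hGv⟩ := Matrix.exists_mulVec_eq_zero_iff.2 h0
    apply hv
    have : ∑ j, v j • M' j = 0 := by
      apply hnd
      intro x
      rw [hs]
      have : B (∑ j, v j • M' j) = 0 := by
        refine M.ext fun i => ?_
        have := congrFun hGv i
        rw [hs]
        simpa [G, Matrix.mulVec, dotProduct, mul_comm] using this
      rw [this]; rfl
    have := (Fintype.linearIndependent_iff.1 M'.linearIndependent) v this
    ext i; exact this i
  have hGe : (Matrix.of fun i j => B (M i) (e (M' j)) : Matrix (Fin 4 ⊕ Fin 4) (Fin 4 ⊕ Fin 4) ℚ) = G*LinearMap.toMatrix M' M' e := by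
    ext i j
    simp only [Matrix.of_apply, Matrix.mul_apply, G]
    conv_lhs => rw [← M'.sum_repr (e (M' j))]
    rw [map_sum]
    refine Finset.sum_congr rfl fun k _ => ?_
    rw [map_smul, smul_eq_mul, LinearMap.toMatrix_apply, mul_comm]
  have hdet := congrArg Matrix.det hGe
  rw [Matrix.det_mul, LinearMap.det_toMatrix] at hdet
  let X1 : Matrix (Fin 4) (Fin 4) ℚ := Matrix.of fun i j => B (U i) (e (W j))
  let X2 : Matrix (Fin 4) (Fin 4) ℚ := Matrix.of fun i j => B (W i) (U j)
  have g1 : G = Matrix.fromBlocks X1 0 (Matrix.of fun i j => B (W i) (e (W j))) X2 := by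
    ext (i | i) (j | j) <;> simp [G, hM, hM', X1, X2, hU]
  have g2 : (Matrix.of fun i j => B (M i) (e (M' j)) : Matrix (Fin 4 ⊕ Fin 4) (Fin 4 ⊕ Fin 4) ℚ) =
      Matrix.fromBlocks X2.transpose (Matrix.of fun i j => B (U i) (e (U j))) 0 X1.transpose := by
    ext (i | i) (j | j) <;> simp [hM, hM', X1, X2, hW, he]
    · exact hs _ _
    · rw [hB, hs]
  rw [g2, Matrix.det_fromBlocks_zero₂₁, Matrix.det_transpose, Matrix.det_transpose] at hdet
  rw [g1, Matrix.det_fromBlocks_zero₁₂] at hdet hG0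
  apply hd
  have : (X1.det*X2.det)*(LinearMap.det e - 1) = 0 := by linear_combination -hdet
  rcases mul_eq_zero.1 this with h | h
  · exact absurd h hG0
  · linarith

noncomputable def sz : ℚ[X] := 1 + X - 6*X^2 + 7*X^3 + X^4
noncomputable def tz : ℚ[X] := 2 + 4*X - 9*X^2 + X^3
noncomputable def f0 : ℚ[X] := C (1 / 5)*(gz*hz)

theorem fz_eq : gz*hz = sz^2 + 4*X^5*tz := by simp only [gz, hz, sz, tz]; ring

theorem f0_dvd (p : ℚ[X]) : f0 ∣ p ↔ gz*hz ∣ p := by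
  unfold f0
  exact (isUnit_C.2 (by norm_num)).mul_left_dvd

theorem gh_deg : (gz*hz).natDegree = 8 := by
  rw [natDegree_mul irr_gz.ne_zero irr_hz.ne_zero, gz_deg, hz_deg]

theorem f0_monic : f0.Monic := by
  have : (gz*hz).leadingCoeff = 5 := by
    rw [leadingCoeff_mul, leadingCoeff, leadingCoeff, gz_deg, hz_deg]
    simp [gz, hz, coeff_X, coeff_one, coeff_ofNat_mul, coeff_X_pow]
  rw [f0, Monic, leadingCoeff_mul, this]; simp

theorem f0_deg : f0.natDegree = 8 := by
  rw [f0, natDegree_C_mul (by norm_num), gh_deg]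

noncomputable def pl {k : ℕ} (c : Fin k → ℚ) : ℚ[X] := ∑ i, C (c i)*X^(i : ℕ)

theorem pl_deg {k : ℕ} (c : Fin k → ℚ) : (pl c).degree < k := degree_sum_fin_lt c

theorem pl_coeff {k : ℕ} (c : Fin k → ℚ) (i : Fin k) : (pl c).coeff i = c i := by
  simp [pl, finset_sum_coeff, coeff_X_pow, Fin.val_inj]

theorem pl_mk {k : ℕ} (c : Fin k → ℚ) (p : ℚ[X]) : ∑ i, c i • AdjoinRoot.mk f0 (p*X^(i : ℕ)) = AdjoinRoot.mk f0 (p*pl c) := by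
  simp only [AdjoinRoot.smul_mk, ← map_sum, pl, Finset.mul_sum, smul_eq_C_mul]
  congr 1
  refine Finset.sum_congr rfl fun i _ => ?_
  ring

theorem pl_zero {k : ℕ} (c : Fin k → ℚ) (h : pl c = 0) : ∀ i, c i = 0 := fun i => by rw [← pl_coeff c i, h]; simp

noncomputable def psi : AdjoinRoot f0 →ₗ[ℚ] ℚ := (lcoeff ℚ 7).comp (AdjoinRoot.modByMonicHom f0_monic)

theorem psi_mk (p : ℚ[X]) (hp : p.natDegree ≤ 7) : psi (AdjoinRoot.mk f0 p) = p.coeff 7 := by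
  simp only [psi, LinearMap.comp_apply, AdjoinRoot.modByMonicHom_mk, lcoeff_apply]
  rw [(modByMonic_eq_self_iff f0_monic).2]
  rw [degree_eq_natDegree f0_monic.ne_zero, f0_deg]
  exact degree_le_natDegree.trans_lt (by exact_mod_cast (by omega))

theorem psi_low (p : ℚ[X]) (hp : p.natDegree ≤ 6) : psi (AdjoinRoot.mk f0 p) = 0 := by
  rw [psi_mk _ (by omega)]; exact coeff_eq_zero_of_natDegree_lt (by omega)

theorem psi_nd (y : AdjoinRoot f0) (h : ∀ x, psi (x*y) = 0) : y = 0 := by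
  obtain ⟨p, hp, rfl⟩ : ∃ p : ℚ[X], p.natDegree ≤ 7 ∧ AdjoinRoot.mk f0 p = y := by
    obtain ⟨p, rfl⟩ := AdjoinRoot.mk_surjective y
    refine ⟨p %ₘ f0, ?_, ?_⟩
    · have := natDegree_modByMonic_lt p f0_monic (by intro h; have := f0_deg; rw [h] at this; simp at this)
      rw [f0_deg] at this; omega
    · rw [AdjoinRoot.mk_eq_mk, modByMonic_eq_sub_mul_div p]
      exact ⟨-(p /ₘ f0), by ring⟩
  by_contra h0
  have hp0 : p ≠ 0 := by rintro rfl; simp at h0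
  have := h (AdjoinRoot.mk f0 (X^(7 - p.natDegree)))
  rw [← map_mul, psi_mk, mul_comm] at this
  · rw [coeff_mul_X_pow', if_pos (by omega), show 7 - (7 - p.natDegree) = p.natDegree by omega] at this
    exact hp0 (leadingCoeff_eq_zero.1 this)
  · refine natDegree_mul_le.trans ?_
    rw [natDegree_X_pow]; omega

noncomputable instance : Module.Finite ℚ (AdjoinRoot f0) := (AdjoinRoot.powerBasis' f0_monic).finite

theorem fr8 : finrank ℚ (AdjoinRoot f0) = 8 := by
  rw [(AdjoinRoot.powerBasis' f0_monic).finrank]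
  exact f0_deg

theorem dvd_low (p : ℚ[X]) (h : gz*hz ∣ p) (hp : p.natDegree ≤ 7) : p = 0 := by
  by_contra h0
  have := natDegree_le_of_dvd h h0
  rw [gh_deg] at this; omega

theorem det_e (E : ℚ[X]) (h1 : gz ∣ E - 1) (h2 : hz ∣ E + 1) : LinearMap.det (LinearMap.mulLeft ℚ (AdjoinRoot.mk f0 E)) ≠ 1 := by
  let v : Fin 5 ⊕ Fin 3 → AdjoinRoot f0 := Sum.elim (fun i => AdjoinRoot.mk f0 (gz*X^(i : ℕ))) (fun i => AdjoinRoot.mk f0 (hz*X^(i : ℕ)))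
  have hv : LinearIndependent ℚ v := by
    rw [Fintype.linearIndependent_iff]
    intro c hc
    rw [Fintype.sum_sum_type] at hc
    simp only [v, Sum.elim_inl, Sum.elim_inr] at hc
    rw [pl_mk (fun i => c (Sum.inl i)), pl_mk (fun i => c (Sum.inr i)), ← map_add, AdjoinRoot.mk_eq_zero, f0_dvd] at hc
    have d1 := pl_deg (fun i => c (Sum.inl i))
    have d2 := pl_deg (fun i => c (Sum.inr i))
    have z1 := pl_zero (fun i => c (Sum.inl i))
    have z2 := pl_zero (fun i => c (Sum.inr i))
    set P := pl (fun i => c (Sum.inl i))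
    set Q := pl (fun i => c (Sum.inr i))
    have hP : P = 0 := by
      by_contra h0
      have : hz ∣ P := by
        refine cop_gh.symm.dvd_of_dvd_mul_left (y := gz) ?_
        have h3 := (dvd_mul_left hz gz).trans hc
        exact (dvd_add_left (dvd_mul_right hz Q)).1 h3
      have h4 := degree_le_of_dvd this h0
      rw [degree_eq_natDegree irr_hz.ne_zero, hz_deg] at h4
      exact absurd (h4.trans_lt d1) (lt_irrefl _)
    have hQ : Q = 0 := by
      by_contra h0
      have : gz ∣ Q := by
        refine cop_gh.dvd_of_dvd_mul_left (y := hz) ?_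
        have h3 := (dvd_mul_right gz hz).trans hc
        exact (dvd_add_right (dvd_mul_right gz P)).1 h3
      have h4 := degree_le_of_dvd this h0
      rw [degree_eq_natDegree irr_gz.ne_zero, gz_deg] at h4
      exact absurd (h4.trans_lt d2) (lt_irrefl _)
    rintro (i | i)
    · exact z1 hP i
    · exact z2 hQ i
  let b := basisOfLinearIndependentOfCardEqFinrank hv (by rw [fr8]; rfl)
  have hb : ∀ i, b i = v i := fun i => by simp [b]
  rw [← LinearMap.det_toMatrix b]
  have : LinearMap.toMatrix b b (LinearMap.mulLeft ℚ (AdjoinRoot.mk f0 E)) = Matrix.diagonal (Sum.elim (fun _ => -1) (fun _ => 1)) := by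
    have key : ∀ i, AdjoinRoot.mk f0 E*b i = (Sum.elim (fun _ => -1) (fun _ => 1) i : ℚ) • b i := by
      rintro (i | i)
      · simp only [hb, v, Sum.elim_inl, neg_smul, one_smul]
        rw [← map_mul, ← map_neg, AdjoinRoot.mk_eq_mk, f0_dvd]
        obtain ⟨k, hk⟩ := h2
        exact ⟨k*X^(i : ℕ), by linear_combination gz*X^(i : ℕ)*hk⟩
      · simp only [hb, v, Sum.elim_inr, one_smul]
        rw [← map_mul, AdjoinRoot.mk_eq_mk, f0_dvd]
        obtain ⟨k, hk⟩ := h1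
        exact ⟨k*X^(i : ℕ), by linear_combination hz*X^(i : ℕ)*hk⟩
    ext i j
    rw [LinearMap.toMatrix_apply, LinearMap.mulLeft_apply, key, map_smul, Finsupp.smul_apply, Basis.repr_self, Matrix.diagonal_apply,
      Finsupp.single_apply]
    by_cases h : i = j
    · subst h; simp
    · simp [h, Ne.symm h]
  rw [this, Matrix.det_diagonal]
  simp
  norm_num

structure OKp (a v l m : ℚ[X]) : Prop where
  dl : l.natDegree ≤ 2
  dm : m.natDegree ≤ 3
  dv : a ∣ m - l*X^2*v

noncomputable def pm (l m : ℚ[X]) : ℚ[X] := C (1 / 2)*l*sz + X^3*m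

theorem c2 : (C (1 / 2) : ℚ[X])*2 = 1 := by
  rw [show (2 : ℚ[X]) = C 2 from rfl, ← C_mul]; norm_num

theorem sz_deg : sz.natDegree ≤ 4 := by unfold sz; compute_degree
theorem tz_deg : tz.natDegree ≤ 3 := by unfold tz; compute_degree

theorem pm_mul {a v l m l' m' : ℚ[X]} (ha : a.natDegree = 3) (hv : a ∣ X^5*v^2 + sz*v - tz) (h : OKp a v l m) (h' : OKp a v l' m') :
    ∃ r : ℚ[X], r.natDegree ≤ 6 ∧ pm l m*pm l' m' = C (1 / 4)*l*l'*(gz*hz) + X^3*(a*r) ∧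
      C (1 / 2)*sz*(l*m' + l'*m) + X^3*m*m' - X^2*tz*l*l' = a*r := by
  have ha0 : a ≠ 0 := by rintro rfl; simp at ha
  have : a ∣ C (1 / 2)*sz*(l*m' + l'*m) + X^3*m*m' - X^2*tz*l*l' := by
    obtain ⟨k, hk⟩ := h.dv
    obtain ⟨k', hk'⟩ := h'.dv
    obtain ⟨w, hw⟩ := hv
    refine ⟨l*l'*X^2*w + C (1 / 2)*sz*(l*k' + l'*k) + X^3*(k*m' + l*X^2*v*k'), ?_⟩
    linear_combination l*l'*X^2*hw + C (1 / 2)*sz*(l*hk' + l'*hk) + X^3*(m'*hk + l*X^2*v*hk') + l*l'*X^2*sz*v*c2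
  obtain ⟨r, hr⟩ := this
  refine ⟨r, ?_, ?_, hr⟩
  · by_cases h0 : r = 0
    · simp [h0]
    have hd : (a*r).natDegree ≤ 9 := by
      rw [← hr]
      have d1 := h.dl
      have d2 := h.dm
      have d3 := h'.dl
      have d4 := h'.dm
      have d5 := sz_deg
      have d6 := tz_deg
      refine (natDegree_sub_le _ _).trans (max_le ((natDegree_add_le _ _).trans (max_le ?_ ?_)) ?_)
      · refine natDegree_mul_le.trans ?_
        have e1 : (C (1 / 2)*sz).natDegree ≤ 4 := (natDegree_C_mul_le _ _).trans d5
        have e2 : (l*m' + l'*m).natDegree ≤ 5 := (natDegree_add_le _ _).trans (max_le (natDegree_mul_le.trans (by omega)) (natDegree_mul_le.trans (by omega)))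
        omega
      · refine natDegree_mul_le.trans ?_
        have e1 : (X^3*m).natDegree ≤ 6 := natDegree_mul_le.trans (by rw [natDegree_X_pow]; omega)
        omega
      · refine natDegree_mul_le.trans ?_
        have e1 : (X^2*tz).natDegree ≤ 5 := natDegree_mul_le.trans (by rw [natDegree_X_pow]; omega)
        have e2 : (X^2*tz*l).natDegree ≤ 7 := natDegree_mul_le.trans (by omega)
        omega
    rw [natDegree_mul ha0 h0] at hd
    omega
  · rw [← hr, fz_eq]
    have c4 : (C (1 / 4) : ℚ[X]) = C (1 / 2)*C (1 / 2) := by rw [← C_mul]; norm_num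
    simp only [pm]
    rw [c4]
    linear_combination (-X^5*tz*l*l')*(2*C (1 / 2) + 1)*c2

theorem lin (a v σ : ℚ[X]) (ha : a.natDegree = 3) (hcop : IsCoprime a (gz*hz)) (hv : a ∣ X^5*v^2 + sz*v - tz)
    (hσ : gz*hz ∣ σ^2 - X^3*a) :
    ∃ l m q : ℚ[X], OKp a v l m ∧ q.natDegree ≤ 3 ∧ (l ≠ 0 ∨ m ≠ 0) ∧ X^3*m^2 + sz*l*m - X^2*tz*l^2 = a*q^2 := by
  have ha0 : a ≠ 0 := by rintro rfl; simp at ha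
  have hX : IsCoprime (X : ℚ[X]) (gz*hz) := by
    refine ⟨-(gz*hz - 1).divX, 1, ?_⟩
    have := X_mul_divX_add (gz*hz - 1)
    have e : (gz*hz - 1).coeff 0 = 0 := by simp [mul_coeff_zero, gz, hz]
    rw [e] at this
    simp at this
    linear_combination -this
  have hX3 : IsCoprime (X^3*a) (gz*hz) := hX.pow_left.mul_left hcop
  obtain ⟨k1, k2, hk⟩ := hX3
  let δ := AdjoinRoot.mk f0 k1
  have hδ : δ*AdjoinRoot.mk f0 (X^3*a) = 1 := by
    simp only [δ]
    rw [← map_mul, ← map_one (AdjoinRoot.mk f0), AdjoinRoot.mk_eq_mk, f0_dvd]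
    exact ⟨-k2, by linear_combination hk⟩
  let L : Fin 4 → ℚ[X] := ![1, X, X^2, 0]
  let Mm : Fin 4 → ℚ[X] := ![(1*X^2*v) % a, (X*X^2*v) % a, (X^2*X^2*v) % a, a]
  have hmod : ∀ p : ℚ[X], (p % a).natDegree ≤ 3 ∧ a ∣ p % a - p := fun p =>
    ⟨by have := natDegree_mod_lt p (q := a) (by omega); omega, ⟨- (p / a), by linear_combination EuclideanDomain.div_add_mod p a⟩⟩
  have hOK : ∀ i, OKp a v (L i) (Mm i) := by
    intro i
    fin_cases i
    · exact ⟨by simp [L], (hmod _).1, (hmod _).2⟩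
    · exact ⟨by simp [L], (hmod _).1, (hmod _).2⟩
    · exact ⟨by simp [L], (hmod _).1, (hmod _).2⟩
    · exact ⟨by simp [L], by simp [Mm, ha], by simp [L, Mm]⟩
  let U : Fin 4 → AdjoinRoot f0 := fun i => AdjoinRoot.mk f0 (pm (L i) (Mm i))
  -- non independent case
  have main : ∀ τ : ℚ[X], gz*hz ∣ τ^2 - X^3*a →
    ¬ LinearIndependent ℚ (Sum.elim U (fun j : Fin 4 => AdjoinRoot.mk f0 (τ*X^(j : ℕ)))) →
    ∃ l m q : ℚ[X], OKp a v l m ∧ q.natDegree ≤ 3 ∧ (l ≠ 0 ∨ m ≠ 0) ∧ X^3*m^2 + sz*l*m - X^2*tz*l^2 = a*q^2 := by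
    intro τ hτ hli
    rw [Fintype.not_linearIndependent_iff] at hli
    obtain ⟨c, hc, hc0⟩ := hli
    rw [Fintype.sum_sum_type] at hc
    simp only [Sum.elim_inl, Sum.elim_inr] at hc
    rw [pl_mk (fun i => c (Sum.inr i))] at hc
    have d2 := pl_deg (fun i => c (Sum.inr i))
    have z2 := pl_zero (fun i => c (Sum.inr i))
    set Q := pl (fun i => c (Sum.inr i))
    have dQ : Q.natDegree ≤ 3 := by
      by_cases h0 : Q = 0
      · simp [h0]
      have := (natDegree_lt_iff_degree_lt h0).2 d2
      omega
    set l := ∑ i, C (c (Sum.inl i))*L i with hl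
    set m := ∑ i, C (c (Sum.inl i))*Mm i with hm
    have hU : ∑ i, c (Sum.inl i) • U i = AdjoinRoot.mk f0 (pm l m) := by
      simp only [U, AdjoinRoot.smul_mk, ← map_sum, smul_eq_C_mul, hl, hm, pm]
      congr 1
      simp only [Fin.sum_univ_four]
      ring
    rw [hU, ← map_add, AdjoinRoot.mk_eq_zero, f0_dvd] at hc
    have hOKs : OKp a v l m := by
      refine ⟨?_, ?_, ?_⟩
      · exact natDegree_sum_le_of_forall_le _ _ fun i _ => (natDegree_C_mul_le _ _).trans (hOK i).dl
      · exact natDegree_sum_le_of_forall_le _ _ fun i _ => (natDegree_C_mul_le _ _).trans (hOK i).dm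
      · have : m - l*X^2*v = ∑ i, C (c (Sum.inl i))*(Mm i - L i*X^2*v) := by
          simp only [hl, hm, Fin.sum_univ_four]; ring
        rw [this]
        exact Finset.dvd_sum fun i _ => (hOK i).dv.mul_left _
    obtain ⟨r, hr6, hr1, hr2⟩ := pm_mul ha hv hOKs hOKs
    have hrQ : r = Q^2 := by
      have h1 : gz*hz ∣ X^3*a*(r - Q^2) := by
        obtain ⟨w, hw⟩ := hc
        obtain ⟨w', hw'⟩ := hτ
        refine ⟨w*(pm l m - τ*Q) + w'*Q^2 - C (1 / 4)*l*l, ?_⟩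
        linear_combination (pm l m - τ*Q)*hw + Q^2*hw' - hr1
      have h2 : gz*hz ∣ r - Q^2 := (hX.pow_left.mul_left hcop).symm.dvd_of_dvd_mul_left h1
      have := dvd_low _ h2 ((natDegree_sub_le _ _).trans (max_le (by omega) (natDegree_pow_le.trans (by omega))))
      linear_combination this
    refine ⟨l, m, Q, hOKs, dQ, ?_, ?_⟩
    · by_contra hcon
      push Not at hcon
      obtain ⟨l0, m0⟩ := hcon
      have hQ0 : Q = 0 := by
        rw [l0, m0] at hr2
        have : a*r = 0 := by rw [← hr2]; ring
        rw [hrQ] at this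
        simpa [ha0] using this
      have hl' : C (c (Sum.inl 0)) + C (c (Sum.inl 1))*X + C (c (Sum.inl 2))*X^2 = 0 := by
        rw [← l0, hl, Fin.sum_univ_four]; simp [L]
      have k0 := congrArg (fun p => coeff p 0) hl'
      have k1 := congrArg (fun p => coeff p 1) hl'
      have k2 := congrArg (fun p => coeff p 2) hl'
      simp [coeff_X, coeff_C, coeff_X_pow] at k0 k1 k2
      have hm' : C (c (Sum.inl 3))*a = 0 := by
        rw [← m0, hm, Fin.sum_univ_four, k0, k1, k2]; simp [Mm]
      have k3 : c (Sum.inl 3) = 0 := by simpa [ha0] using hm'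
      obtain ⟨i | i, hi⟩ := hc0
      · fin_cases i
        · exact hi k0
        · exact hi k1
        · exact hi k2
        · exact hi k3
      · exact hi (z2 hQ0 i)
    · rw [← hrQ, ← hr2]
      linear_combination (-sz*l*m)*c2
  by_contra hno
  have hli : ∀ τ : ℚ[X], gz*hz ∣ τ^2 - X^3*a → LinearIndependent ℚ (Sum.elim U (fun j : Fin 4 => AdjoinRoot.mk f0 (τ*X^(j : ℕ)))) := by
    intro τ hτ
    by_contra h
    exact hno (main τ hτ h)
  obtain ⟨u, w, huw⟩ := cop_gh
  let E := w*hz - u*gz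
  have hE2 : gz*hz ∣ E^2 - 1 := ⟨-4*u*w, by simp only [E]; linear_combination (1 + (u*gz + w*hz))*huw⟩
  have hEE : AdjoinRoot.mk f0 E*AdjoinRoot.mk f0 E = 1 := by
    rw [← map_mul, ← map_one (AdjoinRoot.mk f0), AdjoinRoot.mk_eq_mk, f0_dvd, ← pow_two]; exact hE2
  let B : AdjoinRoot f0 →ₗ[ℚ] AdjoinRoot f0 →ₗ[ℚ] ℚ := (LinearMap.mul ℚ (AdjoinRoot f0)).compr₂ (psi ∘ₗ LinearMap.mulLeft ℚ δ)
  have hB : ∀ x y, B x y = psi (δ*(x*y)) := fun x y => rfl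
  refine lag fr8 B (fun x y => by rw [hB, hB, mul_comm x y]) ?_ (LinearMap.mulLeft ℚ (AdjoinRoot.mk f0 E)) ?_ ?_ (det_e E ?_ ?_)
    U (fun j : Fin 4 => AdjoinRoot.mk f0 (σ*X^(j : ℕ))) ?_ ?_ (hli σ hσ) ?_
  · intro y hy
    apply psi_nd
    intro x
    have := hy (AdjoinRoot.mk f0 (X^3*a)*x)
    rw [hB, show δ*(AdjoinRoot.mk f0 (X^3*a)*x*y) = (δ*AdjoinRoot.mk f0 (X^3*a))*(x*y) by ring, hδ, one_mul] at this
    exact this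
  · intro x
    simp only [LinearMap.mulLeft_apply]
    rw [← mul_assoc, hEE, one_mul]
  · intro x y
    simp only [LinearMap.mulLeft_apply, hB]
    congr 1; ring
  · exact ⟨-2*u, by simp only [E]; linear_combination huw⟩
  · exact ⟨2*w, by simp only [E]; linear_combination -huw⟩
  · intro i j
    obtain ⟨r, hr6, hr1, -⟩ := pm_mul ha hv (hOK i) (hOK j)
    have : U i*U j = AdjoinRoot.mk f0 (X^3*a)*AdjoinRoot.mk f0 r := by
      simp only [U]
      rw [← map_mul, ← map_mul, AdjoinRoot.mk_eq_mk, f0_dvd, hr1]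
      exact ⟨C (1 / 4)*L i*L j, by ring⟩
    rw [hB, this, ← mul_assoc, hδ, one_mul, psi_low _ hr6]
  · intro i j
    have : AdjoinRoot.mk f0 (σ*X^(i : ℕ))*AdjoinRoot.mk f0 (σ*X^(j : ℕ)) = AdjoinRoot.mk f0 (X^3*a)*AdjoinRoot.mk f0 (X^(i + j : ℕ)) := by
      rw [← map_mul, ← map_mul, AdjoinRoot.mk_eq_mk, f0_dvd]
      obtain ⟨w', hw'⟩ := hσ
      exact ⟨w'*X^(i + j : ℕ), by rw [pow_add]; linear_combination X^(i : ℕ)*X^(j : ℕ)*hw'⟩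
    rw [hB, this, ← mul_assoc, hδ, one_mul, psi_low]
    rw [natDegree_X_pow]; omega
  · have := hli (E*σ) (by
      obtain ⟨w', hw'⟩ := hσ
      obtain ⟨w2, hw2⟩ := hE2
      exact ⟨E^2*w' + w2*(X^3*a), by linear_combination E^2*hw' + (X^3*a)*hw2⟩)
    have e : (fun j : Fin 4 => LinearMap.mulLeft ℚ (AdjoinRoot.mk f0 E) (AdjoinRoot.mk f0 (σ*X^(j : ℕ)))) = fun j : Fin 4 => AdjoinRoot.mk f0 (E*σ*X^(j : ℕ)) := by
      funext j
      rw [LinearMap.mulLeft_apply, ← map_mul, mul_assoc]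
    rw [← e] at this
    exact this

def Bd (C : ℚ) (w : PowerSeries ℚ) : Prop := ∀ k, padicNorm 2 (PowerSeries.coeff k w) ≤ C
def Bdd (w : PowerSeries ℚ) : Prop := ∃ C, Bd C w

theorem Bd.nonneg {C : ℚ} {w : PowerSeries ℚ} (h : Bd C w) : 0 ≤ C := (padicNorm.nonneg _).trans (h 0)
theorem Bd.mono {C D : ℚ} {w : PowerSeries ℚ} (h : Bd C w) (hCD : C ≤ D) : Bd D w := fun k => (h k).trans hCD

theorem Bd.add {C : ℚ} {w w' : PowerSeries ℚ} (h : Bd C w) (h' : Bd C w') : Bd C (w + w') := fun k => by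
  rw [map_add]; exact (padicNorm.nonarchimedean).trans (max_le (h k) (h' k))

theorem Bd.neg {C : ℚ} {w : PowerSeries ℚ} (h : Bd C w) : Bd C (-w) := fun k => by
  rw [map_neg, padicNorm.neg]; exact h k

theorem Bd.sub {C : ℚ} {w w' : PowerSeries ℚ} (h : Bd C w) (h' : Bd C w') : Bd C (w - w') := by
  rw [sub_eq_add_neg]; exact h.add h'.neg

theorem Bd.mul {C D : ℚ} {w w' : PowerSeries ℚ} (h : Bd C w) (h' : Bd D w') : Bd (C*D) (w*w') := fun k => by
  rw [PowerSeries.coeff_mul]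
  refine padicNorm.sum_le' (fun i _ => ?_) (mul_nonneg h.nonneg h'.nonneg)
  rw [padicNorm.mul]
  exact mul_le_mul (h _) (h' _) (padicNorm.nonneg _) h.nonneg

theorem Bd.mul1 {w w' : PowerSeries ℚ} (h : Bd 1 w) (h' : Bd 1 w') : Bd 1 (w*w') := by simpa using h.mul h'

theorem Bdd.add {w w' : PowerSeries ℚ} (h : Bdd w) (h' : Bdd w') : Bdd (w + w') := by
  obtain ⟨C, h⟩ := h
  obtain ⟨D, h'⟩ := h'
  exact ⟨max C D, (h.mono (le_max_left _ _)).add (h'.mono (le_max_right _ _))⟩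
theorem Bdd.neg {w : PowerSeries ℚ} (h : Bdd w) : Bdd (-w) := by
  obtain ⟨C, h⟩ := h
  exact ⟨C, h.neg⟩
theorem Bdd.sub {w w' : PowerSeries ℚ} (h : Bdd w) (h' : Bdd w') : Bdd (w - w') := by
  rw [sub_eq_add_neg]; exact h.add h'.neg
theorem Bdd.mul {w w' : PowerSeries ℚ} (h : Bdd w) (h' : Bdd w') : Bdd (w*w') := by
  obtain ⟨C, h⟩ := h
  obtain ⟨D, h'⟩ := h'
  exact ⟨C*D, h.mul h'⟩

theorem Bdd.poly (p : ℚ[X]) : Bdd (p : PowerSeries ℚ) := by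
  refine ⟨∑ i ∈ p.support, padicNorm 2 (p.coeff i), fun k => ?_⟩
  rw [Polynomial.coeff_coe]
  by_cases hk : k ∈ p.support
  · exact Finset.single_le_sum (f := fun i => padicNorm 2 (p.coeff i)) (fun i _ => padicNorm.nonneg _) hk
  · rw [notMem_support_iff.1 hk, padicNorm.zero]
    exact Finset.sum_nonneg fun i _ => padicNorm.nonneg _

theorem Bd.int (w : PowerSeries ℤ) : Bd 1 (w.map (Int.castRingHom ℚ)) := fun k => by
  rw [PowerSeries.coeff_map]; exact padicNorm.of_int _

theorem Bd.intpoly (p : ℤ[X]) : Bd 1 ((p.map (Int.castRingHom ℚ) : ℚ[X]) : PowerSeries ℚ) := fun k => by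
  rw [Polynomial.coeff_coe, Polynomial.coeff_map]; exact padicNorm.of_int _

theorem Bd.inv {w : PowerSeries ℚ} (h : Bd 1 w) (h0 : padicNorm 2 (PowerSeries.coeff 0 w) = 1) : Bd 1 w⁻¹ := by
  have h0' : PowerSeries.constantCoeff w ≠ 0 := by
    intro h1
    rw [PowerSeries.coeff_zero_eq_constantCoeff_apply, h1] at h0; simp at h0
  intro k
  induction k using Nat.strong_induction_on with
  | _ k ih =>
    rw [PowerSeries.coeff_inv]
    rw [PowerSeries.coeff_zero_eq_constantCoeff_apply] at h0
    have hi : padicNorm 2 (PowerSeries.constantCoeff w)⁻¹ = 1 := by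
      have := padicNorm.mul (p := 2) (PowerSeries.constantCoeff w) (PowerSeries.constantCoeff w)⁻¹
      rw [mul_inv_cancel₀ h0', padicNorm.one, h0] at this
      linarith
    split_ifs with hk
    · exact hi.le
    · rw [padicNorm.mul, padicNorm.neg, hi, one_mul]
      refine padicNorm.sum_le' (fun i _ => ?_) zero_le_one
      split_ifs with h2
      · rw [padicNorm.mul]
        exact mul_le_one₀ (h _) (padicNorm.nonneg _) (ih _ h2)
      · simp

theorem int_even {a : ℤ} (h : a % 2 = 0) : padicNorm 2 (a : ℚ) ≤ 1 / 2 := by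
  obtain ⟨b, rfl⟩ := Int.dvd_of_emod_eq_zero h
  push_cast
  rw [padicNorm.mul]
  have h2 : padicNorm 2 (2 : ℚ) = 1 / 2 := by
    have := padicNorm.padicNorm_p (p := 2) (by norm_num)
    push_cast at this
    rw [this]; norm_num
  rw [h2]
  have := padicNorm.of_int (p := 2) b
  linarith

theorem int_odd {a : ℤ} (h : a % 2 = 1) : padicNorm 2 (a : ℚ) = 1 := by
  rw [padicNorm.int_eq_one_iff]; omega

theorem even_of {a : ℤ} (h : padicNorm 2 (a : ℚ) ≤ 1 / 2) : a % 2 = 0 := by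
  by_contra h1
  have := int_odd (a := a) (by omega)
  rw [this] at h; norm_num at h

theorem cq_mul_coeff (a0 a1 a2 n : ℤ) (U : PowerSeries ℚ) (k : ℕ) : PowerSeries.coeff (k + 3) ((cq a0 a1 a2 n : PowerSeries ℚ)*U) =
    n*PowerSeries.coeff k U + a2*PowerSeries.coeff (k + 1) U + a1*PowerSeries.coeff (k + 2) U + a0*PowerSeries.coeff (k + 3) U := by
  have e : (cq a0 a1 a2 n : PowerSeries ℚ)*U = PowerSeries.C (a0 : ℚ)*U + PowerSeries.C (a1 : ℚ)*(PowerSeries.X^1*U) +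
      PowerSeries.C (a2 : ℚ)*(PowerSeries.X^2*U) + PowerSeries.C (n : ℚ)*(PowerSeries.X^3*U) := by
    simp only [cq, Polynomial.coe_add, Polynomial.coe_mul, Polynomial.coe_C, Polynomial.coe_X, Polynomial.coe_pow]
    ring
  rw [e]
  simp only [map_add, PowerSeries.coeff_C_mul]
  rw [PowerSeries.coeff_X_pow_mul U 3 k, show k + 3 = k + 1 + 2 from rfl, PowerSeries.coeff_X_pow_mul U 2 (k + 1),
    show k + 1 + 2 = k + 2 + 1 from rfl, PowerSeries.coeff_X_pow_mul U 1 (k + 2)]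
  ring

structure Sh (a0 a1 a2 n : ℤ) : Prop where
  hn : n % 2 = 1
  h2 : a2 % 2 = 0
  h1 : a1 % 2 = 0
  h0 : a0 % 2 = 0

theorem Sh.wb {a0 a1 a2 n : ℤ} (h : Sh a0 a1 a2 n) {U : PowerSeries ℚ} {C ε : ℚ} (hU : Bd C U) (hε : 0 ≤ ε)
    (hk : ∀ k, padicNorm 2 (PowerSeries.coeff (k + 3) ((cq a0 a1 a2 n : PowerSeries ℚ)*U)) ≤ ε) (i : ℕ) : Bd (max ε (C / 2^i)) U := by
  induction i with
  | zero => exact hU.mono (by simp)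
  | succ i ih =>
    intro k
    have e := cq_mul_coeff a0 a1 a2 n U k
    have h3 := hk k
    set c := PowerSeries.coeff (k + 3) ((cq a0 a1 a2 n : PowerSeries ℚ)*U)
    have e' : (n : ℚ)*PowerSeries.coeff k U = ((c - a2*PowerSeries.coeff (k + 1) U) - a1*PowerSeries.coeff (k + 2) U) - a0*PowerSeries.coeff (k + 3) U := by
      rw [e]; ring
    have hC := hU.nonneg
    have key : ∀ (a : ℤ) (j : ℕ), a % 2 = 0 → padicNorm 2 (a*PowerSeries.coeff j U) ≤ max ε (C / 2^(i + 1)) := by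
      intro a j ha
      rw [padicNorm.mul]
      have h1 := int_even ha
      have h2 := ih j
      have : padicNorm 2 (a : ℚ)*padicNorm 2 (PowerSeries.coeff j U) ≤ 1 / 2*max ε (C / 2^i) :=
        mul_le_mul h1 h2 (padicNorm.nonneg _) (by norm_num)
      refine this.trans ?_
      rcases max_cases ε (C / 2^i) with ⟨h4, -⟩ | ⟨h4, -⟩ <;> rw [h4]
      · exact le_max_of_le_left (by linarith)
      · refine le_max_of_le_right (le_of_eq ?_)
        rw [pow_succ]; field_simp
    have h5 := congrArg (padicNorm 2) e'
    rw [padicNorm.mul, int_odd h.hn, one_mul] at h5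
    rw [h5]
    refine padicNorm.sub.trans (max_le (padicNorm.sub.trans (max_le (padicNorm.sub.trans (max_le ?_ ?_)) ?_)) ?_)
    · exact h3.trans (le_max_left _ _)
    · exact key _ _ h.h2
    · exact key _ _ h.h1
    · exact key _ _ h.h0

theorem Sh.int {a0 a1 a2 n : ℤ} (h : Sh a0 a1 a2 n) {U : PowerSeries ℚ} (hU : Bdd U)
    (hk : Bd 1 ((cq a0 a1 a2 n : PowerSeries ℚ)*U)) : Bd 1 U := by
  obtain ⟨C, hU⟩ := hU
  obtain ⟨i, hi⟩ := pow_unbounded_of_one_lt C (one_lt_two)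
  refine (h.wb hU zero_le_one (fun k => hk _) i).mono (max_le le_rfl ?_)
  rw [div_le_one (by positivity)]; exact hi.le

theorem Sh.zero {a0 a1 a2 n : ℤ} (h : Sh a0 a1 a2 n) {U : PowerSeries ℚ} (hU : Bdd U)
    (hk : ∀ k, PowerSeries.coeff (k + 3) ((cq a0 a1 a2 n : PowerSeries ℚ)*U) = 0) : U = 0 := by
  obtain ⟨C, hU⟩ := hU
  ext k
  by_contra hne
  have hpos : 0 < padicNorm 2 (PowerSeries.coeff k U) := lt_of_le_of_ne (padicNorm.nonneg _) (Ne.symm (padicNorm.nonzero (by simpa using hne)))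
  obtain ⟨i, hi⟩ := pow_unbounded_of_one_lt (C / padicNorm 2 (PowerSeries.coeff k U)) (one_lt_two)
  have := h.wb hU le_rfl (fun k => by rw [hk]; simp) i k
  rw [max_eq_right (by have := hU.nonneg; positivity)] at this
  rw [div_lt_iff₀ hpos] at hi
  rw [le_div_iff₀ (by positivity)] at this
  linarith

def Dv (p : ℚ[X]) (w : PowerSeries ℚ) : Prop := ∃ U, Bdd U ∧ w = (p : PowerSeries ℚ)*U

theorem Sh.ne {a0 a1 a2 n : ℤ} (h : Sh a0 a1 a2 n) : n ≠ 0 := by have := h.hn; omega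

theorem Sh.dvd {a0 a1 a2 n : ℤ} (h : Sh a0 a1 a2 n) {P : ℚ[X]} {U : PowerSeries ℚ} (hU : Bdd U) (hP : (P : PowerSeries ℚ) = (cq a0 a1 a2 n : PowerSeries ℚ)*U) :
    ∃ Q : ℚ[X], P = cq a0 a1 a2 n*Q ∧ U = Q := by
  set a := cq a0 a1 a2 n with ha
  have had : a.natDegree = 3 := cq_deg _ _ _ _ h.ne
  have e : (a : PowerSeries ℚ)*(U - (P / a : ℚ[X])) = (P % a : ℚ[X]) := by
    have := congrArg (fun p : ℚ[X] => (p : PowerSeries ℚ)) (EuclideanDomain.div_add_mod P a)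
    simp only [Polynomial.coe_add, Polynomial.coe_mul] at this
    linear_combination -hP - this
  have h0 := h.zero (hU.sub (Bdd.poly (P / a))) (fun k => by
    rw [← ha, e, Polynomial.coeff_coe]
    apply coeff_eq_zero_of_natDegree_lt
    have := natDegree_mod_lt P (q := a) (by omega)
    omega)
  refine ⟨P / a, ?_, sub_eq_zero.1 h0⟩
  rw [h0, mul_zero] at e
  have e2 : P % a = 0 := by exact_mod_cast e.symm
  have := EuclideanDomain.div_add_mod P a
  rw [e2, add_zero] at this
  exact this.symm

noncomputable def sZ : ℤ[X] := 1 + X - 6*X^2 + 7*X^3 + X^4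
noncomputable def tZ : ℤ[X] := 2 + 4*X - 9*X^2 + X^3

theorem sZ_map : sZ.map (Int.castRingHom ℚ) = sz := by simp [sZ, sz]
theorem tZ_map : tZ.map (Int.castRingHom ℚ) = tz := by simp [tZ, tz]

theorem exV0 : ∃ V : PowerSeries ℤ, (PowerSeries.X^5*V^2 + (sZ : PowerSeries ℤ)*V - (tZ : PowerSeries ℤ)) = 0 := by
  obtain ⟨r, hr⟩ : ∃ r : PowerSeries ℤ, (sZ : PowerSeries ℤ)*r = 1 := by
    refine ⟨PowerSeries.invOfUnit sZ 1, PowerSeries.mul_invOfUnit _ _ ?_⟩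
    simp [sZ]
  let c : PowerSeries ℤ := PowerSeries.catalanSeries.map (Nat.castRingHom ℤ)
  have hc : c^2*PowerSeries.X + 1 = c := by
    have := congrArg (PowerSeries.map (Nat.castRingHom ℤ)) PowerSeries.catalanSeries_sq_mul_X_add_one
    simpa using this
  let w : PowerSeries ℤ := -(PowerSeries.X^5*(tZ : PowerSeries ℤ)*r^2)
  have hw : PowerSeries.HasSubst w := PowerSeries.HasSubst.of_constantCoeff_zero (by
    have : PowerSeries.constantCoeff w = 0 := by simp [w]
    exact this)
  have h1 := congrArg (PowerSeries.substAlgHom hw) hc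
  rw [map_add, map_mul, map_pow, map_one, PowerSeries.substAlgHom_X] at h1
  set d := PowerSeries.substAlgHom hw c
  refine ⟨(tZ : PowerSeries ℤ)*r*d, ?_⟩
  have : w = -(PowerSeries.X^5*(tZ : PowerSeries ℤ)*r^2) := rfl
  rw [this] at h1
  linear_combination (tZ : PowerSeries ℤ)*d*hr - (tZ : PowerSeries ℤ)*h1

noncomputable def V0 : PowerSeries ℤ := Classical.choose exV0
noncomputable def VV : PowerSeries ℚ := V0.map (Int.castRingHom ℚ)

theorem VV_eq : PowerSeries.X^5*VV^2 + (sz : PowerSeries ℚ)*VV - (tz : PowerSeries ℚ) = 0 := by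
  have h := congrArg (PowerSeries.map (Int.castRingHom ℚ)) (Classical.choose_spec exV0)
  have e : ∀ p : ℤ[X], PowerSeries.map (Int.castRingHom ℚ) (p : PowerSeries ℤ) = ((p.map (Int.castRingHom ℚ) : ℚ[X]) : PowerSeries ℚ) := by
    intro p; ext k; simp
  rw [map_sub, map_add, map_mul, map_mul, e, e, sZ_map, tZ_map, map_pow, map_pow, PowerSeries.map_X, map_zero] at h
  exact h

theorem VV_bd : Bd 1 VV := Bd.int _
theorem VV_bdd : Bdd VV := ⟨1, VV_bd⟩

theorem VV_0 : PowerSeries.constantCoeff VV = 2 := by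
  have := congrArg PowerSeries.constantCoeff VV_eq
  simp [sz, tz] at this
  linarith

theorem Dv.bdd_mul {p : ℚ[X]} {w u : PowerSeries ℚ} (h : Dv p w) (hu : Bdd u) : Dv p (w*u) := by
  obtain ⟨U, hU, rfl⟩ := h
  exact ⟨U*u, hU.mul hu, by ring⟩
theorem Dv.add {p : ℚ[X]} {w u : PowerSeries ℚ} (h : Dv p w) (h' : Dv p u) : Dv p (w + u) := by
  obtain ⟨U, hU, rfl⟩ := h
  obtain ⟨U', hU', rfl⟩ := h'
  exact ⟨U + U', hU.add hU', by ring⟩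
theorem Dv.poly {p r : ℚ[X]} (h : p ∣ r) : Dv p (r : PowerSeries ℚ) := by
  obtain ⟨k, rfl⟩ := h
  exact ⟨k, Bdd.poly k, by simp⟩
theorem Dv.of_dvd {p r : ℚ[X]} (h : p ∣ r) {w : PowerSeries ℚ} (hw : Dv r w) : Dv p w := by
  obtain ⟨k, rfl⟩ := h
  obtain ⟨U, hU, rfl⟩ := hw
  exact ⟨k*U, (Bdd.poly k).mul hU, by simp [mul_assoc]⟩
theorem Dv.mul {p r : ℚ[X]} {w u : PowerSeries ℚ} (h : Dv p w) (h' : Dv r u) : Dv (p*r) (w*u) := by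
  obtain ⟨U, hU, rfl⟩ := h
  obtain ⟨U', hU', rfl⟩ := h'
  exact ⟨U*U', hU.mul hU', by simp; ring⟩
theorem Dv.cop {p r : ℚ[X]} (hc : IsCoprime p r) {w : PowerSeries ℚ} (h : Dv p w) (h' : Dv r w) : Dv (p*r) w := by
  obtain ⟨U, hU, e⟩ := h
  obtain ⟨U', hU', e'⟩ := h'
  obtain ⟨x, y, hxy⟩ := hc
  refine ⟨x*U' + y*U, ((Bdd.poly x).mul hU').add ((Bdd.poly y).mul hU), ?_⟩
  have := congrArg (fun q : ℚ[X] => (q : PowerSeries ℚ)) hxy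
  simp only [Polynomial.coe_add, Polynomial.coe_mul, Polynomial.coe_one] at this ⊢
  linear_combination (-w)*this + (x : PowerSeries ℚ)*p*e' + (y : PowerSeries ℚ)*r*e

/-- V is rational modulo p -/
def Rt (p : ℚ[X]) : Prop := ∃ v : ℚ[X], Dv p (VV - v)

theorem Rt.of_dvd {p r : ℚ[X]} (h : p ∣ r) (hr : Rt r) : Rt p := by
  obtain ⟨v, hv⟩ := hr
  exact ⟨v, hv.of_dvd h⟩

theorem Rt.cop {p r : ℚ[X]} (hc : IsCoprime p r) (h : Rt p) (h' : Rt r) : Rt (p*r) := by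
  obtain ⟨v, hv⟩ := h
  obtain ⟨v', hv'⟩ := h'
  obtain ⟨x, y, hxy⟩ := id hc
  refine ⟨x*p*v' + y*r*v, Dv.cop hc ?_ ?_⟩
  · have e : VV - ((x*p*v' + y*r*v : ℚ[X]) : PowerSeries ℚ) = (VV - v) + ((p*(x*(v - v')) : ℚ[X]) : PowerSeries ℚ) := by
      have := congrArg (fun q : ℚ[X] => (q : PowerSeries ℚ)) hxy
      simp only [Polynomial.coe_add, Polynomial.coe_mul, Polynomial.coe_one, Polynomial.coe_sub] at this ⊢
      linear_combination (-(v : PowerSeries ℚ))*this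
    rw [e]
    exact hv.add (Dv.poly ⟨_, rfl⟩)
  · have e : VV - ((x*p*v' + y*r*v : ℚ[X]) : PowerSeries ℚ) = (VV - v') + ((r*(y*(v' - v)) : ℚ[X]) : PowerSeries ℚ) := by
      have := congrArg (fun q : ℚ[X] => (q : PowerSeries ℚ)) hxy
      simp only [Polynomial.coe_add, Polynomial.coe_mul, Polynomial.coe_one, Polynomial.coe_sub] at this ⊢
      linear_combination (-(v' : PowerSeries ℚ))*this
    rw [e]
    exact hv'.add (Dv.poly ⟨_, rfl⟩)

/-- if `b V + c` is divisible and `b` is coprime to `p` then V is rational -/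
theorem Rt.lin {p b c : ℚ[X]} (hc : IsCoprime b p) (h : Dv p ((b : PowerSeries ℚ)*VV + c)) : Rt p := by
  obtain ⟨x, y, hxy⟩ := hc
  refine ⟨-(x*c), ?_⟩
  have e : VV - ((-(x*c) : ℚ[X]) : PowerSeries ℚ) = ((b : PowerSeries ℚ)*VV + c)*x + p*(y*VV) := by
    have := congrArg (fun q : ℚ[X] => (q : PowerSeries ℚ)) hxy
    simp only [Polynomial.coe_add, Polynomial.coe_mul, Polynomial.coe_one, Polynomial.coe_neg] at this ⊢
    linear_combination (-VV)*this
  rw [e]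
  exact (h.bdd_mul (Bdd.poly x)).add ⟨_, (Bdd.poly y).mul ⟨1, VV_bd⟩, rfl⟩

theorem Rt.X_pow (k : ℕ) : Rt (X^k) := by
  refine ⟨PowerSeries.trunc k VV, ⟨PowerSeries.mk fun i => PowerSeries.coeff (i + k) VV, ⟨1, fun i => ?_⟩, ?_⟩⟩
  · rw [PowerSeries.coeff_mk]; exact VV_bd _
  · have := PowerSeries.eq_X_pow_mul_shift_add_trunc k VV
    rw [Polynomial.coe_pow, Polynomial.coe_X]
    linear_combination this

theorem Sh.Dv {a0 a1 a2 n : ℤ} (h : Sh a0 a1 a2 n) {P : ℚ[X]} (hP : Dv (cq a0 a1 a2 n) P) : cq a0 a1 a2 n ∣ P := by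
  obtain ⟨U, hU, e⟩ := hP
  obtain ⟨Q, hQ, -⟩ := h.dvd hU e
  exact ⟨Q, hQ⟩

theorem Dv.phi {p v : ℚ[X]} (hv : Dv p (VV - v)) : Dv p ((X^5*v^2 + sz*v - tz : ℚ[X]) : PowerSeries ℚ) := by
  have e : ((X^5*v^2 + sz*v - tz : ℚ[X]) : PowerSeries ℚ) = (VV - (v : PowerSeries ℚ))*(-((sz : PowerSeries ℚ) + PowerSeries.X^5*(VV + (v : PowerSeries ℚ)))) := by
    have := VV_eq
    simp only [Polynomial.coe_add, Polynomial.coe_mul, Polynomial.coe_sub, Polynomial.coe_pow, Polynomial.coe_X]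
    linear_combination this
  rw [e]
  have : ((X^5 : ℚ[X]) : PowerSeries ℚ) = PowerSeries.X^5 := by simp
  rw [← this]
  exact hv.bdd_mul ((Bdd.poly _).add ((Bdd.poly _).mul (VV_bdd.add (Bdd.poly v)))).neg

theorem Sh.cop {a0 a1 a2 n : ℤ} (h : Sh a0 a1 a2 n) : IsCoprime (cq a0 a1 a2 n) (gz*hz) := by
  have hd := cq_deg a0 a1 a2 n h.ne
  have hne : cq a0 a1 a2 n ≠ 0 := by intro h0; rw [h0] at hd; simp at hd
  refine IsCoprime.mul_right ?_ ?_
  · refine IsCoprime.symm ((irr_gz.coprime_iff_not_dvd).2 ?_)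
    rintro ⟨k, hk⟩
    have hk0 : k ≠ 0 := by rintro rfl; simp at hk; exact hne hk
    have h1 : k.natDegree = 0 := by
      have := congrArg natDegree hk
      rw [natDegree_mul irr_gz.ne_zero hk0, hd, gz_deg] at this; omega
    rw [eq_C_of_natDegree_eq_zero h1] at hk
    have e0 := congrArg (fun p => p.coeff 0) hk
    have e3 := congrArg (fun p => p.coeff 3) hk
    rw [coeff_mul_C] at e0 e3
    have g0 : gz.coeff 0 = 1 := by simp [gz]
    have g3 : gz.coeff 3 = 1 := by have := irr_gz; unfold gz; compute_degree!
    rw [g0, ← cub_map, coeff_map, (cub_coeff _ _ _ _).1] at e0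
    rw [g3, ← cub_map, coeff_map, (cub_coeff _ _ _ _).2.2.2] at e3
    simp at e0 e3
    have : a0 = n := by exact_mod_cast e0.trans e3.symm
    have := h.hn
    have := h.h0
    omega
  · refine IsCoprime.symm ((irr_hz.coprime_iff_not_dvd).2 fun hh => ?_)
    have := natDegree_le_of_dvd hh hne
    rw [hd, hz_deg] at this; omega

theorem scal {k : ℕ} (c : Fin k → ℚ) (i0 : Fin k) (hc : c i0 ≠ 0) : ∃ (r : ℚ) (e : Fin k → ℤ), r ≠ 0 ∧ (∀ i, c i = r*e i) ∧
    ∀ d : ℤ, (∀ i, d ∣ e i) → IsUnit d := by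
  have hD : (∏ i, ((c i).den : ℚ)) ≠ 0 := Finset.prod_ne_zero_iff.2 fun i _ => by exact_mod_cast (c i).den_ne_zero
  let f : Fin k → ℤ := fun i => (c i).num*∏ j ∈ Finset.univ.erase i, ((c j).den : ℤ)
  have hf : ∀ i, (f i : ℚ) = (∏ i, ((c i).den : ℚ))*c i := by
    intro i
    rw [← Finset.mul_prod_erase Finset.univ _ (Finset.mem_univ i)]
    simp only [f]
    push_cast
    have := Rat.mul_den_eq_num (c i)
    linear_combination (-(∏ j ∈ Finset.univ.erase i, ((c j).den : ℚ)))*this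
  obtain ⟨g, hg, h1⟩ := Finset.extract_gcd (s := Finset.univ) f ⟨i0, Finset.mem_univ _⟩
  have hG : ((Finset.univ.gcd f : ℤ) : ℚ) ≠ 0 := by
    intro h0
    have h2 := hf i0
    rw [hg i0 (Finset.mem_univ _)] at h2
    push_cast at h2
    rw [h0, zero_mul] at h2
    exact mul_ne_zero hD hc h2.symm
  refine ⟨(Finset.univ.gcd f : ℤ) / (∏ i, ((c i).den : ℚ)), g, div_ne_zero hG hD, fun i => ?_, fun d hd => ?_⟩
  · have h2 := hf i
    rw [hg i (Finset.mem_univ _)] at h2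
    push_cast at h2
    rw [div_mul_eq_mul_div, eq_div_iff hD, h2]; ring
  · have : d ∣ Finset.univ.gcd g := Finset.dvd_gcd fun i _ => hd i
    rw [h1] at this
    exact isUnit_of_dvd_one this

theorem deg3 {q : ℚ[X]} (h : q.natDegree ≤ 3) : q = C (q.coeff 0) + C (q.coeff 1)*X + C (q.coeff 2)*X^2 + C (q.coeff 3)*X^3 := by
  conv_lhs => rw [q.as_sum_range_C_mul_X_pow' (n := 4) (by omega)]
  simp [Finset.sum_range_succ]

theorem scal4 {q : ℚ[X]} (h : q.natDegree ≤ 3) (h0 : q ≠ 0) : ∃ (r : ℚ) (e0 e1 e2 e3 : ℤ), r ≠ 0 ∧ q = C r*cq e0 e1 e2 e3 ∧ Pr4 e3 e2 e1 e0 := by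
  obtain ⟨i, hi⟩ : ∃ i : Fin 4, q.coeff i ≠ 0 := by
    by_contra! hh
    apply h0
    rw [deg3 h]
    have := hh 0
    have := hh 1
    have := hh 2
    have := hh 3
    simp_all
  obtain ⟨r, e, hr, he, hp⟩ := scal (fun i : Fin 4 => q.coeff i) i hi
  refine ⟨r, e 0, e 1, e 2, e 3, hr, ?_, fun d h3 h2 h1 h0 => hp d fun i => by fin_cases i <;> assumption⟩
  conv_lhs => rw [deg3 h]
  have e0 := he 0
  have e1 := he 1
  have e2 := he 2
  have e3 := he 3
  simp at e0 e1 e2 e3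
  rw [e0, e1, e2, e3]
  simp only [cq, C_mul]
  ring

theorem Pr4.symm {a b c d : ℤ} (h : Pr4 a b c d) : Pr4 d c b a := fun x h1 h2 h3 h4 => h x h4 h3 h2 h1

/-- integrality of square root -/
theorem qint {a0 a1 a2 n : ℤ} (hp : Pr4 n a2 a1 a0) {q : ℚ[X]} (hq : q.natDegree ≤ 3) (P : ℤ[X])
    (h : P.map (Int.castRingHom ℚ) = cq a0 a1 a2 n*q^2) : ∃ q0 q1 q2 q3 : ℤ, q = cq q0 q1 q2 q3 := by
  by_cases h0 : q = 0
  · exact ⟨0, 0, 0, 0, by simp [h0, cq]⟩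
  obtain ⟨r, e0, e1, e2, e3, hr, rfl, he⟩ := scal4 hq h0
  have hrd := Rat.num_div_den r
  have e : C ((r.den : ℤ)^2)*P = C (r.num^2)*(cub a0 a1 a2 n*cub e0 e1 e2 e3^2) := by
    apply Polynomial.map_injective (Int.castRingHom ℚ) Int.cast_injective
    simp only [Polynomial.map_mul, Polynomial.map_pow, cub_map, h, Polynomial.map_C]
    have : (r.num : ℚ) = r*r.den := (Rat.mul_den_eq_num r).symm
    simp only [eq_intCast, Int.cast_pow, this]
    push_cast
    simp only [C_mul, C_pow]
    ring
  have e2' := congrArg content e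
  rw [content_C_mul, content_C_mul, content_mul, pow_two (cub e0 e1 e2 e3), content_mul, hp.symm.prim.content_eq_one, he.symm.prim.content_eq_one] at e2'
  have hd : ((r.den : ℤ))^2 ∣ r.num^2 := by
    have h1 : normalize ((r.den : ℤ)^2) ∣ normalize (r.num^2) := by rw [mul_one, mul_one, mul_one] at e2'; exact ⟨_, e2'.symm⟩
    exact (normalize_dvd_iff.1 (dvd_normalize_iff.1 h1))
  have hd1 : (r.den : ℤ) ∣ r.num := (Int.pow_dvd_pow_iff two_ne_zero).1 hd
  obtain ⟨k, hk⟩ := hd1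
  have : r = k := by
    have h1 : (r.den : ℚ) ≠ 0 := by exact_mod_cast r.den_ne_zero
    rw [← hrd, div_eq_iff h1, hk]; push_cast; ring
  refine ⟨k*e0, k*e1, k*e2, k*e3, ?_⟩
  rw [this]
  simp only [cq, Int.cast_mul, C_mul]
  ring

structure Eqs (l0 l1 l2 m0 m1 m2 m3 q0 q1 q2 q3 a0 a1 a2 n : ℤ) : Prop where
  e0 : - a0*q0*q0 + l0*m0 = 0
  e1 : - 2*a0*q0*q1 - a1*q0*q0 + l0*m0 + l0*m1 + l1*m0 = 0
  e2 : - 2*a0*q0*q2 - a0*q1*q1 - 2*a1*q0*q1 - a2*q0*q0 - 2*l0*l0 - 6*l0*m0 + l0*m1 + l0*m2 + l1*m0 + l1*m1 + l2*m0 = 0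
  e3 : - 2*a0*q0*q3 - 2*a0*q1*q2 - 2*a1*q0*q2 - a1*q1*q1 - 2*a2*q0*q1 - 4*l0*l0 - 4*l0*l1 + 7*l0*m0 - 6*l0*m1 + l0*m2 + l0*m3 - 6*l1*m0 + l1*m1 + l1*m2 + l2*m0 + l2*m1 + m0*m0 - n*q0*q0 = 0
  e4 : - 2*a0*q1*q3 - a0*q2*q2 - 2*a1*q0*q3 - 2*a1*q1*q2 - 2*a2*q0*q2 - a2*q1*q1 + 9*l0*l0 - 8*l0*l1 - 4*l0*l2 + l0*m0 + 7*l0*m1 - 6*l0*m2 + l0*m3 - 2*l1*l1 + 7*l1*m0 - 6*l1*m1 + l1*m2 + l1*m3 - 6*l2*m0 + l2*m1 + l2*m2 + 2*m0*m1 - 2*n*q0*q1 = 0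
  e5 : - 2*a0*q2*q3 - 2*a1*q1*q3 - a1*q2*q2 - 2*a2*q0*q3 - 2*a2*q1*q2 - l0*l0 + 18*l0*l1 - 8*l0*l2 + l0*m1 + 7*l0*m2 - 6*l0*m3 - 4*l1*l1 - 4*l1*l2 + l1*m0 + 7*l1*m1 - 6*l1*m2 + l1*m3 + 7*l2*m0 - 6*l2*m1 + l2*m2 + l2*m3 + 2*m0*m2 + m1*m1 - 2*n*q0*q2 - n*q1*q1 = 0
  e6 : - a0*q3*q3 - 2*a1*q2*q3 - 2*a2*q1*q3 - a2*q2*q2 - 2*l0*l1 + 18*l0*l2 + l0*m2 + 7*l0*m3 + 9*l1*l1 - 8*l1*l2 + l1*m1 + 7*l1*m2 - 6*l1*m3 - 2*l2*l2 + l2*m0 + 7*l2*m1 - 6*l2*m2 + l2*m3 + 2*m0*m3 + 2*m1*m2 - 2*n*q0*q3 - 2*n*q1*q2 = 0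
  e7 : - a1*q3*q3 - 2*a2*q2*q3 - 2*l0*l2 + l0*m3 - l1*l1 + 18*l1*l2 + l1*m2 + 7*l1*m3 - 4*l2*l2 + l2*m1 + 7*l2*m2 - 6*l2*m3 + 2*m1*m3 + m2*m2 - 2*n*q1*q3 - n*q2*q2 = 0
  e8 : - a2*q3*q3 - 2*l1*l2 + l1*m3 + 9*l2*l2 + l2*m2 + 7*l2*m3 + 2*m2*m3 - 2*n*q2*q3 = 0
  e9 : - l2*l2 + l2*m3 + m3*m3 - n*q3*q3 = 0

theorem ap10 {P : Prop} {e0 e1 e2 e3 e4 e5 e6 e7 e8 e9 : ℤ} (mk : e0 = 0 → e1 = 0 → e2 = 0 → e3 = 0 → e4 = 0 → e5 = 0 → e6 = 0 → e7 = 0 → e8 = 0 → e9 = 0 → P)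
    (h : ∑ i, C ((![e0, e1, e2, e3, e4, e5, e6, e7, e8, e9] i : ℤ) : ℚ)*X^(i : ℕ) = (0 : ℚ[X])) : P := by
  have H : ∀ i, ![e0, e1, e2, e3, e4, e5, e6, e7, e8, e9] i = 0 := fun i => by
    have := pl_zero (fun i => ((![e0, e1, e2, e3, e4, e5, e6, e7, e8, e9] i : ℤ) : ℚ)) h i
    exact_mod_cast this
  exact mk (H 0) (H 1) (H 2) (H 3) (H 4) (H 5) (H 6) (H 7) (H 8) (H 9)

theorem Eqs.mk' {l0 l1 l2 m0 m1 m2 m3 q0 q1 q2 q3 a0 a1 a2 n : ℤ}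
    (h : X^3*cq m0 m1 m2 m3^2 + sz*cq l0 l1 l2 0*cq m0 m1 m2 m3 - X^2*tz*cq l0 l1 l2 0^2 = cq a0 a1 a2 n*cq q0 q1 q2 q3^2) :
    Eqs l0 l1 l2 m0 m1 m2 m3 q0 q1 q2 q3 a0 a1 a2 n := by
  refine ap10 (@Eqs.mk l0 l1 l2 m0 m1 m2 m3 q0 q1 q2 q3 a0 a1 a2 n) ?_
  simp only [Fin.sum_univ_succ, Fin.sum_univ_zero]
  have cn : ∀ k : ℕ, ∀ [k.AtLeastTwo], C (OfNat.ofNat k : ℚ) = (OfNat.ofNat k : ℚ[X]) := fun k _ => map_ofNat C k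
  simp [cn]
  simp only [cq, sz, tz, Int.cast_zero, C_0, Polynomial.C_eq_intCast] at h
  simp at h
  linear_combination h

set_option synthInstance.maxHeartbeats 400000 in
set_option synthInstance.maxSize 4000 in
theorem mod2aux : ∀ l0 l1 l2 m3 q0 q1 q2 q3 : ZMod 2, (¬(l0 = 0 ∧ l1 = 0 ∧ l2 = 0 ∧ m3 = 0) ∧ l0*m3 + q0*q0 = 0 ∧
    l0*l0 + l0*m3 + l1*m3 = 0 ∧ l0*l0 + l1*m3 + l2*m3 + q1*q1 = 0 ∧ l0*m3 + l1*l1 + l2*m3 = 0 ∧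
    l0*m3 + l1*l1 + l1*m3 + q2*q2 = 0 ∧ l1*m3 + l2*l2 + l2*m3 = 0 ∧ l2*l2 + l2*m3 + m3*m3 + q3*q3 = 0) →
    (m3 = 1 ∧ q3 = 1 ∧ q1 = 0 ∧ (l0 = 0 ∧ l1 = 0 ∧ l2 = 0 ∧ q0 = 0 ∧ q2 = 0 ∨ l0 = 1 ∧ l1 = 0 ∧ l2 = 1 ∧ q0 = 1 ∧ q2 = 1)) := by
  decide +kernel

theorem Eqs.mod2 {l0 l1 l2 m0 m1 m2 m3 q0 q1 q2 q3 a0 a1 a2 n : ℤ} (h : Eqs l0 l1 l2 m0 m1 m2 m3 q0 q1 q2 q3 a0 a1 a2 n)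
    (hS : Sh a0 a1 a2 n) (hm0 : m0 % 2 = 0) (hm1 : m1 % 2 = 0) (hm2 : m2 % 2 = 0)
    (hne : ¬ (l0 % 2 = 0 ∧ l1 % 2 = 0 ∧ l2 % 2 = 0 ∧ m3 % 2 = 0)) :
    m3 % 2 = 1 ∧ q3 % 2 = 1 ∧ q1 % 2 = 0 ∧ ((l0 % 2 = 0 ∧ l1 % 2 = 0 ∧ l2 % 2 = 0 ∧ q0 % 2 = 0 ∧ q2 % 2 = 0) ∨
      (l0 % 2 = 1 ∧ l1 % 2 = 0 ∧ l2 % 2 = 1 ∧ q0 % 2 = 1 ∧ q2 % 2 = 1)) := by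
  have ev : ∀ x : ℤ, x % 2 = 0 ↔ (x : ZMod 2) = 0 := fun x => by
    rw [ZMod.intCast_zmod_eq_zero_iff_dvd]; omega
  have od : ∀ x : ℤ, x % 2 = 1 ↔ (x : ZMod 2) = 1 := fun x => by
    have := ZMod.intCast_eq_intCast_iff x 1 2
    push_cast at this
    rw [this, Int.modEq_iff_dvd]; omega
  obtain ⟨hn, h2, h1, h0⟩ := hS
  simp only [ev, od] at *
  have E0 := congrArg (Int.cast : ℤ → ZMod 2) h.e0
  have E1 := congrArg (Int.cast : ℤ → ZMod 2) h.e1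
  have E2 := congrArg (Int.cast : ℤ → ZMod 2) h.e2
  have E3 := congrArg (Int.cast : ℤ → ZMod 2) h.e3
  have E4 := congrArg (Int.cast : ℤ → ZMod 2) h.e4
  have E5 := congrArg (Int.cast : ℤ → ZMod 2) h.e5
  have E6 := congrArg (Int.cast : ℤ → ZMod 2) h.e6
  have E7 := congrArg (Int.cast : ℤ → ZMod 2) h.e7
  have E8 := congrArg (Int.cast : ℤ → ZMod 2) h.e8
  have E9 := congrArg (Int.cast : ℤ → ZMod 2) h.e9
  push_cast at E0 E1 E2 E3 E4 E5 E6 E7 E8 E9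
  simp only [hn, h2, h1, h0, hm0, hm1, hm2, mul_zero, zero_mul, add_zero, zero_add, sub_zero, neg_zero, one_mul] at E0 E1 E2 E3 E4 E5 E6 E7 E8 E9
  have t2 : (2 : ZMod 2) = 0 := by decide
  refine mod2aux _ _ _ _ _ _ _ _ ⟨hne, ?_, ?_, ?_, ?_, ?_, ?_, ?_⟩
  · linear_combination E3 - (-2*l0*l0 - 2*l0*l1 - q0*q0 : ZMod 2)*t2
  · linear_combination E4 - (4*l0*l0 - 4*l0*l1 - 2*l0*l2 - l1*l1 - q0*q1 : ZMod 2)*t2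
  · linear_combination E5 - (-l0*l0 + 9*l0*l1 - 4*l0*l2 - 3*l0*m3 - 2*l1*l1 - 2*l1*l2 - q0*q2 - q1*q1 : ZMod 2)*t2
  · linear_combination E6 - (-l0*l1 + 9*l0*l2 + 3*l0*m3 + 4*l1*l1 - 4*l1*l2 - 3*l1*m3 - l2*l2 - q0*q3 - q1*q2 : ZMod 2)*t2
  · linear_combination E7 - (-l0*l2 - l1*l1 + 9*l1*l2 + 3*l1*m3 - 2*l2*l2 - 3*l2*m3 - q1*q3 - q2*q2 : ZMod 2)*t2
  · linear_combination E8 - (-l1*l2 + 4*l2*l2 + 3*l2*m3 - q2*q3 : ZMod 2)*t2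
  · linear_combination E9 - (-l2*l2 - q3*q3 : ZMod 2)*t2

structure St (a0 a1 a2 n : ℤ) : Prop where
  hn : n % 4 = 1
  h2 : a2 % 2 = 0
  h1 : a1 % 2 = 0
  h0 : a0 % 2 = 0
  pr : Pr4 n a2 a1 a0
  rt : Rt (cq a0 a1 a2 n)

theorem St.sh {a0 a1 a2 n : ℤ} (h : St a0 a1 a2 n) : Sh a0 a1 a2 n := ⟨by have := h.hn; omega, h.h2, h.h1, h.h0⟩

structure Da (l0 l1 l2 m0 m1 m2 m3 q0 q1 q2 q3 a0 a1 a2 n : ℤ) : Prop where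
  eq : X^3*cq m0 m1 m2 m3^2 + sz*cq l0 l1 l2 0*cq m0 m1 m2 m3 - X^2*tz*cq l0 l1 l2 0^2 = cq a0 a1 a2 n*cq q0 q1 q2 q3^2
  dv : Dv (cq a0 a1 a2 n) ((cq m0 m1 m2 m3 : PowerSeries ℚ) - PowerSeries.X^2*(cq l0 l1 l2 0 : PowerSeries ℚ)*VV)
  ne : ¬ (l0 % 2 = 0 ∧ l1 % 2 = 0 ∧ l2 % 2 = 0 ∧ m0 % 2 = 0 ∧ m1 % 2 = 0 ∧ m2 % 2 = 0 ∧ m3 % 2 = 0)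

theorem scal7 {l m : ℚ[X]} (hl : l.natDegree ≤ 2) (hm : m.natDegree ≤ 3) (h : l ≠ 0 ∨ m ≠ 0) : ∃ (r : ℚ) (l0 l1 l2 m0 m1 m2 m3 : ℤ), r ≠ 0 ∧
    l = C r*cq l0 l1 l2 0 ∧ m = C r*cq m0 m1 m2 m3 ∧
    ¬ (l0 % 2 = 0 ∧ l1 % 2 = 0 ∧ l2 % 2 = 0 ∧ m0 % 2 = 0 ∧ m1 % 2 = 0 ∧ m2 % 2 = 0 ∧ m3 % 2 = 0) := by
  have l3 : l.coeff 3 = 0 := coeff_eq_zero_of_natDegree_lt (by omega)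
  have dl := deg3 (hl.trans (by norm_num : 2 ≤ 3))
  have dm := deg3 hm
  let c : Fin 7 → ℚ := ![l.coeff 0, l.coeff 1, l.coeff 2, m.coeff 0, m.coeff 1, m.coeff 2, m.coeff 3]
  obtain ⟨i, hi⟩ : ∃ i, c i ≠ 0 := by
    by_contra! hh
    have h0 : l.coeff 0 = 0 := hh 0
    have h1 : l.coeff 1 = 0 := hh 1
    have h2 : l.coeff 2 = 0 := hh 2
    have h3 : m.coeff 0 = 0 := hh 3
    have h4 : m.coeff 1 = 0 := hh 4
    have h5 : m.coeff 2 = 0 := hh 5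
    have h6 : m.coeff 3 = 0 := hh 6
    rcases h with h | h
    · apply h; rw [dl, l3, h0, h1, h2]; simp
    · apply h; rw [dm, h3, h4, h5, h6]; simp
  obtain ⟨r, e, hr, he, hp⟩ := scal c i hi
  refine ⟨r, e 0, e 1, e 2, e 3, e 4, e 5, e 6, hr, ?_, ?_, ?_⟩
  · have h0 : l.coeff 0 = _ := he 0
    have h1 : l.coeff 1 = _ := he 1
    have h2 : l.coeff 2 = _ := he 2
    rw [dl, l3, h0, h1, h2]
    simp only [cq, C_mul, Int.cast_zero, C_0]
    ring
  · have h0 : m.coeff 0 = _ := he 3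
    have h1 : m.coeff 1 = _ := he 4
    have h2 : m.coeff 2 = _ := he 5
    have h3 : m.coeff 3 = _ := he 6
    rw [dm, h3, h0, h1, h2]
    simp only [cq, C_mul]
    ring
  · intro hh
    have := hp 2 (fun i => by fin_cases i <;> (simp; omega))
    exact absurd this (by decide)

theorem St.data {a0 a1 a2 n : ℤ} (h : St a0 a1 a2 n) : ∃ l0 l1 l2 m0 m1 m2 m3 q0 q1 q2 q3, Da l0 l1 l2 m0 m1 m2 m3 q0 q1 q2 q3 a0 a1 a2 n := by
  obtain ⟨v, hv⟩ := h.rt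
  have hv1 := h.sh.Dv hv.phi
  obtain ⟨σ, hσ⟩ := selz1 a0 a1 a2 n h.hn h.h2 h.h1 h.h0 h.pr (sz + 2*X^5*v) (by
    have : (sz + 2*X^5*v)^2 - gz*hz = (X^5*v^2 + sz*v - tz)*(4*X^5) := by rw [fz_eq]; ring
    rw [this]; exact hv1.mul_right _)
  obtain ⟨l, m, q, hok, hq, hne, he⟩ := lin _ v σ (cq_deg _ _ _ _ h.sh.ne) h.sh.cop hv1 hσ
  obtain ⟨r, l0, l1, l2, m0, m1, m2, m3, hr, rfl, rfl, hne'⟩ := scal7 hok.dl hok.dm hne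
  have hr1 : (C r : ℚ[X])*C r⁻¹ = 1 := by rw [← C_mul, mul_inv_cancel₀ hr, C_1]
  have he' : X^3*cq m0 m1 m2 m3^2 + sz*cq l0 l1 l2 0*cq m0 m1 m2 m3 - X^2*tz*cq l0 l1 l2 0^2 = cq a0 a1 a2 n*(C r⁻¹*q)^2 := by
    have : (C r*C r⁻¹)^2*(X^3*cq m0 m1 m2 m3^2 + sz*cq l0 l1 l2 0*cq m0 m1 m2 m3 - X^2*tz*cq l0 l1 l2 0^2) = cq a0 a1 a2 n*(C r⁻¹*q)^2 := by
      linear_combination (C r⁻¹)^2*he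
    rw [hr1] at this
    rw [← this]; ring
  obtain ⟨q0, q1, q2, q3, hqq⟩ := qint h.pr (q := C r⁻¹*q) ((natDegree_C_mul_le _ _).trans hq)
    (X^3*cub m0 m1 m2 m3^2 + sZ*cub l0 l1 l2 0*cub m0 m1 m2 m3 - X^2*tZ*cub l0 l1 l2 0^2) (by
      rw [← he']
      simp only [Polynomial.map_add, Polynomial.map_sub, Polynomial.map_mul, Polynomial.map_pow, cub_map, sZ_map, tZ_map, Polynomial.map_X])
  refine ⟨l0, l1, l2, m0, m1, m2, m3, q0, q1, q2, q3, ⟨by rw [he', hqq], ?_, hne'⟩⟩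
  obtain ⟨k, hk⟩ := hok.dv
  have hk' : cq m0 m1 m2 m3 - X^2*cq l0 l1 l2 0*v = cq a0 a1 a2 n*(C r⁻¹*k) := by
    linear_combination C r⁻¹*hk - (cq m0 m1 m2 m3 - X^2*cq l0 l1 l2 0*v)*hr1
  have e : (cq m0 m1 m2 m3 : PowerSeries ℚ) - PowerSeries.X^2*(cq l0 l1 l2 0 : PowerSeries ℚ)*VV =
      ((cq m0 m1 m2 m3 - X^2*cq l0 l1 l2 0*v : ℚ[X]) : PowerSeries ℚ) + (VV - (v : PowerSeries ℚ))*((-(X^2*cq l0 l1 l2 0) : ℚ[X]) : PowerSeries ℚ) := by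
    simp only [Polynomial.coe_add, Polynomial.coe_sub, Polynomial.coe_mul, Polynomial.coe_neg, Polynomial.coe_pow, Polynomial.coe_X]
    ring
  rw [e]
  exact (Dv.poly ⟨_, hk'⟩).add (hv.bdd_mul (Bdd.poly _))

theorem Bd.cq (a0 a1 a2 n : ℤ) : Bd 1 (cq a0 a1 a2 n : PowerSeries ℚ) := by
  rw [← cub_map]; exact Bd.intpoly _

theorem cq_coeff (a0 a1 a2 n : ℤ) : (cq a0 a1 a2 n).coeff 0 = a0 ∧ (cq a0 a1 a2 n).coeff 1 = a1 ∧ (cq a0 a1 a2 n).coeff 2 = a2 ∧ (cq a0 a1 a2 n).coeff 3 = n := by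
  obtain ⟨h0, h1, h2, h3⟩ := cub_coeff a0 a1 a2 n
  rw [← cub_map]
  simp only [coeff_map, h0, h1, h2, h3]
  simp

theorem Bd.X2 : Bd 1 (PowerSeries.X^2 : PowerSeries ℚ) := by
  have := Bd.intpoly (X^2)
  simpa using this

theorem nle {j : ℕ} {a : ℤ} (h : (2 : ℤ)^j ∣ a) : padicNorm 2 (a : ℚ) ≤ (2 : ℚ)^(-(j : ℤ)) := by
  have := (padicNorm.dvd_iff_norm_le (p := 2) (n := j) (z := a)).1 (by exact_mod_cast h)
  exact_mod_cast this

theorem dle {j : ℕ} {a : ℤ} (h : padicNorm 2 (a : ℚ) ≤ (2 : ℚ)^(-(j : ℤ))) : (2 : ℤ)^j ∣ a := by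
  have := (padicNorm.dvd_iff_norm_le (p := 2) (n := j) (z := a)).2 (by exact_mod_cast h)
  exact_mod_cast this

theorem cm0 (f g : PowerSeries ℚ) : PowerSeries.coeff 0 (f*g) = PowerSeries.coeff 0 f*PowerSeries.coeff 0 g := by
  rw [PowerSeries.coeff_mul, Finset.Nat.sum_antidiagonal_eq_sum_range_succ_mk]
  simp [Finset.sum_range_succ]
theorem cm1 (f g : PowerSeries ℚ) : PowerSeries.coeff 1 (f*g) = PowerSeries.coeff 0 f*PowerSeries.coeff 1 g + PowerSeries.coeff 1 f*PowerSeries.coeff 0 g := by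
  rw [PowerSeries.coeff_mul, Finset.Nat.sum_antidiagonal_eq_sum_range_succ_mk]
  simp [Finset.sum_range_succ]
theorem cm2 (f g : PowerSeries ℚ) : PowerSeries.coeff 2 (f*g) = PowerSeries.coeff 0 f*PowerSeries.coeff 2 g + PowerSeries.coeff 1 f*PowerSeries.coeff 1 g +
    PowerSeries.coeff 2 f*PowerSeries.coeff 0 g := by
  rw [PowerSeries.coeff_mul, Finset.Nat.sum_antidiagonal_eq_sum_range_succ_mk]
  simp [Finset.sum_range_succ]

section
variable {l0 l1 l2 m0 m1 m2 m3 q0 q1 q2 q3 a0 a1 a2 n : ℤ}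

theorem Da.U (h : Da l0 l1 l2 m0 m1 m2 m3 q0 q1 q2 q3 a0 a1 a2 n) (hS : Sh a0 a1 a2 n) : ∃ U : PowerSeries ℚ, Bd 1 U ∧
    (cq m0 m1 m2 m3 : PowerSeries ℚ) - PowerSeries.X^2*(cq l0 l1 l2 0 : PowerSeries ℚ)*VV = (cq a0 a1 a2 n : PowerSeries ℚ)*U := by
  obtain ⟨U, hU, e⟩ := h.dv
  refine ⟨U, hS.int hU ?_, e⟩
  rw [← e]
  exact (Bd.cq _ _ _ _).sub ((Bd.X2.mul1 (Bd.cq _ _ _ _)).mul1 VV_bd)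

theorem Da.mdiv (h : Da l0 l1 l2 m0 m1 m2 m3 q0 q1 q2 q3 a0 a1 a2 n) (hS : Sh a0 a1 a2 n) {j : ℕ} (hl : (2 : ℤ)^j ∣ 2*l0)
    (h0 : (2 : ℤ)^j ∣ a0) (h1 : (2 : ℤ)^j ∣ a1) (h2 : (2 : ℤ)^j ∣ a2) : (2 : ℤ)^j ∣ m0 ∧ (2 : ℤ)^j ∣ m1 ∧ (2 : ℤ)^j ∣ m2 := by
  obtain ⟨U, hU, e⟩ := h.U hS
  have e' : (cq m0 m1 m2 m3 : PowerSeries ℚ) - PowerSeries.X^2*((cq l0 l1 l2 0 : PowerSeries ℚ)*VV) = (cq a0 a1 a2 n : PowerSeries ℚ)*U := by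
    rw [← e]; ring
  obtain ⟨c0, c1, c2, c3⟩ := cq_coeff a0 a1 a2 n
  obtain ⟨d0, d1, d2, d3⟩ := cq_coeff m0 m1 m2 m3
  obtain ⟨g0, g1, g2, g3⟩ := cq_coeff l0 l1 l2 0
  have t0 := congrArg (PowerSeries.coeff 0) e'
  have t1 := congrArg (PowerSeries.coeff 1) e'
  have t2 := congrArg (PowerSeries.coeff 2) e'
  have hV : PowerSeries.coeff 0 VV = 2 := by rw [PowerSeries.coeff_zero_eq_constantCoeff_apply, VV_0]
  rw [map_sub, Polynomial.coeff_coe, PowerSeries.coeff_X_pow_mul'] at t0 t1 t2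
  rw [if_neg (by norm_num), cm0, Polynomial.coeff_coe, d0, c0, sub_zero] at t0
  rw [if_neg (by norm_num), cm1, Polynomial.coeff_coe, Polynomial.coeff_coe, d1, c0, c1, sub_zero] at t1
  rw [if_pos (by norm_num), cm2, Polynomial.coeff_coe, Polynomial.coeff_coe, Polynomial.coeff_coe, d2, c0, c1, c2, Nat.sub_self, cm0, Polynomial.coeff_coe, g0, hV] at t2
  have key : ∀ {a : ℤ}, (2 : ℤ)^j ∣ a → ∀ i, padicNorm 2 (a*PowerSeries.coeff i U) ≤ (2 : ℚ)^(-(j : ℤ)) := by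
    intro a ha i
    rw [padicNorm.mul]
    have := nle ha
    have h3 := hU i
    have : padicNorm 2 (a : ℚ)*padicNorm 2 (PowerSeries.coeff i U) ≤ (2 : ℚ)^(-(j : ℤ))*1 := mul_le_mul this h3 (padicNorm.nonneg _) (by positivity)
    simpa using this
  have kadd : ∀ {x y : ℚ}, padicNorm 2 x ≤ (2 : ℚ)^(-(j : ℤ)) → padicNorm 2 y ≤ (2 : ℚ)^(-(j : ℤ)) → padicNorm 2 (x + y) ≤ (2 : ℚ)^(-(j : ℤ)) :=
    fun hx hy => padicNorm.nonarchimedean.trans (max_le hx hy)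
  refine ⟨dle ?_, dle ?_, dle ?_⟩
  · rw [t0]; exact key h0 0
  · rw [t1]; exact kadd (key h0 1) (key h1 0)
  · rw [sub_eq_iff_eq_add] at t2
    rw [t2]
    refine kadd (kadd (kadd (key h0 2) (key h1 1)) (key h2 0)) ?_
    have := nle hl
    push_cast at this
    rwa [mul_comm] at this
end

theorem ev_of {x m k : ℤ} (hm : m % 2 = 1) (h : x*m = 2*k) : ∃ y, x = 2*y := by
  have h1 : (x*m) % 2 = 0 := by omega
  rw [Int.mul_emod, hm] at h1
  exact ⟨x / 2, by omega⟩

section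
variable {l0 l1 l2 m0 m1 m2 m3 q0 q1 q2 q3 a0 a1 a2 n : ℤ}

theorem dbl_aux {L0 L1 L2 M0 M1 M2 m3 Q0 Q1 Q2 q3 A0 A1 A2 n K : ℤ} (hK : K ≠ 0) (hm : m3 % 2 = 1) (hq : q3 % 2 = 1)
    (h : Eqs (2*K*L0) (2*K*L1) (2*K*L2) (2*K*M0) (2*K*M1) (2*K*M2) m3 (2*K*Q0) (2*K*Q1) (2*K*Q2) q3
      (2*K*A0) (2*K*A1) (2*K*A2) n) : (∃ x, L0 = 2*x) ∧ (∃ x, A0 = 2*x) ∧ (∃ x, A1 = 2*x) ∧ (∃ x, A2 = 2*x) ∧ (∃ x, L1 = 2*x) ∧ (∃ x, L2 = 2*x) := by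
  have hN : 2*K ≠ 0 := by omega
  have hqq : (q3*q3) % 2 = 1 := by rw [Int.mul_emod, hq]; rfl
  have h3 : L0*m3 = 2*(2*A0*Q0*q3*K + 4*A0*Q1*Q2*K*K + 4*A1*Q0*Q2*K*K + 2*A1*Q1*Q1*K*K + 4*A2*Q0*Q1*K*K + 4*L0*L0*K + 4*L0*L1*K - 7*L0*M0*K + 6*L0*M1*K - L0*M2*K + 6*L1*M0*K - L1*M1*K - L1*M2*K - L2*M0*K - L2*M1*K - M0*M0*K + n*Q0*Q0*K) := by
    apply mul_left_cancel₀ hN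
    linear_combination h.e3
  obtain ⟨ly0, rfl⟩ := ev_of hm h3
  have h4 : L1*m3 = 2*(2*A0*Q1*q3*K + 2*A0*Q2*Q2*K*K + 2*A1*Q0*q3*K + 4*A1*Q1*Q2*K*K + 4*A2*Q0*Q2*K*K + 2*A2*Q1*Q1*K*K - 36*ly0*ly0*K + 16*ly0*L1*K + 8*ly0*L2*K - 2*ly0*M0*K - 14*ly0*M1*K + 12*ly0*M2*K - ly0*m3 + 2*L1*L1*K - 7*L1*M0*K + 6*L1*M1*K - L1*M2*K + 6*L2*M0*K - L2*M1*K - L2*M2*K - 2*M0*M1*K + 2*n*Q0*Q1*K) := by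
    apply mul_left_cancel₀ hN
    linear_combination h.e4
  obtain ⟨ly1, rfl⟩ := ev_of hm h4
  have h5 : L2*m3 = 2*(2*A0*Q2*q3*K + 2*A1*Q1*q3*K + 2*A1*Q2*Q2*K*K + 2*A2*Q0*q3*K + 4*A2*Q1*Q2*K*K + 4*ly0*ly0*K - 72*ly0*ly1*K + 16*ly0*L2*K - 2*ly0*M1*K - 14*ly0*M2*K + 6*ly0*m3 + 16*ly1*ly1*K + 8*ly1*L2*K - 2*ly1*M0*K - 14*ly1*M1*K + 12*ly1*M2*K - ly1*m3 - 7*L2*M0*K + 6*L2*M1*K - L2*M2*K - 2*M0*M2*K - M1*M1*K + 2*n*Q0*Q2*K + n*Q1*Q1*K) := by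
    apply mul_left_cancel₀ hN
    linear_combination h.e5
  obtain ⟨ly2, rfl⟩ := ev_of hm h5
  have h6 : A0*(q3*q3) = 2*(-2*A1*Q2*q3*K - 2*A2*Q1*q3*K - 2*A2*Q2*Q2*K*K - 8*ly0*ly1*K + 72*ly0*ly2*K + 2*ly0*M2*K + 7*ly0*m3 + 36*ly1*ly1*K - 32*ly1*ly2*K + 2*ly1*M1*K + 14*ly1*M2*K - 6*ly1*m3 - 8*ly2*ly2*K + 2*ly2*M0*K + 14*ly2*M1*K - 12*ly2*M2*K + ly2*m3 + M0*m3 + 2*M1*M2*K - n*Q0*q3 - 2*n*Q1*Q2*K) := by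
    apply mul_left_cancel₀ hN
    linear_combination -h.e6
  obtain ⟨ay0, rfl⟩ := ev_of hqq h6
  have h7 : A1*(q3*q3) = 2*(-2*A2*Q2*q3*K - 8*ly0*ly2*K + ly0*m3 - 4*ly1*ly1*K + 72*ly1*ly2*K + 2*ly1*M2*K + 7*ly1*m3 - 16*ly2*ly2*K + 2*ly2*M1*K + 14*ly2*M2*K - 6*ly2*m3 + M1*m3 + M2*M2*K - n*Q1*q3 - n*Q2*Q2*K) := by
    apply mul_left_cancel₀ hN
    linear_combination -h.e7
  obtain ⟨ay1, rfl⟩ := ev_of hqq h7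
  have h8 : A2*(q3*q3) = 2*(-8*ly1*ly2*K + ly1*m3 + 36*ly2*ly2*K + 2*ly2*M2*K + 7*ly2*m3 + M2*m3 - n*Q2*q3) := by
    apply mul_left_cancel₀ hN
    linear_combination -h.e8
  obtain ⟨ay2, rfl⟩ := ev_of hqq h8
  exact ⟨⟨_, rfl⟩, ⟨_, rfl⟩, ⟨_, rfl⟩, ⟨_, rfl⟩, ⟨_, rfl⟩, ⟨_, rfl⟩⟩

theorem Da.dbl (h : Da l0 l1 l2 m0 m1 m2 m3 q0 q1 q2 q3 a0 a1 a2 n) (hS : Sh a0 a1 a2 n) (hm : m3 % 2 = 1) (hq : q3 % 2 = 1)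
    (hl0 : l0 % 2 = 0) (hl1 : l1 % 2 = 0) (hl2 : l2 % 2 = 0) {k : ℕ} (hk0 : (2 : ℤ)^k ∣ q0) (hk1 : (2 : ℤ)^k ∣ q1) (hk2 : (2 : ℤ)^k ∣ q2) :
    ∀ i ≤ k, ((2 : ℤ)^(i + 1) ∣ l0 ∧ (2 : ℤ)^(i + 1) ∣ l1 ∧ (2 : ℤ)^(i + 1) ∣ l2) ∧ ((2 : ℤ)^(i + 1) ∣ a0 ∧ (2 : ℤ)^(i + 1) ∣ a1 ∧ (2 : ℤ)^(i + 1) ∣ a2) := by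
  intro i
  induction i with
  | zero =>
    intro _
    have := hS.h0
    have := hS.h1
    have := hS.h2
    simp only [zero_add, pow_one]
    omega
  | succ i ih =>
    intro hi
    obtain ⟨⟨b0, b1, b2⟩, c0, c1, c2⟩ := ih (by omega)
    obtain ⟨d0, d1, d2⟩ := h.mdiv hS (b0.mul_left 2) c0 c1 c2
    have hE := Eqs.mk' h.eq
    have e0 := (pow_dvd_pow (2 : ℤ) hi).trans hk0
    have e1 := (pow_dvd_pow (2 : ℤ) hi).trans hk1
    have e2 := (pow_dvd_pow (2 : ℤ) hi).trans hk2
    have hK : (2 : ℤ)^i ≠ 0 := by positivity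
    have p1 : (2 : ℤ)^(i + 1) = 2*2^i := by ring
    have p2 : (2 : ℤ)^(i + 1 + 1) = 2*2^i*2 := by ring
    rw [p1] at b0 b1 b2 c0 c1 c2 d0 d1 d2 e0 e1 e2
    rw [p2]
    clear ih hk0 hk1 hk2 p1 p2 hi h hS hl0 hl1 hl2
    obtain ⟨L0, rfl⟩ := b0
    obtain ⟨L1, rfl⟩ := b1
    obtain ⟨L2, rfl⟩ := b2
    obtain ⟨A0, rfl⟩ := c0
    obtain ⟨A1, rfl⟩ := c1
    obtain ⟨A2, rfl⟩ := c2
    obtain ⟨M0, rfl⟩ := d0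
    obtain ⟨M1, rfl⟩ := d1
    obtain ⟨M2, rfl⟩ := d2
    obtain ⟨Q0, rfl⟩ := e0
    obtain ⟨Q1, rfl⟩ := e1
    obtain ⟨Q2, rfl⟩ := e2
    obtain ⟨⟨x0, rfl⟩, ⟨x1, rfl⟩, ⟨x2, rfl⟩, ⟨x3, rfl⟩, ⟨x4, rfl⟩, ⟨x5, rfl⟩⟩ := dbl_aux hK hm hq hE
    exact ⟨⟨⟨x0, by ring⟩, ⟨x4, by ring⟩, ⟨x5, by ring⟩⟩, ⟨x1, by ring⟩, ⟨x2, by ring⟩, ⟨x3, by ring⟩⟩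
end

theorem prim4 (q0 q1 q2 q3 : ℤ) (h : q3 % 2 = 1) : ∃ d e0 e1 e2 e3 : ℤ, d % 2 = 1 ∧ e3 % 4 = 1 ∧ q0 = d*e0 ∧ q1 = d*e1 ∧ q2 = d*e2 ∧ q3 = d*e3 ∧
    Pr4 e3 e2 e1 e0 := by
  obtain ⟨g, hg, h1⟩ := Finset.extract_gcd (s := Finset.univ) ![q0, q1, q2, q3] ⟨0, Finset.mem_univ _⟩
  set d := Finset.univ.gcd ![q0, q1, q2, q3]
  have g0 : q0 = d*g 0 := hg 0 (Finset.mem_univ _)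
  have g1 : q1 = d*g 1 := hg 1 (Finset.mem_univ _)
  have g2 : q2 = d*g 2 := hg 2 (Finset.mem_univ _)
  have g3 : q3 = d*g 3 := hg 3 (Finset.mem_univ _)
  have hp : Pr4 (g 3) (g 2) (g 1) (g 0) := by
    intro x h3 h2 hh1 h0
    have : x ∣ Finset.univ.gcd g := Finset.dvd_gcd fun i _ => by fin_cases i <;> assumption
    rw [h1] at this
    exact isUnit_of_dvd_one this
  have h3 : (d*g 3) % 2 = 1 := by rw [← g3]; exact h
  have hd : d % 2 = 1 := by
    rcases Int.emod_two_eq_zero_or_one d with h4 | h4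
    · rw [Int.mul_emod, h4] at h3; simp at h3
    · exact h4
  have hgo : (g 3) % 2 = 1 := by rw [Int.mul_emod, hd] at h3; omega
  rcases (by omega : g 3 % 4 = 1 ∨ (-(g 3)) % 4 = 1) with h4 | h4
  · exact ⟨d, g 0, g 1, g 2, g 3, hd, h4, g0, g1, g2, g3, hp⟩
  · refine ⟨-d, -g 0, -g 1, -g 2, -g 3, by omega, h4, ?_, ?_, ?_, ?_, ?_⟩
    · rw [g0]; ring
    · rw [g1]; ring
    · rw [g2]; ring
    · rw [g3]; ring
    · intro x h3 h2 hh1 h0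
      exact hp x ((dvd_neg).1 h3) ((dvd_neg).1 h2) ((dvd_neg).1 hh1) ((dvd_neg).1 h0)

theorem cq_C (d e0 e1 e2 e3 : ℤ) : cq (d*e0) (d*e1) (d*e2) (d*e3) = C (d : ℚ)*cq e0 e1 e2 e3 := by
  simp only [cq, Int.cast_mul, C_mul]; ring

theorem par_mul {d e : ℤ} (hd : d % 2 = 1) : (d*e) % 2 = e % 2 := by
  rw [Int.mul_emod, hd]; omega

theorem irr_odd {q0 q1 q2 q3 : ℤ} (h0 : q0 % 2 = 1) (h1 : q1 % 2 = 0) (h2 : q2 % 2 = 1) (h3 : q3 % 2 = 1) : Irreducible (cq q0 q1 q2 q3) := by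
  have hd := cq_deg q0 q1 q2 q3 (by omega)
  have hne : cq q0 q1 q2 q3 ≠ 0 := by intro h0; rw [h0] at hd; simp at hd
  rw [irreducible_iff_roots_eq_zero_of_degree_le_three (by omega) (by omega)]
  rw [Multiset.eq_zero_iff_forall_notMem]
  intro x hx
  have hx := (mem_roots hne).1 hx
  simp only [cq, IsRoot, eval_add, eval_mul, eval_C, eval_pow, eval_X] at hx
  have hx1 := Rat.num_div_den x
  have hden : (x.den : ℚ) ≠ 0 := by exact_mod_cast x.den_ne_zero
  have e : q0*(x.den : ℤ)^3 + q1*x.num*(x.den : ℤ)^2 + q2*x.num^2*(x.den : ℤ) + q3*x.num^3 = 0 := by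
    have h4 : (q0*(x.den : ℤ)^3 + q1*x.num*(x.den : ℤ)^2 + q2*x.num^2*(x.den : ℤ) + q3*x.num^3 : ℚ) = 0 := by
      have : (x.num : ℚ) = x*x.den := (Rat.mul_den_eq_num x).symm
      rw [this]
      push_cast
      linear_combination (x.den : ℚ)^3*hx
    exact_mod_cast h4
  have hc := x.reduced
  have hnot : ¬ (x.num % 2 = 0 ∧ (x.den : ℤ) % 2 = 0) := by
    rintro ⟨h5, h6⟩
    have : 2 ∣ Nat.gcd x.num.natAbs x.den := Nat.dvd_gcd (by omega) (by omega)
    rw [hc] at this; omega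
  generalize x.num = u at *
  generalize (x.den : ℤ) = w at *
  have e2 := congrArg (· % 2) e
  rcases Int.emod_two_eq_zero_or_one u with hu | hu <;> rcases Int.emod_two_eq_zero_or_one w with hw | hw
  · exact hnot ⟨hu, hw⟩
  all_goals
    simp [Int.add_emod, Int.mul_emod, pow_succ, h0, h1, h2, h3, hu, hw] at e2

section
variable {l0 l1 l2 m0 m1 m2 m3 q0 q1 q2 q3 a0 a1 a2 n : ℤ}
theorem Da.no2 (h : Da l0 l1 l2 m0 m1 m2 m3 q0 q1 q2 q3 a0 a1 a2 n) (h0 : q0 % 2 = 1) (h1 : q1 % 2 = 0) (h2 : q2 % 2 = 1) (h3 : q3 % 2 = 1)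
    (hl0 : l0 % 2 = 1) : False := by
  have hI := irr_odd h0 h1 h2 h3
  have hcop : IsCoprime (cq q0 q1 q2 q3) (cq l0 l1 l2 0) := by
    rw [hI.coprime_iff_not_dvd]
    intro hd
    have hl : cq l0 l1 l2 0 ≠ 0 := by
      intro h4
      have := (cq_coeff l0 l1 l2 0).1
      rw [h4, coeff_zero] at this
      have : l0 = 0 := by exact_mod_cast this.symm
      omega
    have := natDegree_le_of_dvd hd hl
    rw [cq_deg _ _ _ _ (by omega)] at this
    have h5 : (cq l0 l1 l2 0).natDegree ≤ 2 := by
      simp only [cq, Int.cast_zero, C_0, zero_mul, add_zero]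
      compute_degree
    omega
  obtain ⟨y, x, hxy⟩ := hcop
  have hY : cq q0 q1 q2 q3 ∣ (x*(cq l0 l1 l2 0*sz + 2*X^3*cq m0 m1 m2 m3))^2 - gz*hz := by
    refine ⟨x^2*4*X^3*cq a0 a1 a2 n*cq q0 q1 q2 q3 + y*(y*cq q0 q1 q2 q3 - 2)*(gz*hz), ?_⟩
    rw [fz_eq]
    linear_combination (4*x^2*X^3)*h.eq + (sz^2 + 4*X^5*tz)*(x*cq l0 l1 l2 0 + 1 - y*cq q0 q1 q2 q3)*hxy
  obtain ⟨d, e0, e1, e2, e3, hd, he3, rfl, rfl, rfl, rfl, hp⟩ := prim4 q0 q1 q2 q3 h3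
  rw [par_mul hd] at h0 h1 h2 h3
  rw [cq_C] at hY
  exact selz2 e0 e1 e2 e3 h3 h2 h1 h0 hp _ ((Dvd.intro_left _ rfl).trans hY)
end

structure RD (A Q L M : ℚ[X]) : Prop where
  q0 : Q ≠ 0
  dA : A.natDegree = 3
  dM : M.natDegree ≤ 3
  dL : L.natDegree ≤ 2
  M0 : M ≠ 0
  w : Dv (Q^2) ((X^3*M + sz*L : ℚ[X]) + ((X^5*L : ℚ[X]) : PowerSeries ℚ)*VV)
  e : X^3*M^2 + sz*L*M - X^2*tz*L^2 = A*Q^2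
  rA : Rt A
  u : ∀ P : ℚ[X], Dv A P → A ∣ P
  d : ∀ P : ℚ[X], Dv Q P → Q ∣ P
  m : Dv A ((M : PowerSeries ℚ) - PowerSeries.X^2*(L : PowerSeries ℚ)*VV)

theorem coe_inj' {p q : ℚ[X]} (h : (p : PowerSeries ℚ) = q) : p = q := by exact_mod_cast h

section
variable {A Q L M : ℚ[X]}

theorem RD.d2 (h : RD A Q L M) {c P : ℚ[X]} (hc : c ∣ Q^2) (hP : Dv c P) : c ∣ P := by
  obtain ⟨e, he⟩ := hc
  obtain ⟨U, hU, hPU⟩ := hP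
  have hc0 : c*e ≠ 0 := by rw [← he]; exact pow_ne_zero _ h.q0
  have hQ : (Q : PowerSeries ℚ) ≠ 0 := fun h1 => h.q0 (coe_inj' (by rw [h1]; simp))
  have he' : (Q : PowerSeries ℚ)^2 = c*e := by
    have := congrArg (fun q : ℚ[X] => (q : PowerSeries ℚ)) he
    simpa using this
  have h1 : ((e*P : ℚ[X]) : PowerSeries ℚ) = Q*(Q*U) := by
    rw [Polynomial.coe_mul, hPU]; linear_combination (-U)*he'
  obtain ⟨R, hR⟩ := h.d (e*P) ⟨Q*U, (Bdd.poly Q).mul hU, h1⟩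
  have h2 : (R : PowerSeries ℚ) = Q*U := by
    apply mul_left_cancel₀ hQ
    rw [← h1, hR, Polynomial.coe_mul]
  obtain ⟨S, hS⟩ := h.d R ⟨U, hU, h2⟩
  refine ⟨S, ?_⟩
  have he0 : e ≠ 0 := right_ne_zero_of_mul hc0
  apply mul_left_cancel₀ he0
  rw [hR, hS]
  linear_combination S*he

theorem RD.dM' (h : RD A Q L M) {p : ℚ[X]} (hX : IsCoprime p X) (hQ : p ∣ Q^2) (hL : p ∣ L) : p ∣ M := by
  have h1 : Dv p ((X^3*M : ℚ[X]) : PowerSeries ℚ) := by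
    have e : ((X^3*M : ℚ[X]) : PowerSeries ℚ) = (((X^3*M + sz*L : ℚ[X]) + ((X^5*L : ℚ[X]) : PowerSeries ℚ)*VV)) + ((L : ℚ[X]) : PowerSeries ℚ)*(-((sz : ℚ[X]) : PowerSeries ℚ) - ((X^5 : ℚ[X]) : PowerSeries ℚ)*VV) := by
      simp only [Polynomial.coe_add, Polynomial.coe_mul]
      ring
    rw [e]
    refine (h.w.of_dvd hQ).add ((Dv.poly hL).bdd_mul ?_)
    exact (Bdd.poly _).neg.sub ((Bdd.poly _).mul VV_bdd)
  have h2 := h.d2 hQ h1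
  exact (hX.pow_right (n := 3)).dvd_of_dvd_mul_left h2

theorem RD.key (h : RD A Q L M) {p : ℚ[X]} (hp : Prime p) (hX : IsCoprime p X) {k j : ℕ} (hk : p^k ∣ Q) {L1 : ℚ[X]} (hL : L = p^j*L1)
    (hL1 : ¬ p ∣ L1) (hj : j ≤ k) : Rt (p^k) := by
  obtain ⟨M1, hM⟩ := h.dM' (p := p^j) hX.pow_left ((pow_dvd_pow p hj).trans (hk.trans (Dvd.intro_left Q (pow_two Q).symm))) ⟨L1, hL⟩
  obtain ⟨R, hR⟩ := hk
  obtain ⟨U, hU, e⟩ := h.w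
  have hcop : IsCoprime (X^5*L1) (p^k) := by
    refine IsCoprime.pow_right (IsCoprime.symm (IsCoprime.mul_right hX.pow_right ?_))
    exact (hp.irreducible.coprime_iff_not_dvd).2 hL1
  refine Rt.lin (b := X^5*L1) (c := X^3*M1 + sz*L1) hcop ?_
  refine ⟨((p^(k - j)*R^2 : ℚ[X]) : PowerSeries ℚ)*U, (Bdd.poly _).mul hU, ?_⟩
  have hpj : ((p^j : ℚ[X]) : PowerSeries ℚ) ≠ 0 := fun h1 => pow_ne_zero j hp.ne_zero (coe_inj' (by rw [h1]; simp))
  apply mul_left_cancel₀ hpj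
  have e1 : p^k = p^j*p^(k - j) := by rw [← pow_add]; congr 1; omega
  subst hL hM hR
  have e1' := congrArg (fun q : ℚ[X] => (q : PowerSeries ℚ)) e1
  simp only [Polynomial.coe_add, Polynomial.coe_mul, Polynomial.coe_pow] at e e1' ⊢
  linear_combination e + ((p : PowerSeries ℚ)^k*(R : PowerSeries ℚ)^2*U)*e1'

theorem Rt.unit {p : ℚ[X]} (hp : IsUnit p) : Rt p := by
  refine Rt.of_dvd hp.dvd (r := 1) ?_
  have := Rt.X_pow 0
  simpa using this

theorem RD.rt (h : RD A Q L M) : Rt Q := by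
  suffices hh : ∀ x, x ∣ Q → Rt x from hh Q dvd_rfl
  intro x
  induction x using UniqueFactorizationMonoid.induction_on_coprime with
  | h0 => intro h1; exact absurd (zero_dvd_iff.1 h1) h.q0
  | h1 hx => intro _; exact Rt.unit hx
  | hcp hxy ih1 ih2 => intro h1; exact Rt.cop hxy.isCoprime (ih1 (dvd_of_mul_right_dvd h1)) (ih2 (dvd_of_mul_left_dvd h1))
  | @hpr p k hp =>
    intro hk
    by_cases hX : p ∣ X
    · exact Rt.of_dvd (pow_dvd_pow_of_dvd hX k) (Rt.X_pow k)
    have hX : IsCoprime p X := (hp.irreducible.coprime_iff_not_dvd).2 hX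
    have hA0 : A ≠ 0 := by have := h.dA; rintro rfl; simp at this
    by_cases hL : L = 0
    · have h1 := h.u M (by simpa [hL] using h.m)
      obtain ⟨κ, hκ⟩ := h1
      have hκ0 : κ ≠ 0 := by rintro rfl; exact h.M0 (by rw [hκ, mul_zero])
      have hd := h.dM
      rw [hκ, natDegree_mul hA0 hκ0, h.dA] at hd
      have hκd : κ.natDegree = 0 := by omega
      rw [eq_C_of_natDegree_eq_zero hκd] at hκ hκ0
      have hc0 : κ.coeff 0 ≠ 0 := by intro h1; apply hκ0; rw [h1, C_0]
      have e := h.e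
      rw [hL, hκ] at e
      have e1 : Q^2 = X^3*(C (κ.coeff 0)^2*A) := by
        apply mul_left_cancel₀ hA0
        linear_combination -e
      have h2 : p^k ∣ X^3*(C (κ.coeff 0)^2*A) := by rw [← e1]; exact hk.trans (Dvd.intro_left Q (pow_two Q).symm)
      have h3 : p^k ∣ C (κ.coeff 0)^2*A := (IsCoprime.pow hX).dvd_of_dvd_mul_left h2
      have hu : IsUnit (C (κ.coeff 0)^2) := (isUnit_C.2 (isUnit_iff_ne_zero.2 hc0)).pow 2
      exact Rt.of_dvd ((hu.dvd_mul_left).1 h3) h.rA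
    obtain ⟨j, L1, hL1, hLe⟩ := WfDvdMonoid.max_power_factor hL hp.irreducible
    by_cases hj : j ≤ k
    · exact h.key hp hX hk hLe hL1 hj
    push Not at hj
    rcases Nat.eq_zero_or_pos k with rfl | hkp
    · exact Rt.unit (by simp)
    have hpd : 1 ≤ p.natDegree := hp.irreducible.natDegree_pos
    have hjd : j*p.natDegree ≤ 2 := by
      rw [← natDegree_pow]
      exact (natDegree_le_of_dvd ⟨L1, hLe⟩ hL).trans h.dL
    have hj2 : j = 2 := by nlinarith
    have hk1 : k = 1 := by omega
    subst hj2 hk1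
    rw [pow_one] at hk ⊢
    by_cases hq2 : p^2 ∣ Q
    · exact Rt.of_dvd (Dvd.intro _ (pow_two p).symm) (h.key hp hX hq2 hLe hL1 le_rfl)
    have hM := h.dM' (p := p^2) hX.pow_left (pow_dvd_pow_of_dvd hk 2) ⟨L1, hLe⟩
    obtain ⟨M1, hM⟩ := hM
    obtain ⟨R, hR⟩ := hk
    have e1 : p^2*(X^3*M1^2 + sz*L1*M1 - X^2*tz*L1^2) = A*R^2 := by
      have e := h.e
      rw [hM, hLe, hR] at e
      apply mul_left_cancel₀ (pow_ne_zero 2 hp.ne_zero)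
      linear_combination e
    have h4 : p ∣ A*R^2 := by rw [← e1]; exact (Dvd.intro _ (pow_two p).symm).mul_right _
    rcases hp.dvd_or_dvd h4 with h5 | h5
    · exact Rt.of_dvd h5 h.rA
    · have := hp.dvd_of_dvd_pow h5
      exact absurd (by rw [hR, pow_two]; exact mul_dvd_mul_left p this) hq2
end

section
variable {l0 l1 l2 m0 m1 m2 m3 q0 q1 q2 q3 a0 a1 a2 n : ℤ}

theorem cq_ne {a0 a1 a2 n : ℤ} (h : n ≠ 0) : cq a0 a1 a2 n ≠ 0 := by
  intro h0
  have := cq_deg a0 a1 a2 n h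
  rw [h0] at this; simp at this

theorem Da.rd (h : Da l0 l1 l2 m0 m1 m2 m3 q0 q1 q2 q3 a0 a1 a2 n) (hS : Sh a0 a1 a2 n) (hR : Rt (cq a0 a1 a2 n)) (hm : m3 % 2 = 1)
    (hl0 : l0 % 2 = 0) (hl1 : l1 % 2 = 0) (hq : Sh q0 q1 q2 q3) :
    RD (cq a0 a1 a2 n) (cq q0 q1 q2 q3) (cq l0 l1 l2 0) (cq m0 m1 m2 m3) := by
  refine ⟨cq_ne hq.ne, cq_deg _ _ _ _ hS.ne, cq_deg_le _ _ _ _, ?_, cq_ne (by omega), ?_, h.eq, hR, fun P hP => hS.Dv hP, fun P hP => hq.Dv hP, h.dv⟩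
  · simp only [cq, Int.cast_zero, C_0, zero_mul, add_zero]
    compute_degree
  obtain ⟨U, hU, e⟩ := h.U hS
  have hU0 : padicNorm 2 (PowerSeries.coeff 0 U) = 1 := by
    refine le_antisymm (hU 0) ?_
    by_contra! hlt
    have e' : (cq m0 m1 m2 m3 : PowerSeries ℚ) - PowerSeries.X^2*((cq l0 l1 l2 0 : PowerSeries ℚ)*VV) = (cq a0 a1 a2 n : PowerSeries ℚ)*U := by
      rw [← e]; ring
    have t := congrArg (PowerSeries.coeff (0 + 3)) e'
    rw [cq_mul_coeff, map_sub, Polynomial.coeff_coe, PowerSeries.coeff_X_pow_mul', if_pos (by norm_num), show 0 + 3 - 2 = 1 from rfl, cm1,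
      Polynomial.coeff_coe, Polynomial.coeff_coe, (cq_coeff l0 l1 l2 0).1, (cq_coeff l0 l1 l2 0).2.1, show 0 + 3 = 3 from rfl, (cq_coeff m0 m1 m2 m3).2.2.2] at t
    have t' : (m3 : ℚ) = n*PowerSeries.coeff 0 U + (a2*PowerSeries.coeff (0 + 1) U + a1*PowerSeries.coeff (0 + 2) U + a0*PowerSeries.coeff (0 + 3) U
       + l0*PowerSeries.coeff 1 VV + l1*PowerSeries.coeff 0 VV) := by linear_combination t
    have key : ∀ {a : ℤ} {w : PowerSeries ℚ} (i : ℕ), a % 2 = 0 → Bd 1 w → padicNorm 2 (a*PowerSeries.coeff i w) < 1 := by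
      intro a w i ha hw
      rw [padicNorm.mul]
      have h1 := int_even ha
      have h2 := hw i
      have : padicNorm 2 (a : ℚ)*padicNorm 2 (PowerSeries.coeff i w) ≤ 1 / 2*1 := mul_le_mul h1 h2 (padicNorm.nonneg _) (by norm_num)
      linarith
    have kadd : ∀ {x y : ℚ}, padicNorm 2 x < 1 → padicNorm 2 y < 1 → padicNorm 2 (x + y) < 1 :=
      fun hx hy => lt_of_le_of_lt padicNorm.nonarchimedean (max_lt hx hy)
    have h1 : padicNorm 2 (m3 : ℚ) < 1 := by
      rw [t']
      refine kadd ?_ (kadd (kadd (kadd (kadd (key _ hS.h2 hU) (key _ hS.h1 hU)) (key _ hS.h0 hU)) (key _ hl0 VV_bd)) (key _ hl1 VV_bd))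
      rw [padicNorm.mul, int_odd hS.hn, one_mul]; exact hlt
    rw [int_odd hm] at h1
    exact lt_irrefl _ h1
  have hUi := hU.inv hU0
  have hUc : PowerSeries.constantCoeff U ≠ 0 := by
    intro h1
    rw [PowerSeries.coeff_zero_eq_constantCoeff_apply, h1] at hU0; simp at hU0
  have hA : (cq a0 a1 a2 n : PowerSeries ℚ) ≠ 0 := fun h1 => cq_ne (a0 := a0) (a1 := a1) (a2 := a2) hS.ne (coe_inj' (by rw [h1]; simp))
  refine ⟨U⁻¹, ⟨1, hUi⟩, ?_⟩
  have h1 := PowerSeries.mul_inv_cancel U hUc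
  have h2 := congrArg (fun q : ℚ[X] => (q : PowerSeries ℚ)) h.eq
  have h3 := VV_eq
  simp only [Polynomial.coe_add, Polynomial.coe_sub, Polynomial.coe_mul, Polynomial.coe_pow, Polynomial.coe_X] at h2 ⊢
  generalize (cq m0 m1 m2 m3 : PowerSeries ℚ) = M at *
  generalize (cq l0 l1 l2 0 : PowerSeries ℚ) = L at *
  generalize (cq a0 a1 a2 n : PowerSeries ℚ) = A at *
  generalize (cq q0 q1 q2 q3 : PowerSeries ℚ) = Q at *
  have h4 : U*(PowerSeries.X^3*M + (sz : PowerSeries ℚ)*L + PowerSeries.X^5*L*VV) = Q^2 := by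
    apply mul_left_cancel₀ hA
    linear_combination h2 - (PowerSeries.X^3*M + (sz : PowerSeries ℚ)*L + PowerSeries.X^5*L*VV)*e - PowerSeries.X^2*L^2*h3
  linear_combination U⁻¹*h4 - (PowerSeries.X^3*M + (sz : PowerSeries ℚ)*L + PowerSeries.X^5*L*VV)*h1
end

theorem St.step {a0 a1 a2 n : ℤ} (h : St a0 a1 a2 n) : ∃ e0 e1 e2 e3 : ℤ, St e0 e1 e2 e3 ∧ ∀ k : ℕ,
    ((2 : ℤ)^k ∣ e0 ∧ (2 : ℤ)^k ∣ e1 ∧ (2 : ℤ)^k ∣ e2) → ((2 : ℤ)^(k + 1) ∣ a0 ∧ (2 : ℤ)^(k + 1) ∣ a1 ∧ (2 : ℤ)^(k + 1) ∣ a2) := by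
  obtain ⟨l0, l1, l2, m0, m1, m2, m3, q0, q1, q2, q3, hd⟩ := h.data
  have h0 := h.h0
  have h1 := h.h1
  have h2 := h.h2
  have hm := hd.mdiv h.sh (j := 1) (by simp) (by omega) (by omega) (by omega)
  rw [pow_one] at hm
  have hne := hd.ne
  obtain ⟨hm3, hq3, hq1, hc⟩ := (Eqs.mk' hd.eq).mod2 h.sh (by omega) (by omega) (by omega) (by omega)
  rcases hc with ⟨hl0, hl1, hl2, hq0, hq2⟩ | ⟨hl0, hl1, hl2, hq0, hq2⟩
  swap
  · exact (hd.no2 hq0 hq1 hq2 hq3 hl0).elim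
  have hr := (hd.rd h.sh h.rt hm3 hl0 hl1 ⟨hq3, hq2, hq1, hq0⟩).rt
  have hdbl := fun k => hd.dbl h.sh hm3 hq3 hl0 hl1 hl2 (k := k)
  obtain ⟨d, e0, e1, e2, e3, hdd, he3, rfl, rfl, rfl, rfl, hp⟩ := prim4 q0 q1 q2 q3 hq3
  rw [par_mul hdd] at hq0 hq1 hq2
  rw [cq_C] at hr
  refine ⟨e0, e1, e2, e3, ⟨he3, hq2, hq1, hq0, hp, hr.of_dvd (Dvd.intro_left _ rfl)⟩, ?_⟩
  rintro k ⟨g0, g1, g2⟩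
  exact (hdbl k (g0.mul_left _) (g1.mul_left _) (g2.mul_left _) k le_rfl).2

theorem St.pow (k : ℕ) : ∀ {a0 a1 a2 n : ℤ}, St a0 a1 a2 n → ((2 : ℤ)^k ∣ a0 ∧ (2 : ℤ)^k ∣ a1 ∧ (2 : ℤ)^k ∣ a2) := by
  induction k with
  | zero => intros; simp
  | succ k ih =>
    intro a0 a1 a2 n h
    obtain ⟨e0, e1, e2, e3, he, hk⟩ := h.step
    exact hk k (ih he)

theorem zero_of_pow {a : ℤ} (h : ∀ k : ℕ, (2 : ℤ)^k ∣ a) : a = 0 := by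
  by_contra h0
  have h1 := Int.le_of_dvd (abs_pos.2 h0) ((dvd_abs _ _).2 (h a.natAbs))
  have h2 : a.natAbs < 2^a.natAbs := Nat.lt_two_pow_self
  have h3 : ((a.natAbs : ℕ) : ℤ) < 2^a.natAbs := by exact_mod_cast h2
  rw [Int.natCast_natAbs] at h3
  omega

theorem seed {b0 b1 b2 b3 : ℤ} (hS : Sh b0 b1 b2 b3) (hr : Rt (cq b0 b1 b2 b3)) : b0 = 0 ∧ b2 = 0 := by
  obtain ⟨d, e0, e1, e2, e3, hdd, he3, rfl, rfl, rfl, rfl, hp⟩ := prim4 b0 b1 b2 b3 hS.hn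
  have h2 := hS.h2
  have h1 := hS.h1
  have h0 := hS.h0
  rw [par_mul hdd] at h0 h1 h2
  rw [cq_C] at hr
  have h : St e0 e1 e2 e3 := ⟨he3, h2, h1, h0, hp, hr.of_dvd (Dvd.intro_left _ rfl)⟩
  rw [zero_of_pow fun k => (h.pow k).1, zero_of_pow fun k => (h.pow k).2.2]
  simp

theorem Bd.Cc {a : ℚ} (h : padicNorm 2 a ≤ 1) : Bd 1 (PowerSeries.C a : PowerSeries ℚ) := fun k => by
  rw [PowerSeries.coeff_C]
  split_ifs
  · exact h
  · simp

theorem Bd.Xp (k : ℕ) : Bd 1 (PowerSeries.X^k : PowerSeries ℚ) := fun i => by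
  rw [PowerSeries.coeff_X_pow]
  split_ifs <;> simp

theorem Bd.sz : Bd 1 (sz : PowerSeries ℚ) := by
  have := Bd.intpoly sZ
  rwa [sZ_map] at this

theorem sz_0 : PowerSeries.constantCoeff (sz : PowerSeries ℚ) = 1 := by
  simp [_root_.sz]

theorem rt_of_root {x v0 : ℚ} (hv : padicNorm 2 v0 ≤ 1)
    (h : x^5*v0^2 + (1 + x - 6*x^2 + 7*x^3 + x^4)*v0 - (2 + 4*x - 9*x^2 + x^3) = 0) : Rt (X - C x) := by
  have hd : (X - C x) ∣ (X^5*C v0^2 + sz*C v0 - tz : ℚ[X]) := by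
    rw [dvd_iff_isRoot]
    simp only [IsRoot, sz, tz, eval_add, eval_sub, eval_mul, eval_pow, eval_X, eval_C, eval_one, eval_ofNat]
    exact h
  obtain ⟨p, hp⟩ := hd
  have hG : Bd 1 ((sz : PowerSeries ℚ) + PowerSeries.X^5*(PowerSeries.C v0 + VV)) :=
    Bd.sz.add ((Bd.Xp 5).mul1 ((Bd.Cc hv).add VV_bd))
  have hG0 : PowerSeries.constantCoeff ((sz : PowerSeries ℚ) + PowerSeries.X^5*(PowerSeries.C v0 + VV)) = 1 := by
    rw [map_add, sz_0]; simp
  generalize hGd : ((sz : PowerSeries ℚ) + PowerSeries.X^5*(PowerSeries.C v0 + VV)) = G at *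
  have hGi := hG.inv (by rw [PowerSeries.coeff_zero_eq_constantCoeff_apply, hG0]; simp)
  have h1 := PowerSeries.mul_inv_cancel G (by rw [hG0]; simp)
  have h2 := congrArg (fun q : ℚ[X] => (q : PowerSeries ℚ)) hp
  have h3 := VV_eq
  refine ⟨C v0, -(p : PowerSeries ℚ)*G⁻¹, (Bdd.poly p).neg.mul ⟨1, hGi⟩, ?_⟩
  simp only [Polynomial.coe_add, Polynomial.coe_sub, Polynomial.coe_mul, Polynomial.coe_pow, Polynomial.coe_X, Polynomial.coe_C] at h2 ⊢
  have h4 : (VV - PowerSeries.C v0)*G = -((PowerSeries.X - PowerSeries.C x)*(p : PowerSeries ℚ)) := by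
    rw [← h2, ← hGd]; linear_combination h3
  linear_combination G⁻¹*h4 - (VV - PowerSeries.C v0)*h1

theorem podd {a : ℤ} (n : ℕ) (h : a % 2 = 1) : a^n % 2 = 1 := Int.odd_iff.1 ((Int.odd_iff.2 h).pow)

theorem seed1 {A Z w : ℤ} (hA : A % 2 = 0) (hZ : Z % 2 = 1) (hw : w % 2 = 1) (hA0 : A ≠ 0)
    (h : w^2 = w*(Z^4 + A*Z^3 - 6*A^2*Z^2 + 7*A^3*Z + A^4)
      + A^5*(2*Z^3 + 4*A*Z^2 - 9*A^2*Z + A^3)) : False := by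
  have hZ0 : (Z : ℚ) ≠ 0 := by have : Z ≠ 0 := by omega
                               exact_mod_cast this
  have hw0 : (w : ℚ) ≠ 0 := by have : w ≠ 0 := by omega
                               exact_mod_cast this
  have hA0' : (A : ℚ) ≠ 0 := by exact_mod_cast hA0
  have hq : (w : ℚ)^2 = w*(Z^4 + A*Z^3 - 6*A^2*Z^2 + 7*A^3*Z + A^4)
      + A^5*(2*Z^3 + 4*A*Z^2 - 9*A^2*Z + A^3) := by exact_mod_cast h
  have hr := rt_of_root (x := (A : ℚ) / Z) (v0 := (((2*Z^3 + 4*A*Z^2 - 9*A^2*Z + A^3)*Z : ℤ) : ℚ) / (w : ℚ)) (by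
      rw [padicNorm.div, int_odd hw, div_one]; exact padicNorm.of_int _) (by
      push_cast
      field_simp
      linear_combination (-(2*Z^3 + 4*A*Z^2 - 9*A^2*Z + A^3 : ℚ))*hq)
  have hc : IsCoprime (X^2 : ℚ[X]) (X - C ((A : ℚ) / Z)) := by
    apply IsCoprime.pow_left
    refine ⟨C (Z / A : ℚ), -C (Z / A : ℚ), ?_⟩
    have : (C (Z / A : ℚ)*C ((A : ℚ) / Z) : ℚ[X]) = 1 := by
      rw [← C_mul, ← C_1]; congr 1; field_simp
    linear_combination this
  have h2 := (Rt.X_pow 2).cop hc hr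
  have e : cq 0 0 (-A) Z = C (Z : ℚ)*(X^2*(X - C ((A : ℚ) / Z))) := by
    have : (C (Z : ℚ)*C ((A : ℚ) / Z) : ℚ[X]) = C (A : ℚ) := by
      rw [← C_mul]; congr 1; field_simp
    simp only [cq, Int.cast_zero, Int.cast_neg, C_0, C_neg]
    linear_combination X^2*this
  have h3 : Rt (cq 0 0 (-A) Z) := by
    refine h2.of_dvd ?_
    rw [e]
    refine ⟨C ((Z : ℚ)⁻¹), ?_⟩
    have : (C (Z : ℚ)*C ((Z : ℚ)⁻¹) : ℚ[X]) = 1 := by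
      rw [← C_mul, ← C_1]; congr 1; field_simp
    linear_combination (-(X^2*(X - C ((A : ℚ) / Z))))*this
  have h4 := seed ⟨hZ, by omega, by omega, by omega⟩ h3
  omega

theorem seed2 {A Z c : ℤ} (hA : A % 2 = 1) (hZ : Z % 2 = 1) (hc0 : c ≠ 0)
    (h : 4*c^2 + 2*c*(Z^4 + A*Z^3 - 6*A^2*Z^2 + 7*A^3*Z + A^4)
      = A^5*(2*Z^3 + 4*A*Z^2 - 9*A^2*Z + A^3)) : False := by
  have hA0 : A ≠ 0 := by omega
  have hA0' : (A : ℚ) ≠ 0 := by exact_mod_cast hA0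
  have hq : 4*(c : ℚ)^2 + 2*c*(Z^4 + A*Z^3 - 6*A^2*Z^2 + 7*A^3*Z + A^4)
      = A^5*(2*Z^3 + 4*A*Z^2 - 9*A^2*Z + A^3) := by exact_mod_cast h
  obtain ⟨b0, hb0⟩ : ∃ b, b = 2*c*A^3 := ⟨_, rfl⟩
  obtain ⟨b1, hb1⟩ : ∃ b, b = A^2*(2*c*Z + 2*c*A - 2*A^5) := ⟨_, rfl⟩
  obtain ⟨b2, hb2⟩ : ∃ b, b = A*(Z*(2*c*Z + 2*c*A - 2*A^5) - 12*c*A^2 - 4*A^6) := ⟨_, rfl⟩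
  obtain ⟨b3, hb3⟩ : ∃ b, b = Z*(Z*(2*c*Z + 2*c*A - 2*A^5) - 12*c*A^2 - 4*A^6) + 14*c*A^3 + 9*A^7 := ⟨_, rfl⟩
  have hS : Sh b0 b1 b2 b3 := by
    refine ⟨?_, ?_, ?_, ?_⟩
    · have h7 : A^7 % 2 = 1 := podd _ hA
      have : b3 = 2*(Z*(Z*(c*Z + c*A - A^5) - 6*c*A^2 - 2*A^6) + 7*c*A^3 + 4*A^7) + A^7 := by rw [hb3]; ring
      omega
    · have : b2 = 2*(A*(Z*(c*Z + c*A - A^5) - 6*c*A^2 - 2*A^6)) := by rw [hb2]; ring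
      omega
    · have : b1 = 2*(A^2*(c*Z + c*A - A^5)) := by rw [hb1]; ring
      omega
    · have : b0 = 2*(c*A^3) := by rw [hb0]; ring
      omega
  have hb00 : b0 ≠ 0 := by rw [hb0]; positivity
  obtain ⟨w, hw⟩ : ∃ w : ℚ, w = 2*c / A^4 := ⟨_, rfl⟩
  have hwn : padicNorm 2 w ≤ 1 := by
    have h4 : A^4 % 2 = 1 := podd _ hA
    have : w = ((2*c : ℤ) : ℚ) / ((A^4 : ℤ) : ℚ) := by rw [hw]; push_cast; ring
    rw [this, padicNorm.div, int_odd h4, div_one]; exact padicNorm.of_int _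
  have hp : C ((A : ℚ)^7)*(C w*sz + X^4*C w^2 - X*tz) = cq b0 b1 b2 b3*(1 - C ((Z : ℚ) / A)*X) := by
    have e1 : (C ((A : ℚ)^7)*C w : ℚ[X]) = C (2*c*A^3 : ℚ) := by
      rw [← C_mul]; congr 1; rw [hw]; field_simp
    have e2 : (C (A : ℚ)*C ((Z : ℚ) / A) : ℚ[X]) = C (Z : ℚ) := by
      rw [← C_mul]; congr 1; field_simp
    have e3 : (C (b3 : ℚ)*C ((Z : ℚ) / A) : ℚ[X]) = -(C ((A : ℚ)^7)*C w^2 + C (2*c*A^3 : ℚ) - C ((A : ℚ)^7)) := by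
      simp only [← C_mul, ← C_pow, ← C_add, ← C_sub, ← C_neg]
      congr 1
      rw [hw, hb3]; push_cast; field_simp
      linear_combination hq
    have k0 : (b0 : ℚ) = 2*c*A^3 := by rw [hb0]; push_cast; ring
    have k1 : (C (b1 : ℚ) : ℚ[X]) = C (b0 : ℚ)*C ((Z : ℚ) / A) + C (2*c*A^3 - 2*A^7 : ℚ) := by
      rw [← C_mul, ← C_add]; congr 1; rw [hb1, hb0]; push_cast; field_simp; ring
    have k2 : (C (b2 : ℚ) : ℚ[X]) = C (b1 : ℚ)*C ((Z : ℚ) / A) + C (-12*c*A^3 - 4*A^7 : ℚ) := by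
      rw [← C_mul, ← C_add]; congr 1; rw [hb2, hb1]; push_cast; field_simp; ring
    have k3 : (C (b3 : ℚ) : ℚ[X]) = C (b2 : ℚ)*C ((Z : ℚ) / A) + C (14*c*A^3 + 9*A^7 : ℚ) := by
      rw [← C_mul, ← C_add]; congr 1; rw [hb3, hb2]; push_cast; field_simp; ring
    have k0' : (C (b0 : ℚ) : ℚ[X]) = C (2*c*A^3 : ℚ) := by rw [k0]
    simp only [C_add, C_sub, C_mul, C_pow, C_neg] at e1 e3 k1 k2 k3 k0' ⊢
    simp only [cq, sz, tz]
    simp only [show (C (2 : ℚ) : ℚ[X]) = 2 from rfl, show (C (12 : ℚ) : ℚ[X]) = 12 from rfl, show (C (4 : ℚ) : ℚ[X]) = 4 from rfl, show (C (14 : ℚ) : ℚ[X]) = 14 from rfl, show (C (9 : ℚ) : ℚ[X]) = 9 from rfl] at e1 e3 k1 k2 k3 k0' ⊢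
    linear_combination (1 + X - 6*X^2 + 7*X^3 + X^4)*e1 - k0' - X*k1 - X^2*k2 - X^3*k3 + X^4*e3
  have hG : Bd 1 ((sz : PowerSeries ℚ) + PowerSeries.X^4*(PowerSeries.C w + PowerSeries.X^1*VV)) :=
    Bd.sz.add ((Bd.Xp 4).mul1 ((Bd.Cc hwn).add ((Bd.Xp 1).mul1 VV_bd)))
  have hG0 : PowerSeries.constantCoeff ((sz : PowerSeries ℚ) + PowerSeries.X^4*(PowerSeries.C w + PowerSeries.X^1*VV)) = 1 := by
    rw [map_add, sz_0]; simp
  generalize hGd : ((sz : PowerSeries ℚ) + PowerSeries.X^4*(PowerSeries.C w + PowerSeries.X^1*VV)) = G at *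
  have hGi := hG.inv (by rw [PowerSeries.coeff_zero_eq_constantCoeff_apply, hG0]; simp)
  have h1 := PowerSeries.mul_inv_cancel G (by rw [hG0]; simp)
  have h2 := congrArg (fun q : ℚ[X] => (q : PowerSeries ℚ)) hp
  have h3 := VV_eq
  have hD : Dv (cq b0 b1 b2 b3) (((-X : ℚ[X]) : PowerSeries ℚ)*VV + ((C w : ℚ[X]) : PowerSeries ℚ)) := by
    refine ⟨((C (((A : ℚ)^7)⁻¹)*(1 - C ((Z : ℚ) / A)*X) : ℚ[X]) : PowerSeries ℚ)*G⁻¹, (Bdd.poly _).mul ⟨1, hGi⟩, ?_⟩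
    have e : (PowerSeries.C (((A : ℚ)^7)⁻¹)*PowerSeries.C ((A : ℚ)^7) : PowerSeries ℚ) = 1 := by
      rw [← map_mul, ← map_one PowerSeries.C]; congr 1; field_simp
    simp only [Polynomial.coe_add, Polynomial.coe_sub, Polynomial.coe_mul, Polynomial.coe_pow, Polynomial.coe_X, Polynomial.coe_C, Polynomial.coe_neg, Polynomial.coe_one] at h2 ⊢
    generalize (PowerSeries.C (((A : ℚ)^7)⁻¹) : PowerSeries ℚ) = ai at *
    generalize (PowerSeries.C ((A : ℚ)^7) : PowerSeries ℚ) = aa at *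
    have h4 : (-PowerSeries.X*VV + PowerSeries.C w)*G = ai*(aa*(PowerSeries.C w*(sz : PowerSeries ℚ) + PowerSeries.X^4*PowerSeries.C w^2 - PowerSeries.X*(tz : PowerSeries ℚ))) := by
      rw [← mul_assoc, e, ← hGd]; linear_combination (-PowerSeries.X)*h3
    rw [h2] at h4
    linear_combination G⁻¹*h4 - (-PowerSeries.X*VV + PowerSeries.C w)*h1
  have hcop : IsCoprime (-X : ℚ[X]) (cq b0 b1 b2 b3) := by
    rw [IsCoprime.neg_left_iff]
    refine (irreducible_X.coprime_iff_not_dvd).2 ?_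
    rw [X_dvd_iff, (cq_coeff b0 b1 b2 b3).1]
    exact_mod_cast hb00
  exact hb00 (seed hS (Rt.lin hcop hD)).1

theorem final (x y : ℚ) (h : y^2 = 5*x^8 - 22*x^7 + 53*x^6 - 74*x^5 + 52*x^4 + 2*x^3 - 11*x^2 + 2*x + 1) : x = 0 := by
  by_contra hx
  obtain ⟨A, hAd⟩ : ∃ A : ℤ, A = x.num := ⟨_, rfl⟩
  obtain ⟨Z, hZd⟩ : ∃ Z : ℤ, Z = x.den := ⟨_, rfl⟩
  have hcop : IsCoprime A Z := by
    rw [hAd, hZd]; exact Rat.isCoprime_num_den x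
  have hA0 : A ≠ 0 := by rw [hAd]; exact Rat.num_ne_zero.2 hx
  have hZ0 : (Z : ℚ) ≠ 0 := by rw [hZd]; exact_mod_cast x.den_nz
  have hxe : x = (A : ℚ) / Z := by rw [hAd, hZd]; exact_mod_cast (Rat.num_div_den x).symm
  obtain ⟨Y, hY⟩ : ∃ Y : ℤ, (Y : ℚ) = y*Z^4 := by
    have hi : IsIntegral ℤ (y*(Z : ℚ)^4) := by
      apply IsIntegral.of_pow (n := 2) (by norm_num)
      have : (y*(Z : ℚ)^4)^2 = algebraMap ℤ ℚ (5*A^8 - 22*A^7*Z + 53*A^6*Z^2 - 74*A^5*Z^3 + 52*A^4*Z^4 + 2*A^3*Z^5 - 11*A^2*Z^6 + 2*A*Z^7 + Z^8) := by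
        rw [mul_pow, h, hxe]; simp only [algebraMap_int_eq, eq_intCast]; push_cast; field_simp
      rw [this]; exact isIntegral_algebraMap
    obtain ⟨Y, hY⟩ := IsIntegrallyClosed.isIntegral_iff.1 hi
    exact ⟨Y, by simpa using hY⟩
  have hE : Y^2 = 5*A^8 - 22*A^7*Z + 53*A^6*Z^2 - 74*A^5*Z^3 + 52*A^4*Z^4 + 2*A^3*Z^5 - 11*A^2*Z^6 + 2*A*Z^7 + Z^8 := by
    have : (Y : ℚ)^2 = 5*A^8 - 22*A^7*Z + 53*A^6*Z^2 - 74*A^5*Z^3 + 52*A^4*Z^4 + 2*A^3*Z^5 - 11*A^2*Z^6 + 2*A*Z^7 + Z^8 := by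
      rw [hY, mul_pow, h, hxe]; field_simp
    exact_mod_cast this
  obtain ⟨S, hS⟩ : ∃ S, S = Z^4 + A*Z^3 - 6*A^2*Z^2 + 7*A^3*Z + A^4 := ⟨_, rfl⟩
  obtain ⟨T, hT⟩ : ∃ T, T = 2*Z^3 + 4*A*Z^2 - 9*A^2*Z + A^3 := ⟨_, rfl⟩
  have hE2 : Y^2 = S^2 + 4*A^5*T := by rw [hE, hS, hT]; ring
  rcases Int.emod_two_eq_zero_or_one Z with hZ | hZ
  · have hA : A % 2 = 1 := by
      by_contra h1
      obtain ⟨u, v, huv⟩ := hcop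
      have a : (2 : ℤ) ∣ A := by omega
      have b : (2 : ℤ) ∣ Z := by omega
      have := dvd_add (a.mul_left u) (b.mul_left v)
      rw [huv] at this; omega
    obtain ⟨z, rfl⟩ : (2 : ℤ) ∣ Z := by omega
    have hm := congrArg (fun n : ℤ => (n : ZMod 8)) hE
    push_cast at hm
    have hA2 : ((A : ZMod 8) = 1 ∨ (A : ZMod 8) = 3 ∨ (A : ZMod 8) = 5 ∨ (A : ZMod 8) = 7) := by
      have : A % 8 = 1 ∨ A % 8 = 3 ∨ A % 8 = 5 ∨ A % 8 = 7 := by omega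
      rcases this with h1 | h1 | h1 | h1
      · left; exact_mod_cast (ZMod.intCast_eq_intCast_iff' A 1 8).2 (by omega)
      · right; left; exact_mod_cast (ZMod.intCast_eq_intCast_iff' A 3 8).2 (by omega)
      · right; right; left; exact_mod_cast (ZMod.intCast_eq_intCast_iff' A 5 8).2 (by omega)
      · right; right; right; exact_mod_cast (ZMod.intCast_eq_intCast_iff' A 7 8).2 (by omega)
    generalize (A : ZMod 8) = a at *
    generalize (Y : ZMod 8) = b at *
    generalize (z : ZMod 8) = c at *
    revert a b c
    decide +kernel
  rcases Int.emod_two_eq_zero_or_one A with hA | hA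
  · have hSo : S % 2 = 1 := by
      obtain ⟨a, rfl⟩ : (2 : ℤ) ∣ A := by omega
      have h7 : Z^4 % 2 = 1 := podd _ hZ
      have : S = 2*(a*Z^3 - 12*a^2*Z^2 + 28*a^3*Z + 8*a^4) + Z^4 := by rw [hS]; ring
      omega
    have hYo : Y % 2 = 1 := by
      have h1 : Y^2 % 2 = 1 := by
        have h7 : S^2 % 2 = 1 := podd _ hSo
        rw [hE2]; generalize A^5 = q; rw [mul_assoc]; omega
      exact Int.odd_iff.1 ((Int.odd_pow' (by norm_num)).1 (Int.odd_iff.2 h1))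
    have : ∃ w, w % 2 = 1 ∧ (Y = 2*w - S ∨ Y = S - 2*w) := by
      have : (Y + S) % 4 = 2 ∨ (S - Y) % 4 = 2 := by omega
      rcases this with h1 | h1
      · exact ⟨(Y + S) / 2, by omega, by omega⟩
      · exact ⟨(S - Y) / 2, by omega, by omega⟩
    obtain ⟨w, hw, hwY⟩ := this
    refine seed1 hA hZ hw hA0 ?_
    rw [← hS, ← hT]
    rcases hwY with rfl | rfl
    · have : 4*(w^2) = 4*(w*S + A^5*T) := by linear_combination hE2
      omega
    · have : 4*(w^2) = 4*(w*S + A^5*T) := by linear_combination hE2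
      omega
  · obtain ⟨a, ha⟩ : ∃ a, A = 2*a + 1 := ⟨A / 2, by omega⟩
    obtain ⟨b, hb⟩ : ∃ b, Z = 2*b + 1 := ⟨Z / 2, by omega⟩
    have hSe : ∃ s, S = 2*s := by
      have i1 := Int.odd_iff.1 ((Int.odd_iff.2 hA).mul (Int.odd_iff.2 (podd 3 hZ)))
      have i2 := Int.odd_iff.1 ((Int.odd_iff.2 (podd 3 hA)).mul (Int.odd_iff.2 hZ))
      have i3 := podd 4 hA
      have i4 := podd 4 hZ
      have i5 : S = Z^4 + A*Z^3 - 6*(A^2*Z^2) + 7*(A^3*Z) + A^4 := by rw [hS]; ring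
      have : Even S := by rw [Int.even_iff]; omega
      obtain ⟨s, hs⟩ := this
      exact ⟨s, by omega⟩
    have hTe : ∃ s, T = 2*s := by
      have i2 := Int.odd_iff.1 ((Int.odd_iff.2 (podd 2 hA)).mul (Int.odd_iff.2 hZ))
      have i3 := podd 3 hA
      have i5 : T = 2*Z^3 + 4*(A*Z^2) - 9*(A^2*Z) + A^3 := by rw [hT]; ring
      have : Even T := by rw [Int.even_iff]; omega
      obtain ⟨s, hs⟩ := this
      exact ⟨s, by omega⟩
    obtain ⟨s, hs⟩ := hSe
    obtain ⟨t, ht⟩ := hTe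
    have hYe : Even Y := by
      have : Even (Y^2) := by rw [hE2, hs]; exact ⟨2*s^2 + 2*A^5*T, by ring⟩
      exact (Int.even_pow.1 this).1
    obtain ⟨u, hu⟩ := hYe
    have h8 : u^2 = s^2 + 2*(A^5*t) := by
      have : 4*(u^2) = 4*(s^2 + 2*(A^5*t)) := by
        rw [hs, ht, hu] at hE2; linear_combination hE2
      omega
    have h9 : Even (u - s) := by
      have : Even ((u - s)*(u - s)) := ⟨s^2 + A^5*t - u*s, by linear_combination h8⟩
      rcases Int.even_mul.1 this with h | h <;> exact h
    obtain ⟨c, hc⟩ := h9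
    have hrel : 4*c^2 + 2*c*S = A^5*T := by
      have hus : u = 2*c + s := by omega
      have : 2*(4*c^2 + 2*c*S) = 2*(A^5*T) := by
        rw [hs, ht]; rw [hus] at h8; linear_combination 2*h8
      omega
    refine seed2 (A := A) (Z := Z) (c := c) hA hZ ?_ (by rw [← hS, ← hT]; exact hrel)
    rintro rfl
    have hT0 : T = 0 := by
      have : A^5*T = 0 := by linear_combination -hrel
      rcases mul_eq_zero.1 this with h | h
      · exact absurd h (pow_ne_zero _ hA0)
      · exact h
    rw [hT0] at hT
    have hZ1 : IsUnit Z := by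
      have : Z ∣ A^3 := ⟨-(2*Z^2 + 4*A*Z - 9*A^2), by linear_combination -hT⟩
      exact (hcop.pow_left (m := 3)).isUnit_of_dvd' this dvd_rfl
    have hA1 : IsUnit A := by
      have : A ∣ 2*Z^3 := ⟨-(4*Z^2 - 9*A*Z + A^2), by linear_combination -hT⟩
      have h2 : A ∣ 2 := (hcop.pow_right (n := 3)).dvd_of_dvd_mul_right this
      have h3 : A ∣ 1 := by
        have := dvd_sub (dvd_refl A) (h2.mul_right a)
        rwa [show A - 2*a = 1 by omega] at this
      exact isUnit_of_dvd_one h3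
    rcases Int.isUnit_iff.1 hZ1 with rfl | rfl <;> rcases Int.isUnit_iff.1 hA1 with rfl | rfl <;> norm_num at hT


/-- Subsection 6.4: the affine rational points of
`y² = 5x⁸ - 22x⁷ + 53x⁶ - 74x⁵ + 52x⁴ + 2x³ - 11x² + 2x + 1` are exactly
`(0, 1)` and `(0, -1)`. -/
theorem stmt_15 :
    ∀ x y : ℚ,
      y ^ 2 = 5 * x ^ 8 - 22 * x ^ 7 + 53 * x ^ 6 - 74 * x ^ 5 + 52 * x ^ 4
          + 2 * x ^ 3 - 11 * x ^ 2 + 2 * x + 1 ↔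
        (x = 0 ∧ y = 1) ∨ (x = 0 ∧ y = -1) := by
  intro x y
  constructor
  · intro h
    have hx := final x y h
    subst hx
    have h1 : (y - 1) * (y + 1) = 0 := by linear_combination h
    rcases mul_eq_zero.1 h1 with h2 | h2
    · left; exact ⟨rfl, by linarith⟩
    · right; exact ⟨rfl, by linarith⟩
  · rintro (⟨rfl, rfl⟩ | ⟨rfl, rfl⟩) <;> norm_num
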